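/- arXiv:2501.18906 — 4 statements merged into one kernel-verified Lean document; each statement's English description precedes it below -/
import Mathlib

section
/- For every field F and every field k of characteristic p > 0, every continuous homomorphism ρ : Γ_F → GL_2(k) lifts to W₂(k): there exists a continuous homomorphism ρ̃ : Γ_F → GL_2(W₂(k)) with π ∘ ρ̃ = ρ. -/
open Matrix Topology

/-- The reduction ring homomorphism `π : W₂(k) → k` from the ring of `p`-typical length-`2`
Witt vectors of `k` to `k`, given by the zeroth Witt coefficient. -/
noncomputable def wittReduce (p : ℕ) [hp : Fact p.Prime] (k : Type*) [CommRing k] :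
    TruncatedWittVector p 2 k →+* k where
  toFun x := x.coeff 0
  map_one' := by
    show TruncatedWittVector.coeff 0 (1 : TruncatedWittVector p 2 k) = 1
    rw [show (1 : TruncatedWittVector p 2 k) = WittVector.truncate 2 (1 : WittVector p k) from
        (_root_.map_one _).symm, WittVector.coeff_truncate]
    simpa using WittVector.one_coeff_zero p k
  map_mul' x y := by
    show TruncatedWittVector.coeff 0 (x * y)
        = TruncatedWittVector.coeff 0 x * TruncatedWittVector.coeff 0 y
    obtain ⟨a, ha⟩ := WittVector.truncate_surjective (p := p) 2 k x
    obtain ⟨b, hb⟩ := WittVector.truncate_surjective (p := p) 2 k y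
    rw [← ha, ← hb, ← _root_.map_mul, WittVector.coeff_truncate, WittVector.coeff_truncate,
      WittVector.coeff_truncate]
    simpa using WittVector.mul_coeff_zero a b
  map_zero' := by
    show TruncatedWittVector.coeff 0 (0 : TruncatedWittVector p 2 k) = 0
    rw [show (0 : TruncatedWittVector p 2 k) = WittVector.truncate 2 (0 : WittVector p k) from
        (_root_.map_zero _).symm, WittVector.coeff_truncate]
    simpa using WittVector.zero_coeff p k 0
  map_add' x y := by
    show TruncatedWittVector.coeff 0 (x + y)
        = TruncatedWittVector.coeff 0 x + TruncatedWittVector.coeff 0 y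
    obtain ⟨a, ha⟩ := WittVector.truncate_surjective (p := p) 2 k x
    obtain ⟨b, hb⟩ := WittVector.truncate_surjective (p := p) 2 k y
    rw [← ha, ← hb, ← _root_.map_add, WittVector.coeff_truncate, WittVector.coeff_truncate,
      WittVector.coeff_truncate]
    simpa using WittVector.add_coeff_zero a b

theorem exists_lift_of_coprime_index {Γ E Q : Type*} [Group Γ] [Group E] [Group Q]
    (π : E →* Q) (hπ : Function.Surjective π) {p : ℕ} (hp : p.Prime)
    (hcomm : ∀ x ∈ π.ker, ∀ y ∈ π.ker, x * y = y * x) (hexp : ∀ x ∈ π.ker, x ^ p = 1)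
    (ρ : Γ →* Q) (U : Subgroup Γ) (hU : ¬ p ∣ U.index) (ρU : U →* E)
    (hρU : ∀ u : U, π (ρU u) = ρ u) (N : Subgroup Γ) [hN : N.Normal] (hNU : N ≤ U)
    (hNρ : ∀ u : U, (u : Γ) ∈ N → ρU u = 1) :
    ∃ ρ' : Γ →* E, π.comp ρ' = ρ ∧ N ≤ ρ'.ker := by
  classical
  have hidx : U.index ≠ 0 := fun h => hU (h ▸ dvd_zero p)
  have : U.FiniteIndex := ⟨hidx⟩
  let _ : Fintype (Γ ⧸ U) := U.fintypeQuotientOfFiniteIndex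
  let _ : CommGroup π.ker :=
    { (inferInstance : Group π.ker) with
      mul_comm := fun x y => Subtype.ext (hcomm x x.2 y y.2) }
  -- a set-theoretic lift that is right `U`-equivariant
  choose e he using fun q : Γ ⧸ U => hπ (ρ q.out)
  have hmem : ∀ g : Γ, (g : Γ ⧸ U).out⁻¹ * g ∈ U := fun g =>
    QuotientGroup.eq.1 (QuotientGroup.out_eq' (g : Γ ⧸ U))
  let s : Γ → E := fun g => e g * ρU ⟨_, hmem g⟩
  have hs : ∀ g, π (s g) = ρ g := fun g => by simp [s, he, hρU]
  have hsU : ∀ g (u : U), s (g * u) = s g * ρU u := fun g u => by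
    have hq : ((g * u : Γ) : Γ ⧸ U) = g := QuotientGroup.mk_mul_of_mem g u.2
    have : (⟨_, hmem (g * u)⟩ : U) = ⟨_, hmem g⟩ * u := Subtype.ext (by simp [hq, mul_assoc])
    simp only [s]
    rw [this, hq, map_mul, mul_assoc]
  have hsN : ∀ g, ∀ n ∈ N, s (g * n) = s g := fun g n hn => by
    rw [hsU g ⟨n, hNU hn⟩, hNρ _ hn, mul_one]
  have hsN' : ∀ g, ∀ n ∈ N, s (n * g) = s g := fun g n hn => by
    rw [← hsN g (g⁻¹ * n * g) (by simpa using hN.conj_mem n hn g⁻¹)]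
    congr 1
    group
  -- its defect, a two-cocycle with values in the kernel
  let f : Γ → Γ → π.ker := fun g h => ⟨s g * s h * (s (g * h))⁻¹, by
    simp [MonoidHom.mem_ker, hs]⟩
  have hfs : ∀ g h, (f g h : E) * s (g * h) = s g * s h := fun g h => by simp [f]
  have hfU : ∀ g h (u : U), f g (h * u) = f g h := fun g h u => Subtype.ext (by
    simp only [f]
    rw [← mul_assoc g h u, hsU, hsU]
    group)
  have hfout : ∀ g h, f g (QuotientGroup.mk h : Γ ⧸ U).out = f g h := fun g h => by
    conv_rhs => rw [← mul_inv_cancel_left (QuotientGroup.mk h : Γ ⧸ U).out h]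
    exact (hfU g _ ⟨_, hmem h⟩).symm
  have hcoc : ∀ g h l, f g h * f (g * h) l = MulAut.conjNormal (s g) (f h l) * f g (h * l) :=
    fun g h l => Subtype.ext (by
      simp only [f, Subgroup.coe_mul, MulAut.conjNormal_apply, mul_assoc g h l]
      group)
  obtain ⟨m, hm⟩ : ∃ m : ℕ, ∀ x : π.ker, (x ^ U.index) ^ m = x := by
    obtain ⟨m, -, hm⟩ := Nat.exists_mul_mod_eq_one_of_coprime
      ((Nat.Prime.coprime_iff_not_dvd hp).2 hU).symm hp.one_lt
    refine ⟨m, fun x => ?_⟩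
    have hx : x ^ p = 1 := Subtype.ext (hexp x x.2)
    rw [← pow_mul, ← Nat.div_add_mod (U.index * m) p, hm, pow_add, pow_mul, hx, one_pow, one_mul,
      pow_one]
  let c : Γ → π.ker := fun g => (∏ q : Γ ⧸ U, f g q.out) ^ m
  have hprod : ∀ x : π.ker, (∏ _q : Γ ⧸ U, x) ^ m = x := fun x => by
    rw [Finset.prod_const, Finset.card_univ, ← Nat.card_eq_fintype_card]
    exact hm x
  have hc : ∀ g h, f g h * c (g * h) = MulAut.conjNormal (s g) (c h) * c g := fun g h => by
    have hshift : ∏ q : Γ ⧸ U, f g q.out = ∏ q : Γ ⧸ U, f g (h * q.out) := by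
      rw [← Equiv.prod_comp (MulAction.toPerm h : Equiv.Perm (Γ ⧸ U))]
      refine Finset.prod_congr rfl fun q _ => ?_
      have : (h • q : Γ ⧸ U) = ((h * q.out : Γ) : Γ ⧸ U) := by
        conv_lhs => rw [← QuotientGroup.out_eq' q]
        rfl
      rw [MulAction.toPerm_apply, this, hfout]
    simp only [c]
    rw [hshift, map_pow, map_prod, ← mul_pow, ← Finset.prod_mul_distrib]
    simp_rw [← hcoc]
    rw [Finset.prod_mul_distrib, mul_pow, hprod]
  have hmul : ∀ g h, ((c (g * h))⁻¹ : E) * s (g * h) = (c g : E)⁻¹ * s g * ((c h : E)⁻¹ * s h) := by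
    intro g h
    have h1 := congrArg (fun x : π.ker => (x : E)) (hc g h)
    simp only [Subgroup.coe_mul, MulAut.conjNormal_apply] at h1
    have h3 : s (g * h) = (f g h : E)⁻¹ * (s g * s h) := by rw [← hfs]; group
    have h4 : (f g h : E) = s g * c h * (s g)⁻¹ * c g * (c (g * h) : E)⁻¹ := by
      rw [← h1]; group
    rw [h3, h4]; group
  refine ⟨MonoidHom.mk' (fun g => (c g : E)⁻¹ * s g) hmul, ?_, fun n hn => ?_⟩
  · ext g
    have : π (c g) = 1 := (c g).2
    simp [hs, this]
  · have hfn : ∀ h, f n h = ⟨s n, by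
        rw [MonoidHom.mem_ker, hs, ← hρU ⟨n, hNU hn⟩, hNρ _ hn, map_one]⟩ := fun h =>
      Subtype.ext (by simp only [f]; rw [hsN' h n hn]; group)
    have hcn : (c n : E) = s n := by simp only [c, hfn]; rw [hprod]
    simp [MonoidHom.mem_ker, hcn]

section GaloisDescent

variable {F Ω : Type*} [Field F] [Field Ω] [Algebra F Ω] {U : Subgroup Gal(Ω/F)} {X Y : Type*}

/-- `c u` depends only on the restriction of the automorphism `u` to `E`. -/
def FactorsThroughRestriction (E : IntermediateField F Ω) (c : U → X) : Prop :=
  ∀ u v : U, (∀ x ∈ E, (u : Gal(Ω/F)) x = (v : Gal(Ω/F)) x) → c u = c v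

/-- A function on a group of automorphisms is smooth if it only depends on the restriction of
automorphisms to some finite subextension. -/
def IsSmooth (c : U → X) : Prop :=
  ∃ E : IntermediateField F Ω, FiniteDimensional F E ∧ FactorsThroughRestriction E c

namespace FactorsThroughRestriction

theorem mono {E E' : IntermediateField F Ω} (h : E ≤ E') {c : U → X}
    (hc : FactorsThroughRestriction E c) : FactorsThroughRestriction E' c :=
  fun u v huv => hc u v fun x hx => huv x (h hx)

theorem mul_left {E : IntermediateField F Ω} {c : U → X} (hc : FactorsThroughRestriction E c)
    (w : U) : FactorsThroughRestriction E fun u => c (w * u) :=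
  fun _ _ huv => hc _ _ fun x hx => congrArg (w : Gal(Ω/F)) (huv x hx)

end FactorsThroughRestriction

namespace IsSmooth

theorem comp {c : U → X} (hc : IsSmooth c) (φ : X → Y) : IsSmooth fun u => φ (c u) := by
  obtain ⟨E, hE, h⟩ := hc
  exact ⟨E, hE, fun u v huv => congrArg φ (h u v huv)⟩

theorem pi {ι : Type*} [Finite ι] {X : ι → Type*} {c : ∀ i, U → X i} (hc : ∀ i, IsSmooth (c i)) :
    IsSmooth fun u i => c i u := by
  choose E hE h using hc
  exact ⟨⨆ i, E i, IntermediateField.finiteDimensional_iSup_of_finite,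
    fun u v huv => funext fun i => (h i).mono (le_iSup E i) u v huv⟩

theorem prodMk {c : U → X} {d : U → Y} (hc : IsSmooth c) (hd : IsSmooth d) :
    IsSmooth fun u => (c u, d u) := by
  obtain ⟨E, hE, h⟩ := hc
  obtain ⟨E', hE', h'⟩ := hd
  exact ⟨E ⊔ E', inferInstance, fun u v huv =>
    Prod.ext (h.mono le_sup_left u v huv) (h'.mono le_sup_right u v huv)⟩

theorem apply [Algebra.IsAlgebraic F Ω] (x : Ω) : IsSmooth fun u : U => (u : Gal(Ω/F)) x :=
  ⟨IntermediateField.adjoin F {x}, IntermediateField.adjoin.finiteDimensional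
    (Algebra.IsIntegral.isIntegral x), fun _ _ huv =>
      huv x (IntermediateField.mem_adjoin_simple_self F x)⟩

theorem exists_normal [Normal F Ω] {c : U → X} (hc : IsSmooth c) :
    ∃ E : IntermediateField F Ω, FiniteDimensional F E ∧ Normal F E ∧
      FactorsThroughRestriction E c := by
  obtain ⟨E, hE, h⟩ := hc
  exact ⟨IntermediateField.normalClosure F E Ω, inferInstance, inferInstance,
    h.mono E.le_normalClosure⟩

end IsSmooth

variable (U) in
/-- The elements of `U` acting trivially on `E`. -/
abbrev restrictionKer (E : IntermediateField F Ω) : Subgroup U := E.fixingSubgroup.subgroupOf U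

theorem mk_restrictionKer_eq_iff {E : IntermediateField F Ω} {u v : U} :
    (u : U ⧸ restrictionKer U E) = v ↔ ∀ x ∈ E, (u : Gal(Ω/F)) x = (v : Gal(Ω/F)) x := by
  rw [QuotientGroup.eq, Subgroup.mem_subgroupOf, IntermediateField.mem_fixingSubgroup_iff]
  refine forall₂_congr fun x _ => ?_
  rw [Subgroup.coe_mul, Subgroup.coe_inv, AlgEquiv.mul_apply,
    AlgEquiv.aut_inv, AlgEquiv.symm_apply_eq, eq_comm]

theorem FactorsThroughRestriction.apply_out {E : IntermediateField F Ω} {c : U → X}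
    (hc : FactorsThroughRestriction E c) (u : U) :
    c (QuotientGroup.mk u : U ⧸ restrictionKer U E).out = c u :=
  hc _ _ (mk_restrictionKer_eq_iff.1 (QuotientGroup.out_eq' _))

/-- The embedding of `E` into `Ω` given by a coset. -/
noncomputable def cosetEmbedding (E : IntermediateField F Ω) (q : U ⧸ restrictionKer U E) :
    E →ₐ[F] Ω := ((q.out : Gal(Ω/F)) : Ω →ₐ[F] Ω).comp E.val

theorem cosetEmbedding_injective (E : IntermediateField F Ω) :
    Function.Injective (cosetEmbedding (U := U) E) := fun q r h => by
  rw [← QuotientGroup.out_eq' q, ← QuotientGroup.out_eq' r, mk_restrictionKer_eq_iff]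
  exact fun x hx => DFunLike.congr_fun h (⟨x, hx⟩ : E)

instance (E : IntermediateField F Ω) [FiniteDimensional F E] :
    Finite (U ⧸ restrictionKer U E) :=
  Finite.of_injective _ (cosetEmbedding_injective E)

/-- Independence of characters, for the embeddings of `E` given by cosets. -/
theorem exists_sum_coset_ne_zero (E : IntermediateField F Ω) [Fintype (U ⧸ restrictionKer U E)]
    (c : U ⧸ restrictionKer U E → Ω) (hc : c ≠ 0) :
    ∃ a ∈ E, ∑ q, c q * (q.out : Gal(Ω/F)) a ≠ 0 := by
  by_contra! h
  have hinj : Function.Injective fun q : U ⧸ restrictionKer U E =>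
      ((cosetEmbedding E q : E →ₐ[F] Ω) : E →* Ω) := fun q r hqr =>
    cosetEmbedding_injective E (AlgHom.ext fun x => DFunLike.congr_fun hqr x)
  have hli := (linearIndependent_monoidHom E Ω).comp _ hinj
  refine hc (funext fun q => Fintype.linearIndependent_iff.1 hli c (funext fun x => ?_) q)
  simpa [Finset.sum_apply, cosetEmbedding] using h x x.2

theorem sum_coset_mul_left {E : IntermediateField F Ω} [Fintype (U ⧸ restrictionKer U E)]
    {φ : U → Ω} (hφ : FactorsThroughRestriction E φ) (w : U) :
    ∑ q : U ⧸ restrictionKer U E, φ (w * q.out) = ∑ q : U ⧸ restrictionKer U E, φ q.out := by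
  rw [← Equiv.sum_comp (MulAction.toPerm w : Equiv.Perm (U ⧸ restrictionKer U E)) fun q => φ q.out]
  refine Finset.sum_congr rfl fun q _ => ?_
  have : (w • q : U ⧸ restrictionKer U E) = QuotientGroup.mk (w * q.out) := by
    conv_lhs => rw [← QuotientGroup.out_eq' q]
    rfl
  rw [MulAction.toPerm_apply, this, hφ.apply_out]

/-- Hilbert 90 for the multiplicative group. -/
theorem IsSmooth.exists_ne_zero_mul_eq {c : U → Ω} (hc : IsSmooth c) (hc0 : ∀ u, c u ≠ 0)
    (hmul : ∀ u v : U, c (u * v) = c u * (u : Gal(Ω/F)) (c v)) :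
    ∃ x : Ω, x ≠ 0 ∧ ∀ u : U, c u * (u : Gal(Ω/F)) x = x := by
  obtain ⟨E, hE, h⟩ := hc
  have := Fintype.ofFinite (U ⧸ restrictionKer U E)
  obtain ⟨a, ha, hne⟩ := exists_sum_coset_ne_zero E
    (fun q : U ⧸ restrictionKer U E => c q.out) fun h0 =>
      hc0 _ (congrFun h0 (QuotientGroup.mk (1 : U)))
  have hφ : FactorsThroughRestriction E fun u : U => c u * (u : Gal(Ω/F)) a :=
    fun u v huv => by simp only [h u v huv, huv a ha]
  refine ⟨_, hne, fun u => ?_⟩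
  rw [map_sum, Finset.mul_sum]
  refine Eq.trans ?_ (sum_coset_mul_left hφ u)
  simp [hmul, mul_assoc]

/-- An equivariant partition of unity on the cosets of the stabiliser of a finite extension. -/
theorem exists_equivariant_sum_eq_one (E : IntermediateField F Ω)
    [Fintype (U ⧸ restrictionKer U E)] :
    ∃ ψ : U → Ω, FactorsThroughRestriction E ψ ∧
      (∀ u v : U, ψ (u * v) = (u : Gal(Ω/F)) (ψ v)) ∧
      ∑ q : U ⧸ restrictionKer U E, ψ q.out = 1 := by
  obtain ⟨a, ha, hne⟩ := exists_sum_coset_ne_zero E (1 : U ⧸ restrictionKer U E → Ω)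
    fun h0 => one_ne_zero (congrFun h0 (QuotientGroup.mk (1 : U)))
  have hφ : FactorsThroughRestriction E fun u : U => (u : Gal(Ω/F)) a :=
    fun u v huv => huv a ha
  set t := ∑ q : U ⧸ restrictionKer U E, (1 : U ⧸ restrictionKer U E → Ω) q *
    (q.out : Gal(Ω/F)) a with ht
  simp only [Pi.one_apply, one_mul] at ht
  have htU : ∀ u : U, (u : Gal(Ω/F)) t = t := fun u => by
    rw [ht, map_sum]
    refine Eq.trans ?_ (sum_coset_mul_left hφ u)
    simp
  refine ⟨fun u => t⁻¹ * (u : Gal(Ω/F)) a, fun u v huv => by simp only [huv a ha],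
    fun u v => by simp [htU], ?_⟩
  rw [← Finset.mul_sum, ← ht, inv_mul_cancel₀ hne]

/-- Hilbert 90 for the additive group. -/
theorem IsSmooth.exists_eq_sub {c : U → Ω} (hc : IsSmooth c)
    (hadd : ∀ u v : U, c (u * v) = c u + (u : Gal(Ω/F)) (c v)) :
    ∃ x : Ω, ∀ u : U, c u = x - (u : Gal(Ω/F)) x := by
  obtain ⟨E, hE, h⟩ := hc
  have := Fintype.ofFinite (U ⧸ restrictionKer U E)
  obtain ⟨ψ, hψ, hψU, hψ1⟩ := exists_equivariant_sum_eq_one (U := U) E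
  have hφ : FactorsThroughRestriction E fun u => c u * ψ u :=
    fun u v huv => by simp only [h u v huv, hψ u v huv]
  have hψ1' (u : U) : ∑ q : U ⧸ restrictionKer U E, ψ (u * q.out) = 1 :=
    (sum_coset_mul_left hψ u).trans hψ1
  refine ⟨∑ q : U ⧸ restrictionKer U E, c q.out * ψ q.out, fun u => ?_⟩
  have hφu := sum_coset_mul_left hφ u
  simp_rw [hadd, add_mul, Finset.sum_add_distrib, ← Finset.mul_sum, hψ1', hψU, ← map_mul,
    ← map_sum] at hφu
  linear_combination hφu

/-- Vanishing of the second cohomology of the additive group, for invariant cocycles. -/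
theorem exists_coboundary_eq [Normal F Ω] {f : U → U → Ω}
    (hf : IsSmooth f) (hf' : IsSmooth fun v u => f u v)
    (hfix : ∀ u v w : U, (w : Gal(Ω/F)) (f u v) = f u v)
    (hcoc : ∀ u v w, f v w + f u (v * w) = f (u * v) w + f u v) :
    ∃ g : U → Ω, IsSmooth g ∧ ∀ u v : U, g u + (u : Gal(Ω/F)) (g v) - g (u * v) = f u v := by
  obtain ⟨E, hE, hN, h⟩ := (hf.prodMk hf').exists_normal
  have := Fintype.ofFinite (U ⧸ restrictionKer U E)
  obtain ⟨ψ, hψ, hψU, hψ1⟩ := exists_equivariant_sum_eq_one (U := U) E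
  have hψ1' (u : U) : ∑ q : U ⧸ restrictionKer U E, ψ (u * q.out) = 1 :=
    (sum_coset_mul_left hψ u).trans hψ1
  have hmem (v : U) (x : Ω) (hx : x ∈ E) : (v : Gal(Ω/F)) x ∈ E := by
    have hv := AlgEquiv.restrictNormal_commutes (v : Gal(Ω/F)) E ⟨x, hx⟩
    exact hv ▸ Subtype.property _
  refine ⟨fun u => ∑ q : U ⧸ restrictionKer U E, f u q.out * ψ (u * q.out),
    ⟨E, hE, fun u v huv => Finset.sum_congr rfl fun q _ => ?_⟩, fun u v => ?_⟩
  · have h1 : f u = f v := (Prod.ext_iff.1 (h u v huv)).1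
    rw [h1, hψ (u * q.out) (v * q.out) fun x hx => ?_]
    exact huv _ (hmem _ x hx)
  · have hφ : FactorsThroughRestriction E fun w => f u w * ψ (u * w) := fun w w' hw => by
      have h2 : f u w = f u w' := congrFun (Prod.ext_iff.1 (h w w' hw)).2 u
      simp only [h2, hψ.mul_left u w w' hw]
    dsimp only
    rw [← sum_coset_mul_left hφ v, map_sum, ← Finset.sum_add_distrib, ← Finset.sum_sub_distrib]
    simp_rw [map_mul, hfix, ← hψU]
    rw [← mul_one (f u v), ← hψ1' (u * v), Finset.mul_sum]
    refine Finset.sum_congr rfl fun q _ => ?_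
    rw [← mul_assoc u v]
    linear_combination ψ (u * v * q.out) * hcoc u v q.out

end GaloisDescent

section TwistedLift

variable {F Ω : Type*} [Field F] [Field Ω] [Algebra F Ω] [IsAlgClosed Ω] [Algebra.IsAlgebraic F Ω]
  {U : Subgroup Gal(Ω/F)} {p : ℕ} [Fact p.Prime]

/-- By Kummer theory, additive characters modulo `p` lift to cocycles modulo `p ^ 2` with values
in the cyclotomic twist. -/
theorem exists_cyclotomic_lift (hpF : (p : Ω) ≠ 0)
    (hω : ∀ ω : Ω, ω ^ p = 1 → ∀ u : U, (u : Gal(Ω/F)) ω = ω) :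
    ∃ χ : U → ℕ, IsSmooth χ ∧ (∀ u, χ u ≡ 1 [MOD p]) ∧
      (∀ u v, χ (u * v) ≡ χ u * χ v [MOD p ^ 2]) ∧
      ∀ b : U → ZMod p, IsSmooth b → (∀ u v, b (u * v) = b u + b v) →
        ∃ B : U → ℕ, IsSmooth B ∧ (∀ u, (B u : ZMod p) = b u) ∧
          ∀ u v, B (u * v) ≡ B u + χ u * B v [MOD p ^ 2] := by
  have hp0 : p ≠ 0 := (Fact.out : p.Prime).ne_zero
  have : NeZero ((p ^ 2 : ℕ) : Ω) := ⟨by push_cast; exact pow_ne_zero 2 hpF⟩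
  have : NeZero (p ^ 2) := ⟨pow_ne_zero 2 hp0⟩
  have : NeZero (p : Ω) := ⟨hpF⟩
  obtain ⟨ζ, hζ⟩ := HasEnoughRootsOfUnity.exists_primitiveRoot Ω (p ^ 2)
  have hζ0 : ζ ≠ 0 := hζ.ne_zero (pow_ne_zero 2 hp0)
  have hroot : ∀ z : Ω, z ^ p ^ 2 = 1 → ∃ n : ℕ, ζ ^ n = z := fun z hz => by
    obtain ⟨n, -, hn⟩ := hζ.eq_pow_of_pow_eq_one hz
    exact ⟨n, hn⟩
  choose! φ hφ using hroot
  have hmod : ∀ {m n : ℕ}, ζ ^ m = ζ ^ n → m ≡ n [MOD p ^ 2] := fun {m n} h => by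
    rw [hζ.eq_orderOf]
    exact (hζ.isOfFinOrder (pow_ne_zero 2 hp0)).pow_eq_pow_iff_modEq.1 h
  have hmodp : ∀ {m n : ℕ}, ζ ^ (p * m) = ζ ^ (p * n) → m ≡ n [MOD p] := fun {m n} h =>
    Nat.ModEq.mul_left_cancel' hp0 (by rw [← sq]; exact hmod h)
  have hωp : (ζ ^ p) ^ p = 1 := by rw [← pow_mul, ← sq, hζ.pow_eq_one]
  have hχ : ∀ u : U, ζ ^ φ ((u : Gal(Ω/F)) ζ) = (u : Gal(Ω/F)) ζ := fun u =>
    hφ _ (by rw [← map_pow, hζ.pow_eq_one, map_one])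
  refine ⟨fun u => φ ((u : Gal(Ω/F)) ζ), (IsSmooth.apply ζ).comp φ, fun u => hmodp ?_,
    fun u v => hmod ?_, fun b hb hbadd => ?_⟩
  · rw [mul_comm, pow_mul, hχ, mul_one, ← map_pow, hω _ hωp]
  · rw [hχ, pow_mul, hχ, ← map_pow, hχ]
    simp
  · have hpow : ∀ m n : ℕ, (m : ZMod p) = n → (ζ ^ p) ^ m = (ζ ^ p) ^ n := fun m n h => by
      rw [ZMod.natCast_eq_natCast_iff] at h
      rw [← Nat.div_add_mod m p, ← Nat.div_add_mod n p, pow_add, pow_add, pow_mul, pow_mul _ p, hωp,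
        h, one_pow, one_pow]
    have hωb : ∀ (m : ℕ) (u : U), (u : Gal(Ω/F)) ((ζ ^ p) ^ m) = (ζ ^ p) ^ m := fun m u => by
      rw [map_pow, hω _ hωp]
    obtain ⟨x, hx0, hx⟩ := IsSmooth.exists_ne_zero_mul_eq (hb.comp fun i => (ζ ^ p) ^ i.val)
      (fun u => pow_ne_zero _ (pow_ne_zero _ hζ0)) fun u v => by
        rw [hωb, ← pow_add]
        exact hpow _ _ (by simp [hbadd])
    obtain ⟨y, hy⟩ := IsAlgClosed.exists_pow_nat_eq x⁻¹ (Nat.pos_of_ne_zero hp0)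
    have hy0 : y ≠ 0 := fun h => by
      rw [h, zero_pow hp0] at hy
      exact hx0 (inv_eq_zero.1 hy.symm)
    have hyp : ∀ u : U, ((u : Gal(Ω/F)) y / y) ^ p = (ζ ^ p) ^ (b u).val := fun u => by
      rw [div_pow, ← map_pow, hy, map_inv₀]
      have hux : (u : Gal(Ω/F)) x ≠ 0 := by simpa using hx0
      have := hx u
      field_simp
      rw [mul_comm]
      exact this.symm
    have hB : ∀ u : U, ζ ^ φ ((u : Gal(Ω/F)) y / y) = (u : Gal(Ω/F)) y / y := fun u =>
      hφ _ (by rw [sq, pow_mul, hyp, ← pow_mul, mul_comm, pow_mul, hωp, one_pow])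
    refine ⟨fun u => φ ((u : Gal(Ω/F)) y / y), (IsSmooth.apply y).comp fun z => φ (z / y),
      fun u => ?_, fun u v => hmod ?_⟩
    · rw [← ZMod.natCast_zmod_val (b u), ZMod.natCast_eq_natCast_iff]
      refine hmodp ?_
      rw [mul_comm, pow_mul, hB, hyp, pow_mul]
    · rw [hB, pow_add, hB, pow_mul, hχ, ← map_pow, hB]
      have huy : (u : Gal(Ω/F)) y ≠ 0 := by simpa using hy0
      simp
      field_simp

/-- By Artin-Schreier theory, additive characters modulo `p` lift modulo `p ^ 2` over fields of
characteristic `p`. -/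
theorem exists_charP_lift [CharP Ω p] {b : U → ZMod p} (hb : IsSmooth b)
    (hbadd : ∀ u v, b (u * v) = b u + b v) :
    ∃ B : U → ℕ, IsSmooth B ∧ (∀ u, (B u : ZMod p) = b u) ∧
      ∀ u v, B (u * v) ≡ B u + B v [MOD p ^ 2] := by
  have hp : p.Prime := Fact.out
  have : Normal F Ω := normal_iff.2 fun x => ⟨Algebra.IsIntegral.isIntegral x, IsAlgClosed.splits _⟩
  let carry : ZMod p → ZMod p → ℕ := fun i j => (i.val + j.val) / p
  have hcarry : ∀ i j, i.val + j.val = (i + j).val + p * carry i j := fun i j => by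
    rw [ZMod.val_add, Nat.mod_add_div]
  have hp' : ∀ {m n : ℕ}, p * m = p * n → m = n := fun h => Nat.eq_of_mul_eq_mul_left hp.pos h
  obtain ⟨g, hg, hgf⟩ := exists_coboundary_eq (F := F) (Ω := Ω)
    (f := fun u v => (carry (b u) (b v) : Ω))
    (hb.comp fun i v => (carry i (b v) : Ω)) (hb.comp fun j u => (carry (b u) j : Ω))
    (fun u v w => map_natCast _ _) fun u v w => by
      simp only [hbadd]
      rw [← Nat.cast_add, ← Nat.cast_add]
      refine congrArg _ (hp' ?_)
      have h1 := hcarry (b v) (b w)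
      have h2 := hcarry (b u) (b v + b w)
      have h3 := hcarry (b u + b v) (b w)
      have h4 := hcarry (b u) (b v)
      rw [← add_assoc] at h2
      rw [mul_add, mul_add]
      omega
  have hcp : ∀ n : ℕ, (n : Ω) ^ p = n := fun n => by
    rw [← frobenius_def, map_natCast]
  obtain ⟨x, hx⟩ := (hg.comp fun z => z ^ p - z).exists_eq_sub fun u v => by
    have h1 : g (u * v) = g u + (u : Gal(Ω/F)) (g v) - carry (b u) (b v) := by
      rw [← hgf]; ring
    rw [h1, sub_pow_char, add_pow_char, hcp, map_sub, map_pow]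
    ring
  obtain ⟨y, hy⟩ : ∃ y : Ω, y ^ p - y = x := by
    obtain ⟨y, hy⟩ := IsAlgClosed.exists_root (Polynomial.X ^ p - Polynomial.X - Polynomial.C x)
      (by
        rw [sub_sub]
        rw [Polynomial.degree_sub_eq_left_of_degree_lt]
        · simp [hp.ne_zero]
        · rw [Polynomial.degree_X_add_C, Polynomial.degree_X_pow]
          exact_mod_cast hp.one_lt)
    exact ⟨y, by simpa [sub_eq_zero] using hy⟩
  have hmem : ∀ z : Ω, z ^ p = z → ∃ n : ZMod p, (n.val : Ω) = z := fun z hz => by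
    rw [← Subfield.mem_bot_iff_pow_eq_self (F := Ω) (p := p)] at hz
    obtain ⟨n, hn⟩ := (bot_le : ⊥ ≤ (ZMod.castHom dvd_rfl Ω).fieldRange) hz
    exact ⟨n, by rw [ZMod.natCast_val, ← hn, ZMod.castHom_apply]⟩
  choose! c hc using hmem
  let d : U → Ω := fun u => y - (u : Gal(Ω/F)) y - g u
  have hd : ∀ u, ((c (d u)).val : Ω) = d u := fun u => hc _ (by
    have := hx u
    simp only [← hy, map_sub, map_pow] at this
    simp only [d, sub_pow_char]
    linear_combination -this)
  have hdadd : ∀ u v : U, d (u * v) = d u + d v + carry (b u) (b v) := fun u v => by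
    have h1 : (u : Gal(Ω/F)) (d v) = d v := by rw [← hd v, map_natCast]
    rw [← h1, ← hgf]
    simp [d]
    ring
  refine ⟨fun u => (b u).val + p * (c (d u)).val,
    ((hb.prodMk ((IsSmooth.apply y).prodMk hg)).comp fun z : ZMod p × Ω × Ω =>
      z.1.val + p * (c (y - z.2.1 - z.2.2)).val), fun u => by simp, fun u v => ?_⟩
  have key : (c (d (u * v))).val ≡ (c (d u)).val + (c (d v)).val + carry (b u) (b v) [MOD p] := by
    rw [← CharP.natCast_eq_natCast Ω p]
    push_cast
    rw [hd, hd, hd, hdadd]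
  have := (key.mul_left' p).add_left (b u + b v).val
  have h2 := hcarry (b u) (b v)
  simp only [sq, hbadd]
  refine this.trans (congrArg (· % (p * p)) ?_)
  rw [mul_add, mul_add]
  omega

end TwistedLift

section TruncatedWitt

variable (p : ℕ) [Fact p.Prime] (k : Type*)

theorem wittReduce_truncate [CommRing k] (x : WittVector p k) :
    wittReduce p k (WittVector.truncate 2 x) = x.coeff 0 :=
  WittVector.coeff_truncate x 0

theorem wittReduce_surjective [CommRing k] : Function.Surjective (wittReduce p k) := fun a =>
  ⟨WittVector.truncate 2 (WittVector.teichmuller p a), by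
    rw [wittReduce_truncate, WittVector.teichmuller_coeff_zero]⟩

variable {p k}

theorem truncate_two_eq_zero [CommRing k] {x : WittVector p k} (h0 : x.coeff 0 = 0)
    (h1 : x.coeff 1 = 0) : WittVector.truncate 2 x = 0 := by
  rw [← RingHom.mem_ker, WittVector.mem_ker_truncate]
  intro i hi
  interval_cases i <;> assumption

theorem natCast_mul_eq_zero_of_wittReduce_eq_zero [CommRing k] [CharP k p]
    {x : TruncatedWittVector p 2 k} (hx : wittReduce p k x = 0) :
    (p : TruncatedWittVector p 2 k) * x = 0 := by
  obtain ⟨a, rfl⟩ := WittVector.truncate_surjective p 2 k x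
  rw [wittReduce_truncate] at hx
  rw [mul_comm, ← map_natCast (WittVector.truncate (p := p) (R := k) 2), ← map_mul]
  refine truncate_two_eq_zero (WittVector.mul_charP_coeff_zero a) ?_
  rw [← zero_add 1, WittVector.mul_charP_coeff_succ, hx, zero_pow (Fact.out : p.Prime).ne_zero]

theorem mul_eq_zero_of_wittReduce_eq_zero [CommRing k] [CharP k p]
    {x y : TruncatedWittVector p 2 k} (hx : wittReduce p k x = 0) (hy : wittReduce p k y = 0) :
    x * y = 0 := by
  obtain ⟨a, rfl⟩ := WittVector.truncate_surjective p 2 k x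
  obtain ⟨b, rfl⟩ := WittVector.truncate_surjective p 2 k y
  rw [wittReduce_truncate] at hx hy
  have hV : ∀ c : WittVector p k, c.coeff 0 = 0 → WittVector.verschiebung (c.shift 1) = c :=
    fun c hc => (WittVector.verschiebung_shift c 0 fun i hi => by
      rwa [Nat.lt_one_iff.1 hi]).trans (WittVector.ext fun i => by simp [WittVector.shift_coeff])
  rw [← map_mul, ← hV a hx, ← WittVector.verschiebung_mul_frobenius, ← hV b hy,
    WittVector.frobenius_verschiebung, ← mul_assoc]
  refine truncate_two_eq_zero (WittVector.verschiebung_coeff_zero _) ?_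
  rw [WittVector.verschiebung_coeff_succ _ 0, WittVector.mul_charP_coeff_zero]

end TruncatedWitt

section SquareZero

variable {R S : Type*} [CommRing R] [CommRing S] {f : R →+* S}

theorem RingHom.isLocalHom_of_mul_eq_zero (hf : Function.Surjective f)
    (h0 : ∀ x y, f x = 0 → f y = 0 → x * y = 0) : IsLocalHom f := ⟨fun x hx => by
  obtain ⟨z, hz⟩ := hx.exists_right_inv
  obtain ⟨y, rfl⟩ := hf z
  have he : f (x * y - 1) = 0 := by simp [hz]
  refine IsUnit.of_mul_eq_one (y * (2 - x * y)) ?_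
  linear_combination -(h0 _ _ he he)⟩

variable {n : Type*} [Fintype n] [DecidableEq n]

theorem Matrix.GeneralLinearGroup.map_surjective_of_isLocalHom [IsLocalHom f]
    (hf : Function.Surjective f) :
    Function.Surjective (Matrix.GeneralLinearGroup.map (n := n) f) := fun g => by
  choose t ht using hf
  have hM : f.mapMatrix (g.1.map t) = g.1 := by
    ext i j
    simp [ht]
  have hdet : IsUnit (g.1.map t).det := by
    refine isUnit_of_map_unit f _ ?_
    rw [RingHom.map_det, hM]
    exact (Matrix.isUnit_iff_isUnit_det _).1 g.isUnit
  exact ⟨Matrix.GeneralLinearGroup.mk'' _ hdet, Units.ext hM⟩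

theorem Matrix.GeneralLinearGroup.map_sub_one_of_mem_ker {g : GL n R}
    (hg : g ∈ (Matrix.GeneralLinearGroup.map (n := n) f).ker) (i j : n) :
    f ((g.1 - 1) i j) = 0 := by
  have h := congrArg (fun h : GL n S => h.1 i j) (MonoidHom.mem_ker.1 hg)
  have h' : f (g.1 i j) = (1 : Matrix n n S) i j := h
  rw [Matrix.sub_apply, map_sub, h', Matrix.one_apply, Matrix.one_apply]
  split_ifs <;> simp

theorem Matrix.GeneralLinearGroup.sub_one_mul_sub_one_of_mem_ker
    (h0 : ∀ x y, f x = 0 → f y = 0 → x * y = 0) {g h : GL n R}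
    (hg : g ∈ (Matrix.GeneralLinearGroup.map (n := n) f).ker)
    (hh : h ∈ (Matrix.GeneralLinearGroup.map (n := n) f).ker) : (g.1 - 1) * (h.1 - 1) = 0 := by
  ext i j
  rw [Matrix.mul_apply, Matrix.zero_apply]
  exact Finset.sum_eq_zero fun l _ =>
    h0 _ _ (map_sub_one_of_mem_ker hg i l) (map_sub_one_of_mem_ker hh l j)

theorem Matrix.GeneralLinearGroup.mul_comm_of_mem_ker
    (h0 : ∀ x y, f x = 0 → f y = 0 → x * y = 0) {g h : GL n R}
    (hg : g ∈ (Matrix.GeneralLinearGroup.map (n := n) f).ker)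
    (hh : h ∈ (Matrix.GeneralLinearGroup.map (n := n) f).ker) : g * h = h * g := by
  refine Units.ext (sub_eq_zero.1 ?_)
  calc g.1 * h.1 - h.1 * g.1 = (g.1 - 1) * (h.1 - 1) - (h.1 - 1) * (g.1 - 1) := by noncomm_ring
    _ = 0 := by
      rw [sub_one_mul_sub_one_of_mem_ker h0 hg hh, sub_one_mul_sub_one_of_mem_ker h0 hh hg, sub_zero]

theorem Matrix.GeneralLinearGroup.pow_eq_one_of_mem_ker
    (h0 : ∀ x y, f x = 0 → f y = 0 → x * y = 0) {p : ℕ} (hp : ∀ x, f x = 0 → (p : R) * x = 0)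
    {g : GL n R} (hg : g ∈ (Matrix.GeneralLinearGroup.map (n := n) f).ker) : g ^ p = 1 := by
  have hpow : ∀ m : ℕ, g.1 ^ m = 1 + (m : Matrix n n R) * (g.1 - 1) := fun m => by
    induction m with
    | zero => simp
    | succ m ih =>
      calc g.1 ^ (m + 1) = (1 + (m : Matrix n n R) * (g.1 - 1)) * (1 + (g.1 - 1)) := by
            rw [pow_succ, ih, add_sub_cancel]
        _ = 1 + ((m + 1 : ℕ) : Matrix n n R) * (g.1 - 1)
              + m * ((g.1 - 1) * (g.1 - 1)) := by
            push_cast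
            noncomm_ring
        _ = 1 + ((m + 1 : ℕ) : Matrix n n R) * (g.1 - 1) := by
            rw [sub_one_mul_sub_one_of_mem_ker h0 hg hg, mul_zero, add_zero]
  refine Units.ext ?_
  rw [Units.val_pow_eq_pow_val, hpow, Units.val_one, add_eq_left]
  ext i j
  rw [← nsmul_eq_mul, Matrix.smul_apply, nsmul_eq_mul, hp _ (map_sub_one_of_mem_ker hg i j),
    Matrix.zero_apply]

end SquareZero

/-- A `p`-group of matrices in characteristic `p` has a nonzero fixed vector. -/
theorem exists_ne_zero_mulVec_eq {p : ℕ} [Fact p.Prime] {k n G : Type*} [Field k] [CharP k p]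
    [Fintype n] [DecidableEq n] [Nonempty n] [Group G] [Finite G] (hG : IsPGroup p G)
    (σ : G →* GL n k) : ∃ v : n → k, v ≠ 0 ∧ ∀ g, (σ g).1 *ᵥ v = v := by
  let _ : Algebra (ZMod p) k := ZMod.algebra k p
  let s : Set (n → k) := Set.range fun g => (σ g).1 *ᵥ 1
  let V := Submodule.span (ZMod p) s
  have : FiniteDimensional (ZMod p) V := FiniteDimensional.span_of_finite _ (Set.finite_range _)
  have : Finite V := Module.finite_of_finite (ZMod p)
  have hV : ∀ (g : G) (v : n → k), v ∈ V → (σ g).1 *ᵥ v ∈ V := fun g v hv => by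
    induction hv using Submodule.span_induction with
    | mem x hx =>
      obtain ⟨h, rfl⟩ := hx
      refine Submodule.subset_span ⟨g * h, ?_⟩
      simp [Matrix.mulVec_mulVec]
    | zero => simp
    | add x y _ _ hx hy => rw [Matrix.mulVec_add]; exact add_mem hx hy
    | smul a x _ hx => rw [Matrix.mulVec_smul]; exact V.smul_mem a hx
  let _ : MulAction G V :=
    { smul := fun g v => ⟨(σ g).1 *ᵥ v, hV g v v.2⟩
      one_smul := fun v => Subtype.ext (by
        change (σ 1).1 *ᵥ v.1 = v.1
        simp)
      mul_smul := fun g h v => Subtype.ext (by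
        change (σ (g * h)).1 *ᵥ v.1 = (σ g).1 *ᵥ ((σ h).1 *ᵥ v.1)
        simp [Matrix.mulVec_mulVec]) }
  have h1 : (1 : n → k) ∈ V := Submodule.subset_span ⟨1, by simp⟩
  have : Nontrivial V := ⟨0, ⟨1, h1⟩, fun h => zero_ne_one (congrArg Subtype.val h)⟩
  have hcard : p ∣ Nat.card V := by
    rw [Module.natCard_eq_pow_finrank (K := ZMod p), Nat.card_zmod]
    exact dvd_pow_self p Module.finrank_pos.ne'
  obtain ⟨v, hv, hv0⟩ := hG.exists_fixed_point_of_prime_dvd_card_of_fixed_point V hcard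
    (a := 0) fun g => Subtype.ext (Matrix.mulVec_zero _)
  exact ⟨v, fun h => hv0 (Subtype.ext h.symm), fun g => congrArg Subtype.val (hv g)⟩

theorem exists_gl_two_mulVec_eq {k : Type*} [Field k] {v : Fin 2 → k} (hv : v ≠ 0) :
    ∃ A : GL (Fin 2) k, A.1 *ᵥ ![1, 0] = v := by
  by_cases h0 : v 0 = 0
  · have h1 : v 1 ≠ 0 := fun h1 => hv (by ext i; fin_cases i <;> assumption)
    refine ⟨Matrix.GeneralLinearGroup.mkOfDetNeZero !![v 0, 1; v 1, 0] (by simpa using h1), ?_⟩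
    ext i
    fin_cases i <;> simp [Matrix.GeneralLinearGroup.mkOfDetNeZero]
  · refine ⟨Matrix.GeneralLinearGroup.mkOfDetNeZero !![v 0, 0; v 1, 1] (by simpa using h0), ?_⟩
    ext i
    fin_cases i <;> simp [Matrix.GeneralLinearGroup.mkOfDetNeZero]

section Lift

variable {F Ω : Type*} [Field F] [Field Ω] [Algebra F Ω] {U : Subgroup Gal(Ω/F)} {p : ℕ}
  [Fact p.Prime]

theorem IsSmooth.finite_range {X : Type*} {c : U → X} (hc : IsSmooth c) :
    (Set.range c).Finite := by
  obtain ⟨E, hE, h⟩ := hc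
  refine (Set.finite_range fun q : U ⧸ restrictionKer U E => c q.out).subset ?_
  rintro _ ⟨u, rfl⟩
  exact ⟨QuotientGroup.mk u, h.apply_out u⟩

/-- An automorphism, some `p`-power of which fixes a `p`-th root of unity, fixes it itself. -/
theorem apply_eq_of_pow_apply_eq {σ : Gal(Ω/F)} {ω : Ω} (hω : ω ^ p = 1) {n : ℕ}
    (hσ : (σ ^ p ^ n) ω = ω) : σ ω = ω := by
  by_cases h1 : ω = 1
  · rw [h1, map_one]
  have hprim : IsPrimitiveRoot ω p := orderOf_eq_prime hω h1 ▸ IsPrimitiveRoot.orderOf ω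
  have : NeZero p := ⟨(Fact.out : p.Prime).ne_zero⟩
  obtain ⟨j, -, hj⟩ := hprim.eq_pow_of_pow_eq_one (ξ := σ ω) (by rw [← map_pow, hω, map_one])
  have hpow : ∀ m : ℕ, (σ ^ m) ω = ω ^ j ^ m := fun m => by
    induction m with
    | zero => simp
    | succ m ih => rw [pow_succ, AlgEquiv.mul_apply, ← hj, map_pow, ih, ← pow_mul, pow_succ]
  have hmod : j ^ p ^ n ≡ j [MOD p] := by
    rw [← ZMod.natCast_eq_natCast_iff, Nat.cast_pow, ZMod.pow_card_pow]
  have hpow' : ω ^ j ^ p ^ n = ω ^ j :=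
    (hprim.isOfFinOrder NeZero.out).pow_eq_pow_iff_modEq.2 (by rwa [← hprim.eq_orderOf])
  rw [← hj, ← hpow', ← hpow, hσ]

variable [IsAlgClosed Ω] [Algebra.IsAlgebraic F Ω]

theorem exists_twisted_lift (hω : ∀ ω : Ω, ω ^ p = 1 → ∀ u : U, (u : Gal(Ω/F)) ω = ω) :
    ∃ χ : U → ℕ, IsSmooth χ ∧ (∀ u, χ u ≡ 1 [MOD p]) ∧
      (∀ u v, χ (u * v) ≡ χ u * χ v [MOD p ^ 2]) ∧
      ∀ b : U → ZMod p, IsSmooth b → (∀ u v, b (u * v) = b u + b v) →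
        ∃ B : U → ℕ, IsSmooth B ∧ (∀ u, (B u : ZMod p) = b u) ∧
          ∀ u v, B (u * v) ≡ B u + χ u * B v [MOD p ^ 2] := by
  by_cases hpF : (p : Ω) = 0
  · have : CharP Ω p := CharP.ringChar_of_prime_eq_zero Fact.out hpF ▸ inferInstance
    refine ⟨fun _ => 1, ⟨⊥, inferInstance, fun _ _ _ => rfl⟩, fun _ => rfl, fun _ _ => rfl,
      fun b hb hbadd => ?_⟩
    simpa only [one_mul] using exists_charP_lift hb hbadd
  · exact exists_cyclotomic_lift hpF hω

variable {k : Type*} [Field k] [CharP k p]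

theorem natCast_eq_of_modEq_sq {m n : ℕ} (h : m ≡ n [MOD p ^ 2]) :
    (m : TruncatedWittVector p 2 k) = n := by
  have hp : ((p ^ 2 : ℕ) : TruncatedWittVector p 2 k) = 0 := by
    rw [Nat.cast_pow, sq]
    exact natCast_mul_eq_zero_of_wittReduce_eq_zero (by simp)
  rw [← Nat.div_add_mod m (p ^ 2), ← Nat.div_add_mod n (p ^ 2), h]
  simp [hp]

instance : IsLocalHom (wittReduce p k) :=
  RingHom.isLocalHom_of_mul_eq_zero (wittReduce_surjective p k)
    fun _ _ => mul_eq_zero_of_wittReduce_eq_zero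

/-- A character and a cocycle define an upper triangular representation. -/
theorem exists_hom_eq_upperTriangular {G R : Type*} [Group G] [CommRing R] {X Y : G → R}
    (hX1 : X 1 = 1) (hX : ∀ u v, X (u * v) = X u * X v) (hY1 : Y 1 = 0)
    (hY : ∀ u v, Y (u * v) = Y u + X u * Y v) :
    ∃ M : G →* GL (Fin 2) R, ∀ u, (M u).1 = !![X u, Y u; 0, 1] := by
  let M : G →* Matrix (Fin 2) (Fin 2) R :=
    { toFun := fun u => !![X u, Y u; 0, 1]
      map_one' := by rw [hX1, hY1, Matrix.one_fin_two]
      map_mul' := fun u v => by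
        rw [Matrix.mul_fin_two, hX, hY]
        simp [add_comm] }
  exact ⟨M.toHomUnits, fun _ => rfl⟩

/-- Upper unipotent representations lift, if the `p`-th roots of unity are invariant. -/
theorem exists_unipotent_lift (hω : ∀ ω : Ω, ω ^ p = 1 → ∀ u : U, (u : Gal(Ω/F)) ω = ω)
    {b : U → k} (hb : IsSmooth b) (hbadd : ∀ u v, b (u * v) = b u + b v) :
    ∃ M : U →* GL (Fin 2) (TruncatedWittVector p 2 k), IsSmooth M ∧
      ∀ u, (Matrix.GeneralLinearGroup.map (wittReduce p k) (M u)).1 = !![1, b u; 0, 1] := by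
  obtain ⟨χ, hχ, hχ1, hχmul, hlift⟩ := exists_twisted_lift hω
  let _ : Algebra (ZMod p) k := ZMod.algebra k p
  let V := Submodule.span (ZMod p) (Set.range b)
  have : FiniteDimensional (ZMod p) V := FiniteDimensional.span_of_finite _ hb.finite_range
  let e := Module.finBasis (ZMod p) V
  let b' : U → V := fun u => ⟨b u, Submodule.subset_span ⟨u, rfl⟩⟩
  have hb' : IsSmooth b' := by
    obtain ⟨E, hE, h⟩ := hb
    exact ⟨E, hE, fun u v huv => Subtype.ext (h u v huv)⟩
  have hb'add : ∀ u v, b' (u * v) = b' u + b' v := fun u v => Subtype.ext (hbadd u v)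
  choose B hB hBb hBmul using fun i => hlift (fun u => e.repr (b' u) i)
    (hb'.comp fun v => e.repr v i) fun u v => by simp [hb'add]
  choose t ht using wittReduce_surjective p k
  let X : U → TruncatedWittVector p 2 k := fun u => χ u
  let Y : U → TruncatedWittVector p 2 k := fun u => ∑ i, B i u * t (e i)
  have hXred : ∀ u, wittReduce p k (X u) = 1 := fun u => by
    have := (CharP.natCast_eq_natCast k p).2 (hχ1 u)
    simpa [X] using this
  have hYred : ∀ u, wittReduce p k (Y u) = b u := fun u => by
    have h1 : ((∑ i, e.repr (b' u) i • e i : V) : k) = b u := by rw [e.sum_repr]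
    rw [← h1]
    simp only [Y, map_sum, map_mul, map_natCast, ht, Submodule.coe_sum, ← hBb]
    refine Finset.sum_congr rfl fun i _ => ?_
    rw [Nat.cast_smul_eq_nsmul, AddSubmonoidClass.coe_nsmul, nsmul_eq_mul]
  have hXmul : ∀ u v, X (u * v) = X u * X v := fun u v => by
    simpa using natCast_eq_of_modEq_sq (p := p) (k := k) (hχmul u v)
  have hYmul : ∀ u v, Y (u * v) = Y u + X u * Y v := fun u v => by
    simp only [Y, Finset.mul_sum, ← Finset.sum_add_distrib]
    refine Finset.sum_congr rfl fun i _ => ?_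
    have := natCast_eq_of_modEq_sq (p := p) (k := k) (hBmul i u v)
    push_cast at this
    rw [this]
    ring
  have hX1u : IsUnit (X 1) := isUnit_of_map_unit (wittReduce p k) _ (by simp [hXred])
  have hX1 : X 1 = 1 := hX1u.mul_left_cancel (by rw [← hXmul, mul_one, mul_one])
  have hY1 : Y 1 = 0 := by simpa [hX1] using hYmul 1 1
  obtain ⟨M, hMu⟩ := exists_hom_eq_upperTriangular hX1 hXmul hY1 hYmul
  refine ⟨M, ?_, fun u => ?_⟩
  · have hM : IsSmooth fun u => (χ u, fun i => B i u) := hχ.prodMk (IsSmooth.pi hB)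
    obtain ⟨E, hE, h⟩ := hM
    refine ⟨E, hE, fun u v huv => Units.ext ?_⟩
    obtain ⟨h1, h2⟩ := Prod.ext_iff.1 (h u v huv)
    have hX : X u = X v := congrArg Nat.cast h1
    have hY : Y u = Y v := Finset.sum_congr rfl fun i _ => by
      have : B i u = B i v := congrFun h2 i
      rw [this]
    rw [hMu, hMu, hX, hY]
  · change (M u).1.map (wittReduce p k) = _
    rw [hMu]
    ext i j
    fin_cases i <;> fin_cases j <;> simp [hXred, hYred]

/-- Smooth representations with image a `p`-group lift, if the `p`-th roots of unity are
invariant. -/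
theorem exists_lift_of_isPGroup (hω : ∀ ω : Ω, ω ^ p = 1 → ∀ u : U, (u : Gal(Ω/F)) ω = ω)
    (σ : U →* GL (Fin 2) k) (hσ : IsSmooth σ) (hp : ∀ u, ∃ n : ℕ, σ u ^ p ^ n = 1) :
    ∃ ρ : U →* GL (Fin 2) (TruncatedWittVector p 2 k), IsSmooth ρ ∧
      ∀ u, Matrix.GeneralLinearGroup.map (wittReduce p k) (ρ u) = σ u := by
  have : Finite σ.range := hσ.finite_range.to_subtype
  have hG : IsPGroup p σ.range := by
    rintro ⟨_, u, rfl⟩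
    obtain ⟨n, hn⟩ := hp u
    exact ⟨n, Subtype.ext hn⟩
  obtain ⟨v, hv0, hv⟩ := exists_ne_zero_mulVec_eq hG σ.range.subtype
  obtain ⟨A, rfl⟩ := exists_gl_two_mulVec_eq hv0
  let τ : U →* GL (Fin 2) k := (MulAut.conj A⁻¹).toMonoidHom.comp σ
  have hτσ : ∀ u, σ u = A * τ u * A⁻¹ := fun u => by
    simp only [τ, MonoidHom.comp_apply, MulEquiv.coe_toMonoidHom, MulAut.conj_apply]
    group
  have hτe : ∀ u, (τ u).1 *ᵥ ![1, 0] = ![1, 0] := fun u => by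
    have h1 : (σ u).1 *ᵥ (A.1 *ᵥ ![1, 0]) = A.1 *ᵥ ![1, 0] := hv ⟨σ u, u, rfl⟩
    have h2 : τ u = A⁻¹ * (σ u * A) := by rw [hτσ]; group
    rw [h2, Units.val_mul, Units.val_mul, ← Matrix.mulVec_mulVec, ← Matrix.mulVec_mulVec, h1,
      Matrix.mulVec_mulVec, ← Units.val_mul, inv_mul_cancel, Units.val_one, Matrix.one_mulVec]
  have hτ00 : ∀ u, (τ u).1 0 0 = 1 := fun u => by
    simpa [Matrix.mulVec, dotProduct] using congrFun (hτe u) 0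
  have hτ10 : ∀ u, (τ u).1 1 0 = 0 := fun u => by
    simpa [Matrix.mulVec, dotProduct] using congrFun (hτe u) 1
  have hτmul : ∀ u v i j, (τ (u * v)).1 i j = (τ u).1 i 0 * (τ v).1 0 j + (τ u).1 i 1 * (τ v).1 1 j :=
    fun u v i j => by rw [map_mul, Units.val_mul, Matrix.mul_apply, Fin.sum_univ_two]
  let d : U →* k :=
    { toFun := fun u => (τ u).1 1 1
      map_one' := by simp
      map_mul' := fun u v => by rw [hτmul, hτ10, zero_mul, zero_add] }
  have hτ11 : ∀ u, (τ u).1 1 1 = 1 := fun u => by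
    obtain ⟨n, hn⟩ := hp u
    have h1 : τ (u ^ p ^ n) = 1 := by
      change MulAut.conj A⁻¹ (σ (u ^ p ^ n)) = 1
      rw [map_pow σ, hn, map_one]
    have h2 : d u ^ p ^ n = 1 := by
      rw [← map_pow]
      change (τ (u ^ p ^ n)).1 1 1 = 1
      rw [h1]
      simp
    have h3 : (d u - 1) ^ p ^ n = 0 := by rw [sub_pow_char_pow, h2, one_pow, sub_self]
    exact sub_eq_zero.1 (pow_eq_zero_iff (pow_ne_zero n (Fact.out : p.Prime).ne_zero) |>.1 h3)
  have hτ : IsSmooth τ := hσ.comp (MulAut.conj A⁻¹)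
  obtain ⟨M, hM, hMτ⟩ := exists_unipotent_lift hω (b := fun u => (τ u).1 0 1)
    (hτ.comp fun g => g.1 0 1) fun u v => by rw [hτmul, hτ00, hτ11]; ring
  obtain ⟨A', rfl⟩ := Matrix.GeneralLinearGroup.map_surjective_of_isLocalHom
    (wittReduce_surjective p k) A
  refine ⟨(MulAut.conj A').toMonoidHom.comp M, hM.comp (MulAut.conj A'), fun u => ?_⟩
  have hMτ' : Matrix.GeneralLinearGroup.map (wittReduce p k) (M u) = τ u := Units.ext (by
    rw [hMτ]
    ext i j
    fin_cases i <;> fin_cases j <;> simp [hτ00, hτ10, hτ11])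
  rw [hτσ, ← hMτ']
  simp

theorem exists_lift_of_fixingSubgroup_le (ρ : Gal(Ω/F) →* GL (Fin 2) k) (E : IntermediateField F Ω)
    [FiniteDimensional F E] (hE : E.fixingSubgroup ≤ ρ.ker) :
    ∃ ρ' : Gal(Ω/F) →* GL (Fin 2) (TruncatedWittVector p 2 k),
      (Matrix.GeneralLinearGroup.map (wittReduce p k)).comp ρ' = ρ ∧
      ∃ L : IntermediateField F Ω, FiniteDimensional F L ∧ L.fixingSubgroup ≤ ρ'.ker := by
  classical
  have hp : p.Prime := Fact.out
  have : Normal F Ω := normal_iff.2 fun x => ⟨Algebra.IsIntegral.isIntegral x, IsAlgClosed.splits _⟩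
  let R : Set Ω := ↑(Polynomial.nthRoots p (1 : Ω)).toFinset
  have hR : ∀ ω : Ω, ω ^ p = 1 → ω ∈ R := fun ω hω => by
    simpa [R, Polynomial.mem_nthRoots hp.pos] using hω
  let E' : IntermediateField F Ω := E ⊔ IntermediateField.adjoin F R
  have : FiniteDimensional F (IntermediateField.adjoin F R) :=
    IntermediateField.finiteDimensional_adjoin fun x _ => Algebra.IsIntegral.isIntegral x
  let L : IntermediateField F Ω := IntermediateField.normalClosure F E' Ω
  have hEL : E' ≤ L := E'.le_normalClosure
  let r : Gal(Ω/F) →* Gal(L/F) := AlgEquiv.restrictNormalHom L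
  have hr : r.ker = L.fixingSubgroup := IntermediateField.restrictNormalHom_ker L
  have hrsurj : Function.Surjective r := AlgEquiv.restrictNormalHom_surjective Ω
  let P : Sylow p Gal(L/F) := default
  let U : Subgroup Gal(Ω/F) := (P : Subgroup Gal(L/F)).comap r
  have hU : ¬ p ∣ U.index := by
    rw [Subgroup.index_comap_of_surjective _ hrsurj]
    exact P.not_dvd_index
  have hUp : ∀ u : U, ∃ n : ℕ, (u : Gal(Ω/F)) ^ p ^ n ∈ L.fixingSubgroup := fun u => by
    obtain ⟨n, hn⟩ := P.isPGroup' ⟨r u, u.2⟩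
    refine ⟨n, ?_⟩
    rw [← hr, MonoidHom.mem_ker, map_pow]
    exact congrArg Subtype.val hn
  have hLρ : L.fixingSubgroup ≤ ρ.ker :=
    (IntermediateField.fixingSubgroup_antitone (le_sup_left.trans hEL)).trans hE
  have hω : ∀ ω : Ω, ω ^ p = 1 → ∀ u : U, (u : Gal(Ω/F)) ω = ω := fun ω hω u => by
    obtain ⟨n, hn⟩ := hUp u
    have hωL : ω ∈ L := hEL ((le_sup_right : _ ≤ E') (IntermediateField.subset_adjoin F R (hR ω hω)))
    exact apply_eq_of_pow_apply_eq hω ((IntermediateField.mem_fixingSubgroup_iff _ _).1 hn ω hωL)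
  have hσ : IsSmooth (ρ.comp U.subtype) := ⟨E, inferInstance, fun u v huv => by
    have h := mk_restrictionKer_eq_iff.2 huv
    rw [QuotientGroup.eq, Subgroup.mem_subgroupOf] at h
    have h1 : ρ ((u : Gal(Ω/F))⁻¹ * v) = 1 := hE h
    rw [map_mul, map_inv, inv_mul_eq_one] at h1
    exact h1⟩
  obtain ⟨ρU, ⟨E₁, hE₁, h₁⟩, hρU⟩ := exists_lift_of_isPGroup hω (ρ.comp U.subtype) hσ fun u => by
    obtain ⟨n, hn⟩ := hUp u
    have h1 : ρ ((u : Gal(Ω/F)) ^ p ^ n) = 1 := hLρ hn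
    exact ⟨n, by simpa using h1⟩
  let L' : IntermediateField F Ω := IntermediateField.normalClosure F (L ⊔ E₁ : IntermediateField F Ω) Ω
  have hL' : L ⊔ E₁ ≤ L' := IntermediateField.le_normalClosure _
  have hnormal : L'.fixingSubgroup.Normal := by
    rw [← IntermediateField.restrictNormalHom_ker L']
    infer_instance
  have h0 : ∀ x y, wittReduce p k x = 0 → wittReduce p k y = 0 → x * y = 0 :=
    fun _ _ => mul_eq_zero_of_wittReduce_eq_zero
  obtain ⟨ρ', hρ', hN⟩ := exists_lift_of_coprime_index
    (Matrix.GeneralLinearGroup.map (n := Fin 2) (wittReduce p k))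
    (Matrix.GeneralLinearGroup.map_surjective_of_isLocalHom (wittReduce_surjective p k)) hp
    (fun _ hx _ hy => Matrix.GeneralLinearGroup.mul_comm_of_mem_ker h0 hx hy)
    (fun _ hx => Matrix.GeneralLinearGroup.pow_eq_one_of_mem_ker h0
      (fun _ => natCast_mul_eq_zero_of_wittReduce_eq_zero) hx)
    ρ U hU ρU hρU L'.fixingSubgroup
    (fun g hg => by
      have h1 : g ∈ r.ker := hr ▸
        IntermediateField.fixingSubgroup_antitone (le_sup_left.trans hL') hg
      exact Subgroup.mem_comap.2 ((MonoidHom.mem_ker.1 h1) ▸ one_mem _))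
    (fun u hu => (h₁ u 1 fun x hx =>
      (IntermediateField.mem_fixingSubgroup_iff _ _).1 hu x (hL' (le_sup_right (a := L) hx))).trans
        (map_one ρU))
  exact ⟨ρ', hρ', L', inferInstance, hN⟩

end Lift

/-- Khare, De Clercq–Florence. For every field `F` and every field `k`
of characteristic `p > 0`, every continuous homomorphism `Γ_F → GL₂(k)` lifts to `W₂(k)`. -/
theorem gl_two_lifts (p : ℕ) [Fact p.Prime] (F : Type) [Field F] (k : Type) [Field k] [CharP k p]
    (ρ : Field.absoluteGaloisGroup F →* GL (Fin 2) k) (hρ : Continuous[_, ⊥] ⇑ρ) :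
    ∃ ρ' : Field.absoluteGaloisGroup F →* GL (Fin 2) (TruncatedWittVector p 2 k),
      Continuous[_, ⊥] ⇑ρ' ∧ (Matrix.GeneralLinearGroup.map (wittReduce p k)).comp ρ' = ρ := by
  have hopen : IsOpen (ρ ⁻¹' {1}) := @Continuous.isOpen_preimage _ _ _ ⊥ _ hρ {1} trivial
  obtain ⟨E, hE, hEρ⟩ := (krullTopology_mem_nhds_one_iff F (AlgebraicClosure F) _).1
    (hopen.mem_nhds (map_one ρ))
  obtain ⟨ρ', hρ', L, hL, hLρ⟩ := exists_lift_of_fixingSubgroup_le (p := p) (k := k)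
    (F := F) (Ω := AlgebraicClosure F) ρ E hEρ
  refine ⟨ρ', ?_, hρ'⟩
  let _ : TopologicalSpace (GL (Fin 2) (TruncatedWittVector p 2 k)) := ⊥
  have : DiscreteTopology (GL (Fin 2) (TruncatedWittVector p 2 k)) := ⟨rfl⟩
  have hcont : Continuous ρ' := by
    refine continuous_of_continuousAt_one ρ' ?_
    rw [ContinuousAt, map_one, nhds_discrete (GL _ _), Filter.tendsto_pure]
    exact Filter.mem_of_superset ((IntermediateField.fixingSubgroup_isOpen L).mem_nhds (one_mem _))
      hLρ
  exact hcont
end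

section
/- For every field F and every field k of characteristic p > 0, every continuous homomorphism ρ : Γ_F → B_2(k) lifts to W₂(k): there exists a continuous homomorphism ρ̃ : Γ_F → B_2(W₂(k)) with π ∘ ρ̃ = ρ. -/
open Matrix Topology

/-- `B_n(R)`: the Borel subgroup of `GL_n(R)` consisting of the invertible upper-triangular
`n × n` matrices over `R`. -/
def BorelSubgroup (n : ℕ) (R : Type*) [CommRing R] : Subgroup (GL (Fin n) R) where
  carrier := {A | ((A : Matrix (Fin n) (Fin n) R)).BlockTriangular id}
  one_mem' := by
    show ((1 : GL (Fin n) R) : Matrix (Fin n) (Fin n) R).BlockTriangular id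
    simpa using Matrix.blockTriangular_one
  mul_mem' := by
    intro A B hA hB
    show ((A * B : GL (Fin n) R) : Matrix (Fin n) (Fin n) R).BlockTriangular id
    simpa [Units.val_mul] using hA.mul hB
  inv_mem' := by
    intro A hA
    show ((A⁻¹ : GL (Fin n) R) : Matrix (Fin n) (Fin n) R).BlockTriangular id
    rw [Matrix.coe_units_inv]
    letI := A.invertible
    exact Matrix.blockTriangular_inv_of_blockTriangular hA

/-- The group homomorphism `B_n(R) → B_n(S)` induced by a ring homomorphism `R → S`. -/
def BorelSubgroup.map {n : ℕ} {R S : Type*} [CommRing R] [CommRing S] (f : R →+* S) :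
    BorelSubgroup n R →* BorelSubgroup n S where
  toFun A := ⟨Matrix.GeneralLinearGroup.map f A.1, by
    have hA := A.2
    intro i j hij
    show ((Matrix.GeneralLinearGroup.map f A.1 : GL (Fin n) S) : Matrix (Fin n) (Fin n) S) i j = 0
    show ((A.1 : Matrix (Fin n) (Fin n) R).map f) i j = 0
    rw [Matrix.map_apply, hA hij, map_zero]⟩
  map_one' := Subtype.ext (_root_.map_one _)
  map_mul' A B := Subtype.ext (_root_.map_mul _ _ _)

namespace TruncatedWittVector

variable {p : ℕ} [Fact p.Prime] {R S : Type*} [CommRing R] [CommRing S]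

theorem map_aux (n : ℕ) (f : R →+* S) (a : WittVector p R)
    (ha : WittVector.truncate n a = 0) :
    WittVector.truncate n (WittVector.map f a) = 0 := by
  ext i
  have h := congrArg (TruncatedWittVector.coeff i) ha
  rw [WittVector.coeff_truncate, TruncatedWittVector.coeff_zero] at h
  rw [WittVector.coeff_truncate, WittVector.map_coeff, h, _root_.map_zero,
    TruncatedWittVector.coeff_zero]

/-- Functoriality of truncated Witt vectors. -/
noncomputable def map (n : ℕ) (f : R →+* S) :
    TruncatedWittVector p n R →+* TruncatedWittVector p n S :=
  (WittVector.truncate n).liftOfRightInverse (TruncatedWittVector.out (p := p))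
    (fun x => TruncatedWittVector.truncateFun_out x)
    ⟨(WittVector.truncate n).comp (WittVector.map f), fun a ha => map_aux n f a ha⟩

theorem map_truncate (n : ℕ) (f : R →+* S) (a : WittVector p R) :
    map n f (WittVector.truncate n a) = WittVector.truncate n (WittVector.map f a) :=
  RingHom.liftOfRightInverse_comp_apply _ _ _ _ _

@[simp]
theorem coeff_map (n : ℕ) (f : R →+* S) (x : TruncatedWittVector p n R) (i : Fin n) :
    (map n f x).coeff i = f (x.coeff i) := by
  obtain ⟨a, rfl⟩ := WittVector.truncate_surjective (p := p) n R x
  rw [map_truncate, WittVector.coeff_truncate, WittVector.coeff_truncate, WittVector.map_coeff]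

theorem map_injective (n : ℕ) {f : R →+* S} (hf : Function.Injective f) :
    Function.Injective (map (p := p) n f) := fun x y h => by
  ext i
  exact hf (by simpa using congrArg (TruncatedWittVector.coeff i) h)

theorem exists_map_eq (n : ℕ) (f : R →+* S) (x : TruncatedWittVector p n S)
    (hx : ∀ i, ∃ r, f r = x.coeff i) : ∃ y, map n f y = x := by
  choose r hr using hx
  refine ⟨TruncatedWittVector.mk p r, ?_⟩
  ext i
  rw [coeff_map, TruncatedWittVector.coeff_mk, hr]

variable (p R) in
/-- The Teichmüller lift to Witt vectors of length two. -/
noncomputable def teichmullerTwo :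
    R →* TruncatedWittVector p 2 R :=
  ((WittVector.truncate 2 : WittVector p R →+* _) : WittVector p R →* _).comp
    (WittVector.teichmuller p)

theorem wittReduce_teichmullerTwo (r : R) : wittReduce p R (teichmullerTwo p R r) = r := by
  change TruncatedWittVector.coeff 0 (WittVector.truncate 2 (WittVector.teichmuller p r)) = r
  rw [WittVector.coeff_truncate]
  exact WittVector.teichmuller_coeff_zero p r

variable (p R) in
/-- The embedding of the additive group of `R` as the kernel of the reduction on Witt vectors
of length two. -/
noncomputable def verschiebungTwo :
    R →+ TruncatedWittVector p 2 R where
  toFun r := WittVector.truncate 2 (WittVector.verschiebung (WittVector.teichmuller p r))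
  map_zero' := by simp
  map_add' r s := by
    rw [← _root_.map_add, ← _root_.map_add]
    ext i
    rw [WittVector.coeff_truncate, WittVector.coeff_truncate]
    fin_cases i
    · exact (WittVector.verschiebung_coeff_zero _).trans (WittVector.verschiebung_coeff_zero _).symm
    · change WittVector.coeff _ (0 + 1) = WittVector.coeff _ (0 + 1)
      rw [WittVector.verschiebung_coeff_add_one, WittVector.verschiebung_coeff_add_one,
        WittVector.add_coeff_zero]
      simp

@[simp]
theorem coeff_zero_verschiebungTwo (r : R) :
    (verschiebungTwo p R r).coeff 0 = 0 := by
  change TruncatedWittVector.coeff 0 (WittVector.truncate 2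
    (WittVector.verschiebung (WittVector.teichmuller p r))) = _
  rw [WittVector.coeff_truncate]
  simp

@[simp]
theorem coeff_one_verschiebungTwo (r : R) : (verschiebungTwo p R r).coeff 1 = r := by
  change TruncatedWittVector.coeff 1 (WittVector.truncate 2
    (WittVector.verschiebung (WittVector.teichmuller p r))) = _
  rw [WittVector.coeff_truncate]
  exact (WittVector.verschiebung_coeff_add_one _ 0).trans (WittVector.teichmuller_coeff_zero p r)

theorem exists_verschiebungTwo_eq (x : TruncatedWittVector p 2 R)
    (hx : wittReduce p R x = 0) :
    ∃ r, verschiebungTwo p R r = x :=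
  ⟨x.coeff 1, by
    ext i
    fin_cases i
    · exact (coeff_zero_verschiebungTwo _).trans hx.symm
    · exact coeff_one_verschiebungTwo _⟩

theorem map_verschiebungTwo (f : R →+* S) (r : R) :
    map 2 f (verschiebungTwo p R r) = verschiebungTwo p S (f r) := by
  ext i; fin_cases i <;> simp

theorem map_teichmullerTwo (f : R →+* S) (r : R) :
    map 2 f (teichmullerTwo p R r) = teichmullerTwo p S (f r) := by
  change map 2 f (WittVector.truncate 2 (WittVector.teichmuller p r)) =
    WittVector.truncate 2 (WittVector.teichmuller p (f r))
  rw [map_truncate, WittVector.map_teichmuller]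

theorem wittReduce_map (f : R →+* S) (x : TruncatedWittVector p 2 R) :
    wittReduce p S (map 2 f x) = f (wittReduce p R x) :=
  coeff_map 2 f x 0

variable (p R) in
/-- The canonical ring homomorphism from `ZMod (p ^ 2)` to the Witt vectors of length two over a
ring of characteristic `p`. -/
noncomputable def ofZMod [CharP R p] :
    ZMod (p ^ 2) →+* TruncatedWittVector p 2 R :=
  (map 2 (ZMod.castHom dvd_rfl R)).comp (TruncatedWittVector.zmodEquivTrunc p 2).toRingHom

theorem wittReduce_ofZMod [CharP R p] (x : ZMod (p ^ 2)) :
    wittReduce p R (ofZMod p R x) =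
      ZMod.castHom dvd_rfl R (ZMod.castHom (dvd_pow_self p two_ne_zero) (ZMod p) x) :=
  DFunLike.congr_fun (Subsingleton.elim ((wittReduce p R).comp (ofZMod p R))
    ((ZMod.castHom dvd_rfl R).comp (ZMod.castHom (dvd_pow_self p two_ne_zero) (ZMod p)))) x

theorem ofZMod_injective {K : Type*} [Field K] [CharP K p] :
    Function.Injective (ofZMod p K) :=
  (map_injective (p := p) 2 (RingHom.injective (ZMod.castHom dvd_rfl K))).comp
    (TruncatedWittVector.zmodEquivTrunc p 2).injective

theorem exists_castHom_eq_of_pow_eq {K : Type*} [Field K] [CharP K p] (x : K) (hx : x ^ p = x) :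
    ∃ r : ZMod p, ZMod.castHom dvd_rfl K r = x := by
  have h := (Subfield.mem_bot_iff_pow_eq_self K p).2 hx
  rw [← ZMod.fieldRange_castHom_eq_bot p] at h
  exact h

end TruncatedWittVector
section Galois

variable {F Ω : Type*} [Field F] [Field Ω] [Algebra F Ω]

theorem isLocallyConstant_galois_apply [Algebra.IsAlgebraic F Ω] (x : Ω) :
    IsLocallyConstant fun σ : Gal(Ω/F) => σ x := by
  refine (IsLocallyConstant.iff_exists_open _).2 fun σ =>
    ⟨(fun τ => σ⁻¹ * τ) ⁻¹' (MulAction.stabilizer Gal(Ω/F) x : Set Gal(Ω/F)),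
      (stabilizer_isOpen_of_isIntegral x).preimage (continuous_const_mul _), ?_, fun τ hτ => ?_⟩
  · simp
  · have h : (σ⁻¹ * τ) x = x := hτ
    have := congrArg σ h
    rwa [← AlgEquiv.mul_apply, mul_inv_cancel_left] at this

theorem finiteIndex_of_isOpen_galois (U : Subgroup Gal(Ω/F)) (hU : IsOpen (U : Set Gal(Ω/F))) :
    U.FiniteIndex := by
  obtain ⟨E, _, hE⟩ := (krullTopology_mem_nhds_one_iff F Ω _).1 (hU.mem_nhds U.one_mem)
  have hf : Function.Injective fun q : Gal(Ω/F) ⧸ E.fixingSubgroup =>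
      (((q.out : Gal(Ω/F)) : Ω →ₐ[F] Ω).comp E.val) := by
    intro q r h
    rw [← q.out_eq', ← r.out_eq', QuotientGroup.eq, IntermediateField.mem_fixingSubgroup_iff]
    intro x hx
    have := DFunLike.congr_fun h (⟨x, hx⟩ : E)
    change q.out x = r.out x at this
    rw [AlgEquiv.mul_apply, ← this, ← AlgEquiv.mul_apply, inv_mul_cancel,
      AlgEquiv.one_apply]
  have : Finite (Gal(Ω/F) ⧸ E.fixingSubgroup) := Finite.of_injective _ hf
  have : E.fixingSubgroup.FiniteIndex := Subgroup.finiteIndex_of_finite_quotient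
  exact Subgroup.finiteIndex_of_le hE

/-- A uniform form of Hilbert's theorem 90: the averages `A y g` over the embeddings induced by
`N` of a finite subextension translate under `N` via the homomorphism `c`. -/
theorem exists_average {M : Type*} [AddGroup M] (N : Subgroup Gal(Ω/F)) (c : Gal(Ω/F) → M)
    (hc : IsLocallyConstant c) (hadd : ∀ σ ∈ N, ∀ τ ∈ N, c (σ * τ) = c σ + c τ) :
    ∃ (E : IntermediateField F Ω) (A : E → (M → Ω) →ₗ[Ω] Ω),
      (∀ g : M → Ω, g 0 ≠ 0 → ∃ y, A y g ≠ 0) ∧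
      ∀ g : M → Ω, (∀ r, ∀ σ ∈ N, σ (g r) = g r) →
        ∀ σ ∈ N, ∀ y, σ (A y g) = A y fun r => g (-c σ + r) := by
  classical
  have hc1 : c 1 = 0 := by simpa using hadd 1 N.one_mem 1 N.one_mem
  have hcinv : ∀ σ ∈ N, c σ⁻¹ = -c σ := fun σ hσ => by
    rw [eq_neg_iff_add_eq_zero, ← hadd _ (N.inv_mem hσ) _ hσ, inv_mul_cancel, hc1]
  obtain ⟨E, _, hE⟩ := (krullTopology_mem_nhds_one_iff F Ω _).1
    ((hc.isOpen_fiber 0).mem_nhds (x := 1) hc1)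
  let res : Gal(Ω/F) → (E →ₐ[F] Ω) := fun σ => (σ : Ω →ₐ[F] Ω).comp E.val
  have hres : ∀ σ ∈ N, ∀ τ ∈ N, res σ = res τ → c σ = c τ := by
    intro σ hσ τ hτ h
    have hmem : σ⁻¹ * τ ∈ E.fixingSubgroup := by
      rw [IntermediateField.mem_fixingSubgroup_iff]
      intro x hx
      have := DFunLike.congr_fun h (⟨x, hx⟩ : E)
      change σ x = τ x at this
      rw [AlgEquiv.mul_apply, ← this, ← AlgEquiv.mul_apply, inv_mul_cancel,
        AlgEquiv.one_apply]
    have h0 : c (σ⁻¹ * τ) = 0 := hE hmem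
    rwa [hadd _ (N.inv_mem hσ) _ hτ, hcinv _ hσ, neg_add_eq_zero] at h0
  let T := {φ : E →ₐ[F] Ω // ∃ σ ∈ N, res σ = φ}
  have : Fintype T := Fintype.ofFinite T
  choose s hs hsφ using fun φ : T => φ.2
  refine ⟨E, fun y => ∑ φ : T, φ.1 y • LinearMap.proj (c (s φ)), fun g hg => ?_,
    fun g hg σ hσ y => ?_⟩
  · by_contra! h
    have hli := (linearIndependent_monoidHom E Ω).comp (fun φ : T => (φ.1 : E →* Ω))
      fun φ ψ h => Subtype.ext (AlgHom.ext fun x => DFunLike.congr_fun h x)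
    have h0 := Fintype.linearIndependent_iff.1 hli (fun φ => g (c (s φ))) (by
      ext y
      simpa [mul_comm, Finset.sum_apply] using h y) ⟨res 1, 1, N.one_mem, rfl⟩
    apply hg
    rwa [hres _ (hs _) 1 N.one_mem (hsφ _), hc1] at h0
  · let e : T → T := fun φ => ⟨res (σ * s φ), _, N.mul_mem hσ (hs φ), rfl⟩
    have he : ∀ φ x, (e φ).1 x = σ (φ.1 x) := fun φ x => by
      conv_rhs => rw [← hsφ φ]
      rfl
    have hinj : Function.Injective e := fun φ ψ h => Subtype.ext <| AlgHom.ext fun x =>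
      σ.injective (by rw [← he, ← he, h])
    have hce : ∀ φ, c (s (e φ)) = c σ + c (s φ) := fun φ => by
      rw [← hadd _ hσ _ (hs φ)]
      exact hres _ (hs _) _ (N.mul_mem hσ (hs φ)) (hsφ _)
    simp only [LinearMap.sum_apply, LinearMap.smul_apply, LinearMap.proj_apply, smul_eq_mul,
      map_sum, map_mul]
    refine Eq.trans ?_ ((Finite.injective_iff_bijective.1 hinj).sum_comp _)
    refine Finset.sum_congr rfl fun φ _ => ?_
    rw [he, hce, neg_add_cancel_left, hg _ _ hσ]

section RootsOfUnity

variable {n : ℕ} {ζ : Ω}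

theorem pow_val_mul (hζ : ζ ^ n = 1) (a b : ZMod n) :
    ζ ^ (a * b).val = (ζ ^ a.val) ^ b.val := by
  rw [ZMod.val_mul, ← pow_mul, ← pow_eq_pow_mod _ hζ]

variable [NeZero n]

theorem pow_val_add (hζ : ζ ^ n = 1) (a b : ZMod n) :
    ζ ^ (a + b).val = ζ ^ a.val * ζ ^ b.val := by
  rw [ZMod.val_add, ← pow_add, ← pow_eq_pow_mod _ hζ]

theorem IsPrimitiveRoot.pow_val_injective (hζ : IsPrimitiveRoot ζ n) :
    Function.Injective fun a : ZMod n => ζ ^ a.val := fun a b h =>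
  ZMod.val_injective n (hζ.pow_inj (ZMod.val_lt a) (ZMod.val_lt b) h)

theorem IsPrimitiveRoot.exists_pow_val_eq (hζ : IsPrimitiveRoot ζ n) {x : Ω} (hx : x ^ n = 1) :
    ∃ a : ZMod n, ζ ^ a.val = x := by
  obtain ⟨i, hi, rfl⟩ := hζ.eq_pow_of_pow_eq_one hx
  exact ⟨i, by rw [ZMod.val_cast_of_lt hi]⟩

theorem pow_val_castHom {m : ℕ} [NeZero m] (hmn : m ∣ n) (hζ : ζ ^ m = 1) (a : ZMod n) :
    ζ ^ (ZMod.castHom hmn (ZMod m) a).val = ζ ^ a.val := by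
  rw [ZMod.castHom_apply, ZMod.cast_eq_val, ZMod.val_natCast, ← pow_eq_pow_mod _ hζ]

end RootsOfUnity

variable {p : ℕ} [Fact p.Prime]

theorem exists_cocycle_lift_of_isPrimitiveRoot [IsAlgClosed Ω] [Algebra.IsAlgebraic F Ω] {ζ : Ω}
    (hζ : IsPrimitiveRoot ζ (p ^ 2)) (N : Subgroup Gal(Ω/F))
    (hN : ∀ σ ∈ N, ZMod.castHom (dvd_pow_self p two_ne_zero) (ZMod p)
      (hζ.autToPow F σ : ZMod (p ^ 2)) = 1)
    (c : Gal(Ω/F) → ZMod p) (hc : IsLocallyConstant c)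
    (hadd : ∀ σ ∈ N, ∀ τ ∈ N, c (σ * τ) = c σ + c τ) :
    ∃ C : Gal(Ω/F) → ZMod (p ^ 2), IsLocallyConstant C ∧
      (∀ σ ∈ N, ∀ τ ∈ N, C (σ * τ) = C σ + (hζ.autToPow F σ : ZMod (p ^ 2)) * C τ) ∧
      ∀ σ ∈ N, ZMod.castHom (dvd_pow_self p two_ne_zero) (ZMod p) (C σ) = c σ := by
  classical
  have hp : p ≠ 0 := (Fact.out : p.Prime).ne_zero
  have hξ : IsPrimitiveRoot (ζ ^ p) p := hζ.pow (pow_ne_zero 2 hp).bot_lt (sq p)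
  have hfix : ∀ σ ∈ N, σ (ζ ^ p) = ζ ^ p := fun σ hσ => by
    rw [map_pow, ← hζ.autToPow_spec F σ, pow_right_comm, ← pow_val_castHom
      (dvd_pow_self p two_ne_zero) hξ.pow_eq_one, hN σ hσ, ZMod.val_one, pow_one]
  obtain ⟨E, A, hA0, hA⟩ := exists_average N c hc hadd
  have hg : ∀ r : ZMod p, (ζ ^ p) ^ (-r).val ≠ 0 := fun r =>
    pow_ne_zero _ (hξ.ne_zero hp)
  obtain ⟨y, hy⟩ := hA0 (fun r => (ζ ^ p) ^ (-r).val) (hg 0)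
  obtain ⟨b, hb⟩ := IsAlgClosed.exists_pow_nat_eq (A y fun r => (ζ ^ p) ^ (-r).val) hp.bot_lt
  rw [← hb] at hy
  have hb0 : b ≠ 0 := fun h => hy (by rw [h, zero_pow hp])
  have hσb : ∀ σ ∈ N, σ b ^ p = (ζ ^ p) ^ (c σ).val * b ^ p := by
    intro σ hσ
    rw [← map_pow, hb, hA _ (fun r τ hτ => by rw [map_pow, hfix τ hτ]) σ hσ, ← smul_eq_mul,
      ← map_smul]
    congr 1
    ext r
    rw [Pi.smul_apply, smul_eq_mul, ← pow_val_add hξ.pow_eq_one, neg_add_rev, neg_neg, add_comm]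
  let f : Ω → ZMod (p ^ 2) := fun x =>
    if h : ∃ r : ZMod (p ^ 2), ζ ^ r.val = x / b then h.choose else 0
  have hf : ∀ σ ∈ N, σ b = ζ ^ (f (σ b)).val * b := by
    intro σ hσ
    have h : ∃ r : ZMod (p ^ 2), ζ ^ r.val = σ b / b := by
      apply hζ.exists_pow_val_eq
      rw [sq, pow_mul, div_pow, hσb σ hσ, mul_div_assoc, div_self hy, mul_one, pow_right_comm,
        hξ.pow_eq_one, one_pow]
    rw [show f (σ b) = h.choose from dif_pos h, h.choose_spec, div_mul_cancel₀ _ hb0]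
  refine ⟨fun σ => f (σ b), (isLocallyConstant_galois_apply b).comp f, fun σ hσ τ hτ => ?_,
    fun σ hσ => ?_⟩
  · apply hζ.pow_val_injective
    apply mul_right_cancel₀ hb0
    simp only
    have h : (σ * τ) b = σ (ζ ^ (f (τ b)).val * b) := congrArg σ (hf τ hτ)
    rw [← hf _ (N.mul_mem hσ hτ), h, map_mul, map_pow, ← hζ.autToPow_spec F σ,
      ← pow_val_mul hζ.pow_eq_one, pow_val_add hζ.pow_eq_one]
    conv_lhs => rw [hf σ hσ]
    ring
  · apply hξ.pow_val_injective
    apply mul_right_cancel₀ hy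
    simp only
    rw [← hσb σ hσ, pow_val_castHom _ hξ.pow_eq_one, pow_right_comm, ← mul_pow, ← hf σ hσ]

open TruncatedWittVector in
theorem exists_hom_lift_of_charP [IsAlgClosed Ω] [Algebra.IsAlgebraic F Ω] [CharP Ω p]
    (N : Subgroup Gal(Ω/F)) (c : Gal(Ω/F) → ZMod p) (hc : IsLocallyConstant c)
    (hadd : ∀ σ ∈ N, ∀ τ ∈ N, c (σ * τ) = c σ + c τ) :
    ∃ C : Gal(Ω/F) → ZMod (p ^ 2), IsLocallyConstant C ∧
      (∀ σ ∈ N, ∀ τ ∈ N, C (σ * τ) = C σ + C τ) ∧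
      ∀ σ ∈ N, ZMod.castHom (dvd_pow_self p two_ne_zero) (ZMod p) (C σ) = c σ := by
  classical
  have hp : p.Prime := Fact.out
  obtain ⟨E, A, hA0, hA⟩ := exists_average N c hc hadd
  let j : ZMod p →+* Ω := ZMod.castHom dvd_rfl Ω
  have hj : ∀ (σ : Gal(Ω/F)) r, σ (j r) = j r := fun σ r =>
    DFunLike.congr_fun (Subsingleton.elim ((σ : Ω →+* Ω).comp j) j) r
  obtain ⟨y, hy⟩ := hA0 (fun _ => 1) one_ne_zero
  obtain ⟨a, ha⟩ : ∃ a : Ω, ∀ σ ∈ N, σ a = a + j (c σ) := by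
    refine ⟨-A y j / A y fun _ => 1, fun σ hσ => ?_⟩
    rw [map_div₀, map_neg, hA _ (fun r τ _ => hj τ r) σ hσ, hA _ (fun r τ _ => map_one τ) σ hσ]
    have h : (fun r => j (-c σ + r)) = ⇑j - j (c σ) • fun _ => (1 : Ω) := by
      ext r
      simp only [map_add, map_neg, Pi.sub_apply, Pi.smul_apply, smul_eq_mul]
      ring
    rw [h, map_sub, map_smul, smul_eq_mul]
    field_simp
    ring
  let Fr := TruncatedWittVector.map (p := p) 2 (frobenius Ω p)
  let S : Gal(Ω/F) → TruncatedWittVector p 2 Ω →+* TruncatedWittVector p 2 Ω :=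
    fun σ => TruncatedWittVector.map (p := p) 2 (σ : Ω →+* Ω)
  obtain ⟨b, hb0, hb⟩ : ∃ b : TruncatedWittVector p 2 Ω, wittReduce p Ω b = a ∧
      Fr b = b + teichmullerTwo p Ω (a ^ p - a) := by
    have h0 : wittReduce p Ω (Fr (teichmullerTwo p Ω a) - teichmullerTwo p Ω a -
        teichmullerTwo p Ω (a ^ p - a)) = 0 := by
      simp [Fr, wittReduce_map, wittReduce_teichmullerTwo, frobenius_def]
    obtain ⟨q, hq⟩ := exists_verschiebungTwo_eq _ h0
    obtain ⟨x, hx⟩ : ∃ x : Ω, x ^ p - x + q = 0 := by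
      have hdeg : (Polynomial.X ^ p - Polynomial.X + Polynomial.C q : Polynomial Ω).natDegree
          = p := by
        rw [Polynomial.natDegree_add_C, FiniteField.X_pow_card_sub_X_natDegree_eq _ hp.one_lt]
      obtain ⟨x, hx⟩ := IsAlgClosed.exists_root
        (Polynomial.X ^ p - Polynomial.X + Polynomial.C q : Polynomial Ω)
        fun h => hp.ne_zero <| by
          rw [← hdeg, Polynomial.natDegree_eq_zero_iff_degree_le_zero.2 h.le]
      exact ⟨x, by simpa [Polynomial.IsRoot.def] using hx⟩
    refine ⟨teichmullerTwo p Ω a + verschiebungTwo p Ω x, ?_, ?_⟩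
    · rw [map_add, wittReduce_teichmullerTwo]
      exact add_eq_left.2 (coeff_zero_verschiebungTwo (p := p) x)
    · have h : Fr (verschiebungTwo p Ω x) =
          verschiebungTwo p Ω x - verschiebungTwo p Ω q := by
        rw [map_verschiebungTwo, ← map_sub, frobenius_def]
        congr 1
        linear_combination hx
      rw [map_add, h, hq]
      ring
  have hSFr : ∀ σ z, Fr (S σ z) = S σ (Fr z) := fun σ z => by
    ext i
    simp [Fr, S, frobenius_def]
  have hSb : ∀ σ ∈ N, S σ (teichmullerTwo p Ω (a ^ p - a)) = teichmullerTwo p Ω (a ^ p - a) := by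
    intro σ hσ
    rw [map_teichmullerTwo]
    congr 1
    change σ _ = _
    rw [map_sub, map_pow, ha σ hσ, add_pow_char, ← map_pow, ZMod.pow_card]
    ring
  let ι := ofZMod p Ω
  have hSι : ∀ σ r, S σ (ι r) = ι r := fun σ r =>
    DFunLike.congr_fun (Subsingleton.elim ((S σ).comp ι) ι) r
  let f : TruncatedWittVector p 2 Ω → ZMod (p ^ 2) := fun z =>
    if h : ∃ r, ι r = z - b then h.choose else 0
  have hf : ∀ σ ∈ N, S σ b = b + ι (f (S σ b)) := by
    intro σ hσ
    have hfix : Fr (S σ b - b) = S σ b - b := by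
      rw [map_sub, hSFr, hb, map_add, hSb σ hσ]
      ring
    have h : ∃ r, ι r = S σ b - b := by
      obtain ⟨z, hz⟩ := exists_map_eq (p := p) 2 j (S σ b - b) fun i =>
        exists_castHom_eq_of_pow_eq _ (by
          conv_rhs => rw [← hfix]
          rw [coeff_map, frobenius_def])
      exact ⟨(TruncatedWittVector.zmodEquivTrunc p 2).symm z, by simpa [ι, ofZMod] using hz⟩
    rw [show f (S σ b) = h.choose from dif_pos h, h.choose_spec, add_sub_cancel]
  refine ⟨fun σ => f (S σ b), ?_, fun σ hσ τ hτ => ?_, fun σ hσ => ?_⟩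
  · have hS : (fun σ => f (S σ b)) = fun σ : Gal(Ω/F) =>
        f (TruncatedWittVector.mk p ![σ (b.coeff 0), σ (b.coeff 1)]) := by
      ext σ
      congr 1
      ext i
      fin_cases i <;> simp [S]
    rw [hS]
    exact (isLocallyConstant_galois_apply (b.coeff 0)).comp₂
      (isLocallyConstant_galois_apply (b.coeff 1))
      fun u v => f (TruncatedWittVector.mk p ![u, v])
  · apply ofZMod_injective (p := p) (K := Ω)
    have hmul : S (σ * τ) b = S σ (S τ b) := by
      ext i
      simp [S]
    have h : S σ (S τ b) = S σ b + ι (f (S τ b)) := by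
      rw [← hSι σ, ← map_add, ← hf τ hτ]
    change ι (f (S (σ * τ) b)) = ι (f (S σ b) + f (S τ b))
    rw [map_add]
    linear_combination h + hf σ hσ - hf _ (N.mul_mem hσ hτ) + hmul
  · apply j.injective
    have h := congrArg (wittReduce p Ω) (hf σ hσ)
    rw [map_add, wittReduce_map, wittReduce_ofZMod, hb0] at h
    change σ a = _ at h
    rw [ha σ hσ] at h
    exact (add_left_cancel h).symm

theorem exists_cyclotomic_lift_s2 [IsAlgClosed Ω] [Algebra.IsAlgebraic F Ω] :
    ∃ χ : Gal(Ω/F) →* (ZMod (p ^ 2))ˣ, IsLocallyConstant χ ∧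
      ∀ (N : Subgroup Gal(Ω/F)) (_ : ∀ σ ∈ N,
          ZMod.castHom (dvd_pow_self p two_ne_zero) (ZMod p) (χ σ : ZMod (p ^ 2)) = 1)
        (c : Gal(Ω/F) → ZMod p) (_ : IsLocallyConstant c)
        (_ : ∀ σ ∈ N, ∀ τ ∈ N, c (σ * τ) = c σ + c τ),
        ∃ C : Gal(Ω/F) → ZMod (p ^ 2), IsLocallyConstant C ∧
          (∀ σ ∈ N, ∀ τ ∈ N, C (σ * τ) = C σ + (χ σ : ZMod (p ^ 2)) * C τ) ∧
          ∀ σ ∈ N, ZMod.castHom (dvd_pow_self p two_ne_zero) (ZMod p) (C σ) = c σ := by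
  by_cases h : (p : Ω) = 0
  · have : CharP Ω p := (CharP.charP_iff_prime_eq_zero Fact.out).2 h
    refine ⟨1, IsLocallyConstant.const 1, fun N _ c hc hadd => ?_⟩
    simpa using exists_hom_lift_of_charP N c hc hadd
  · have : NeZero ((p ^ 2 : ℕ) : Ω) := ⟨by simpa using h⟩
    obtain ⟨ζ, hζ⟩ := HasEnoughRootsOfUnity.exists_primitiveRoot Ω (p ^ 2)
    refine ⟨hζ.autToPow F, ?_, fun N hN c hc hadd =>
      exists_cocycle_lift_of_isPrimitiveRoot hζ N hN c hc hadd⟩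
    refine IsLocallyConstant.desc _ (fun a : (ZMod (p ^ 2))ˣ => ζ ^ (a : ZMod (p ^ 2)).val) ?_ ?_
    · convert isLocallyConstant_galois_apply (F := F) ζ using 2 with σ
      exact hζ.autToPow_spec F σ
    · exact hζ.pow_val_injective.comp Units.val_injective

end Galois

theorem IsLocallyConstant.pi_of_finite {X ι : Type*} [TopologicalSpace X] [Finite ι] {Y : Type*}
    {f : ι → X → Y} (hf : ∀ i, IsLocallyConstant (f i)) :
    IsLocallyConstant fun x i => f i x :=
  (IsLocallyConstant.iff_eventually_eq _).2 fun x =>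
    (Filter.eventually_all.2 fun i => (hf i).eventually_eq x).mono fun _ hy => funext hy

/-- A cocycle with values in a quotient ring lifts if its restriction to an open subgroup of
invertible index lifts: correct the corestriction of the lift by a coboundary. -/
theorem exists_cocycle_lift_of_subgroup {G R k : Type*} [Group G] [TopologicalSpace G]
    [IsTopologicalGroup G] [CommRing R] [CommRing k] {π : R →+* k} (hπ : Function.Surjective π)
    (χ : G →* Rˣ) (hχ : IsLocallyConstant χ) (N : Subgroup G) (hN : IsOpen (N : Set G))
    [N.FiniteIndex] (hunit : IsUnit (N.index : R)) (c : G → k)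
    (hc : ∀ g h, c (g * h) = c g + π (χ g) * c h) (f : G → R) (hf : IsLocallyConstant f)
    (hfN : ∀ g ∈ N, ∀ h ∈ N, f (g * h) = f g + χ g * f h) (hfc : ∀ g ∈ N, π (f g) = c g) :
    ∃ C : G → R, IsLocallyConstant C ∧ (∀ g h, C (g * h) = C g + χ g * C h) ∧
      ∀ g, π (C g) = c g := by
  have : Fintype (G ⧸ N) := Fintype.ofFinite _
  have : DiscreteTopology (G ⧸ N) := QuotientGroup.discreteTopology hN
  let s : G ⧸ N → G := Quotient.out
  have hs : ∀ t, (s t : G ⧸ N) = t := fun t => t.out_eq'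
  have hmem : ∀ g t, (s (g • t))⁻¹ * (g * s t) ∈ N := fun g t => by
    rw [← QuotientGroup.eq, hs]
    conv_lhs => rw [← hs t]
    rfl
  let term : G ⧸ N → G → R := fun t g => χ (s (g • t)) * f ((s (g • t))⁻¹ * (g * s t))
  let D : G → R := fun g => ∑ t, term t g
  have hterm : ∀ t, IsLocallyConstant (term t) := by
    intro t
    have hcont : Continuous fun g : G => s (g • t) := by
      refine (continuous_of_discreteTopology (f := s)).comp ?_
      have : (fun g : G => g • t) = fun g => ((g * s t : G) : G ⧸ N) := by
        ext g
        conv_lhs => rw [← hs t]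
        rfl
      rw [this]
      exact continuous_quot_mk.comp (continuous_mul_const _)
    exact (hχ.comp_continuous hcont).comp₂
      (hf.comp_continuous (hcont.inv.mul (continuous_mul_const (s t)))) fun u v => u * v
  have hD : IsLocallyConstant D :=
    (IsLocallyConstant.pi_of_finite hterm).comp fun v : G ⧸ N → R => ∑ t, v t
  have hDmul : ∀ g h, D (g * h) = D g + χ g * D h := by
    intro g h
    simp only [D]
    rw [← (MulAction.bijective h).sum_comp (fun t => term t g), Finset.mul_sum,
      ← Finset.sum_add_distrib]
    refine Finset.sum_congr rfl fun t _ => ?_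
    have hu := hmem g (h • t)
    have hv := hmem h t
    have hsplit : (s ((g * h) • t))⁻¹ * (g * h * s t) =
        ((s (g • h • t))⁻¹ * (g * s (h • t))) * ((s (h • t))⁻¹ * (h * s t)) := by
      rw [mul_smul]
      group
    simp only [term]
    have hχs : (χ (s (g • h • t)) : R) * χ ((s (g • h • t))⁻¹ * (g * s (h • t))) =
        χ g * χ (s (h • t)) := by
      rw [← Units.val_mul, ← map_mul, mul_inv_cancel_left, map_mul, Units.val_mul]
    rw [hsplit, hfN _ hu _ hv, mul_smul]
    linear_combination f ((s (h • t))⁻¹ * (h * s t)) * hχs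
  have hDc : ∀ g, π (D g) = N.index * c g + (π (χ g) - 1) * ∑ t, c (s t) := by
    intro g
    have hpt : ∀ t, π (term t g) = c g + (π (χ g) * c (s t) - c (s (g • t))) := by
      intro t
      have h1 := hc (s (g • t)) ((s (g • t))⁻¹ * (g * s t))
      rw [mul_inv_cancel_left, hc] at h1
      simp only [term, map_mul]
      rw [hfc _ (hmem g t)]
      linear_combination -h1
    simp only [D, map_sum, hpt]
    rw [Finset.sum_add_distrib, Finset.sum_sub_distrib,
      (MulAction.bijective g).sum_comp (fun t => c (s t)), ← Finset.mul_sum, Finset.sum_const,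
      Finset.card_univ, ← Nat.card_eq_fintype_card, nsmul_eq_mul, sub_one_mul]
    rfl
  obtain ⟨m, hm⟩ := hunit
  have hmk : π (m⁻¹ : Rˣ) * N.index = 1 := by
    rw [← map_natCast π, ← hm, ← map_mul, Units.inv_mul, map_one]
  obtain ⟨v, hv⟩ := hπ (∑ t, c (s t))
  refine ⟨fun g => (m⁻¹ : Rˣ) * (D g - (χ g - 1) * v), ?_, fun g h => ?_, fun g => ?_⟩
  · exact hD.comp₂ hχ fun x u => (m⁻¹ : Rˣ) * (x - (u - 1) * v)
  · simp only [hDmul, map_mul, Units.val_mul]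
    ring
  · simp only [map_mul, map_sub, map_one, hDc, hv]
    linear_combination c g * hmk

theorem MonoidHom.coprime_index_ker {G H : Type*} [Group G] [CommGroup H] {p : ℕ}
    [Fact p.Prime] (hH : ∀ x : H, x ^ p = 1 → x = 1) (f : G →* H) [f.ker.FiniteIndex] :
    f.ker.index.Coprime p := by
  have hcard := Subgroup.index_ker f
  have : Finite f.range := Nat.finite_of_card_ne_zero (hcard ▸ Subgroup.FiniteIndex.index_ne_zero)
  rw [hcard, Nat.coprime_comm, (Fact.out : p.Prime).coprime_iff_not_dvd]
  intro hdvd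
  obtain ⟨x, hx⟩ := exists_prime_orderOf_dvd_card' p hdvd
  have h1 : x = 1 := Subtype.ext (hH x (by
    rw [← Subgroup.coe_pow, ← hx, pow_orderOf_eq_one, Subgroup.coe_one]))
  rw [h1, orderOf_one] at hx
  exact (Fact.out : p.Prime).one_lt.ne hx

theorem eq_one_of_pow_charP_eq_one {k : Type*} [Field k] {p : ℕ} [Fact p.Prime] [CharP k p]
    (x : kˣ) (hx : x ^ p = 1) : x = 1 :=
  Units.ext (frobenius_inj k p (by
    simpa [frobenius_def] using congrArg Units.val hx))

section Character

variable {F Ω : Type*} [Field F] [Field Ω] [Algebra F Ω]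
  {p : ℕ} [Fact p.Prime] {k : Type*} [Field k] [CharP k p]

/-- A crossed homomorphism for a locally constant character takes finitely many values. -/
theorem finite_range_of_isLocallyConstant_cocycle (χ : Gal(Ω/F) →* kˣ) (c : Gal(Ω/F) → k)
    (hc : IsLocallyConstant c) (hcoc : ∀ g h, c (g * h) = c g + χ g * c h) :
    (Set.range c).Finite := by
  have hc1 : c 1 = 0 := by simpa using hcoc 1 1
  have hopen : IsOpen (c ⁻¹' {0}) := hc _
  obtain ⟨E, hE, hEc⟩ := (krullTopology_mem_nhds_one_iff F Ω _).1
    (hopen.mem_nhds (by simpa using hc1))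
  have hEo : IsOpen (E.fixingSubgroup : Set Gal(Ω/F)) := IntermediateField.fixingSubgroup_isOpen E
  have := finiteIndex_of_isOpen_galois _ hEo
  have : Finite (Quotient (QuotientGroup.leftRel E.fixingSubgroup)) :=
    inferInstanceAs (Finite (Gal(Ω/F) ⧸ E.fixingSubgroup))
  have hlift : ∀ a b : Gal(Ω/F), (QuotientGroup.leftRel E.fixingSubgroup) a b → c a = c b := by
    intro a b hab
    rw [QuotientGroup.leftRel_apply] at hab
    have h0 : c (a⁻¹ * b) = 0 := hEc hab
    simpa [h0] using (hcoc a (a⁻¹ * b)).symm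
  refine (Set.finite_range (Quotient.lift c hlift)).subset ?_
  rintro _ ⟨g, rfl⟩
  exact ⟨(g : Gal(Ω/F) ⧸ E.fixingSubgroup), rfl⟩

open TruncatedWittVector in
/-- Every character lifts to Witt vectors of length two in such a way that all its crossed
homomorphisms lift as well. -/
theorem exists_character_lift [Algebra.IsAlgebraic F Ω] [IsAlgClosed Ω]
    (χ : Gal(Ω/F) →* kˣ) (hχ : IsLocallyConstant χ) :
    ∃ X : Gal(Ω/F) →* (TruncatedWittVector p 2 k)ˣ, IsLocallyConstant X ∧
      (∀ g, wittReduce p k (X g) = χ g) ∧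
      ∀ (c : Gal(Ω/F) → k) (_ : IsLocallyConstant c)
        (_ : ∀ g h, c (g * h) = c g + χ g * c h),
        ∃ C : Gal(Ω/F) → TruncatedWittVector p 2 k, IsLocallyConstant C ∧
          (∀ g h, C (g * h) = C g + X g * C h) ∧ ∀ g, wittReduce p k (C g) = c g := by
  obtain ⟨cyc, hcyc, hlift⟩ := exists_cyclotomic_lift_s2 (F := F) (Ω := Ω) (p := p)
  let W := TruncatedWittVector p 2 k
  let π : Wˣ →* kˣ := Units.map (wittReduce p k : W →* k)
  let T : kˣ →* Wˣ := Units.map (teichmullerTwo p k)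
  have hπT : ∀ u, π (T u) = u := fun u => Units.ext (wittReduce_teichmullerTwo (p := p) (u : k))
  let cycW : Gal(Ω/F) →* Wˣ := (Units.map (ofZMod p k : ZMod (p ^ 2) →* W)).comp cyc
  let ω : Gal(Ω/F) →* kˣ := π.comp cycW
  let X : Gal(Ω/F) →* Wˣ := cycW * T.comp (χ * ω⁻¹)
  have hcycW : IsLocallyConstant cycW := hcyc.comp (Units.map (ofZMod p k : ZMod (p ^ 2) →* W))
  have hω : IsLocallyConstant ω := hcycW.comp π
  have hX : IsLocallyConstant X :=
    hcycW.comp₂ (hχ.comp₂ hω fun a b => T (a * b⁻¹)) fun a b => a * b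
  have hXχ : ∀ g, wittReduce p k (X g) = χ g := by
    intro g
    have : π (X g) = χ g := by
      change π (cycW g * T (χ g * (ω g)⁻¹)) = χ g
      rw [map_mul, hπT]
      change ω g * _ = _
      rw [mul_comm, inv_mul_cancel_right]
    exact congrArg Units.val this
  let N := (χ.prod ω).ker
  have hNo : IsOpen (N : Set Gal(Ω/F)) := (hχ.prodMk hω) {1}
  have : N.FiniteIndex := finiteIndex_of_isOpen_galois N hNo
  have hcop : N.index.Coprime p := MonoidHom.coprime_index_ker (fun x hx => by
    rw [Prod.ext_iff] at hx
    exact Prod.ext (eq_one_of_pow_charP_eq_one (p := p) _ hx.1)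
      (eq_one_of_pow_charP_eq_one (p := p) _ hx.2)) (χ.prod ω)
  have hunit : IsUnit (N.index : W) := by
    have := (ZMod.isUnit_iff_coprime N.index (p ^ 2)).2 (hcop.pow_right 2)
    simpa using this.map (ofZMod p k)
  have hχN : ∀ σ ∈ N, χ σ = 1 := fun σ hσ => (Prod.ext_iff.1 (MonoidHom.mem_ker.1 hσ)).1
  have hωN : ∀ σ ∈ N, ω σ = 1 := fun σ hσ => (Prod.ext_iff.1 (MonoidHom.mem_ker.1 hσ)).2
  have hcycN : ∀ σ ∈ N,
      ZMod.castHom (dvd_pow_self p two_ne_zero) (ZMod p) (cyc σ : ZMod (p ^ 2)) = 1 := by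
    intro σ hσ
    refine (ZMod.castHom dvd_rfl k : ZMod p →+* k).injective ?_
    rw [← wittReduce_ofZMod, map_one]
    exact congrArg Units.val (hωN σ hσ)
  have hXN : ∀ σ ∈ N, (X σ : W) = ofZMod p k (cyc σ : ZMod (p ^ 2)) := by
    intro σ hσ
    have : X σ = cycW σ := by
      change cycW σ * T (χ σ * (ω σ)⁻¹) = cycW σ
      rw [hχN σ hσ, hωN σ hσ, inv_one, mul_one, map_one, mul_one]
    rw [this]
    rfl
  refine ⟨X, hX, hXχ, fun c hc hcoc => ?_⟩
  let _ : Algebra (ZMod p) k := ZMod.algebra k p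
  let V := Submodule.span (ZMod p) (Set.range c)
  have : FiniteDimensional (ZMod p) V :=
    FiniteDimensional.span_of_finite _ (finite_range_of_isLocallyConstant_cocycle χ c hc hcoc)
  let b := Module.finBasis (ZMod p) V
  let cV : Gal(Ω/F) → V := fun g => ⟨c g, Submodule.subset_span ⟨g, rfl⟩⟩
  have hcV : IsLocallyConstant cV := IsLocallyConstant.desc cV Subtype.val hc Subtype.val_injective
  have hcVN : ∀ σ ∈ N, ∀ τ ∈ N, cV (σ * τ) = cV σ + cV τ := fun σ hσ τ _ =>
    Subtype.ext (by simp [cV, hcoc, hχN σ hσ])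
  have hcoord := fun i => hlift N hcycN (fun g => b.repr (cV g) i) (hcV.comp fun v => b.repr v i)
    fun σ hσ τ hτ => by simp only [hcVN σ hσ τ hτ, map_add, Finsupp.add_apply]
  choose C hC hCN hCc using hcoord
  refine exists_cocycle_lift_of_subgroup
    (fun x => ⟨_, wittReduce_teichmullerTwo (p := p) x⟩) X hX N hNo hunit c
    (fun g h => by rw [hcoc, hXχ])
    (fun g => ∑ i, teichmullerTwo p k (b i : k) * ofZMod p k (C i g)) ?_ ?_ ?_
  · exact (IsLocallyConstant.pi_of_finite hC).comp
      fun v => ∑ i, teichmullerTwo p k (b i : k) * ofZMod p k (v i)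
  · intro g hg h hh
    simp only [hCN _ g hg h hh, map_add, map_mul, hXN g hg, Finset.mul_sum, mul_add,
      Finset.sum_add_distrib]
    congr 1
    exact Finset.sum_congr rfl fun i _ => by ring
  · intro g hg
    have h1 := congrArg Subtype.val (b.sum_repr (cV g))
    rw [Submodule.coe_sum] at h1
    refine Eq.trans ?_ h1
    rw [map_sum]
    refine Finset.sum_congr rfl fun i _ => ?_
    rw [map_mul, wittReduce_teichmullerTwo, wittReduce_ofZMod, hCc i g hg, mul_comm,
      Submodule.coe_smul, Algebra.smul_def]
    rfl

end Character

namespace BorelSubgroup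

variable {R S : Type*} [CommRing R] [CommRing S]

theorem coe_apply_of_lt {n : ℕ} (A : BorelSubgroup n R) {i j : Fin n} (h : j < i) :
    (A : GL (Fin n) R) i j = 0 :=
  A.2 h

/-- The upper-triangular `2 × 2` matrix with diagonal entries `a`, `d` and corner `b`. -/
noncomputable def mkTwo (a d : Rˣ) (b : R) : BorelSubgroup 2 R :=
  ⟨Matrix.GeneralLinearGroup.mk'' !![(a : R), b; 0, d] (by
    rw [Matrix.det_fin_two_of, mul_zero, sub_zero]
    exact (a * d).isUnit), fun i j h => by
      fin_cases i <;> fin_cases j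
      · exact absurd h (lt_irrefl _)
      · exact absurd h (by decide)
      · rfl
      · exact absurd h (lt_irrefl _)⟩

theorem coe_mkTwo (a d : Rˣ) (b : R) :
    ((mkTwo a d b : GL (Fin 2) R) : Matrix (Fin 2) (Fin 2) R) = !![(a : R), b; 0, d] :=
  rfl

theorem mkTwo_mul (a d a' d' : Rˣ) (b b' : R) :
    mkTwo a d b * mkTwo a' d' b' = mkTwo (a * a') (d * d') (a * b' + b * d') := by
  refine Subtype.ext (Units.ext ?_)
  rw [Subgroup.coe_mul, Units.val_mul, coe_mkTwo, coe_mkTwo, coe_mkTwo]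
  simp

theorem map_mkTwo (f : R →+* S) (a d : Rˣ) (b : R) :
    map f (mkTwo a d b) = mkTwo (Units.map f a) (Units.map f d) (f b) := by
  refine Subtype.ext (Units.ext ?_)
  ext i j
  change f (!![(a : R), b; 0, d] i j) = !![f a, f b; 0, f d] i j
  fin_cases i <;> fin_cases j <;> simp

variable (R) in
/-- The character of the upper-triangular `2 × 2` matrices given by a diagonal entry. -/
noncomputable def diagTwo (i : Fin 2) : BorelSubgroup 2 R →* Rˣ :=
  MonoidHom.toHomUnits
    { toFun := fun A => (A : GL (Fin 2) R) i i
      map_one' := by simp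
      map_mul' := fun A B => by
        have hA := coe_apply_of_lt A (show (0 : Fin 2) < 1 by decide)
        have hB := coe_apply_of_lt B (show (0 : Fin 2) < 1 by decide)
        fin_cases i <;> simp [Matrix.mul_apply, Fin.sum_univ_two, hA, hB] }

theorem mkTwo_diagTwo (A : BorelSubgroup 2 R) :
    mkTwo (diagTwo R 0 A) (diagTwo R 1 A) ((A : GL (Fin 2) R) 0 1) = A := by
  refine Subtype.ext (Units.ext ?_)
  ext i j
  fin_cases i <;> fin_cases j
  · rfl
  · rfl
  · exact (coe_apply_of_lt A (show (0 : Fin 2) < 1 by decide)).symm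
  · rfl

theorem coe_mul_zero_one (A B : BorelSubgroup 2 R) :
    ((A * B : BorelSubgroup 2 R) : GL (Fin 2) R) 0 1 =
      diagTwo R 0 A * (B : GL (Fin 2) R) 0 1 + (A : GL (Fin 2) R) 0 1 * diagTwo R 1 B := by
  rw [Subgroup.coe_mul, Units.val_mul, Matrix.mul_apply, Fin.sum_univ_two]
  rfl

end BorelSubgroup

open BorelSubgroup in
theorem exists_borelTwo_lift {F Ω k : Type*} [Field F] [Field Ω] [Algebra F Ω]
    [Algebra.IsAlgebraic F Ω] [IsAlgClosed Ω] (p : ℕ) [Fact p.Prime] [Field k] [CharP k p]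
    (ρ : Gal(Ω/F) →* BorelSubgroup 2 k) (hρc : IsLocallyConstant ρ) :
    ∃ ρ' : Gal(Ω/F) →* BorelSubgroup 2 (TruncatedWittVector p 2 k),
      IsLocallyConstant ρ' ∧ (BorelSubgroup.map (wittReduce p k)).comp ρ' = ρ := by
  let a := (diagTwo k 0).comp ρ
  let d := (diagTwo k 1).comp ρ
  let b : Gal(Ω/F) → k := fun g => (ρ g : GL (Fin 2) k) 0 1
  have hmul : ∀ g h, b (g * h) = a g * b h + b g * d h := fun g h => by
    simp only [b, map_mul]
    exact coe_mul_zero_one _ _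
  let χ := a * d⁻¹
  have hχ : IsLocallyConstant χ := hρc.comp fun A => diagTwo k 0 A * (diagTwo k 1 A)⁻¹
  let c : Gal(Ω/F) → k := fun g => b g * ((d g)⁻¹ : kˣ)
  have hc : IsLocallyConstant c :=
    hρc.comp fun A => (A : GL (Fin 2) k) 0 1 * ((diagTwo k 1 A)⁻¹ : kˣ)
  have hcmul : ∀ g h, c (g * h) = c g + χ g * c h := fun g h => by
    have hh := (d h).mul_inv
    simp only [c, χ, hmul, map_mul, mul_inv, Units.val_mul, MonoidHom.mul_apply,
      MonoidHom.inv_apply]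
    linear_combination b g * ((d g)⁻¹ : kˣ) * hh
  obtain ⟨X, hX, hXχ, hlift⟩ := exists_character_lift (F := F) (Ω := Ω) (p := p) χ hχ
  obtain ⟨C, hC, hCmul, hCc⟩ := hlift c hc hcmul
  let T : kˣ →* (TruncatedWittVector p 2 k)ˣ := Units.map (TruncatedWittVector.teichmullerTwo p k)
  have hT : ∀ u, Units.map (wittReduce p k : _ →* k) (T u) = u := fun u =>
    Units.ext (TruncatedWittVector.wittReduce_teichmullerTwo (p := p) (u : k))
  let ρ' : Gal(Ω/F) →* BorelSubgroup 2 (TruncatedWittVector p 2 k) :=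
    MonoidHom.mk' (fun g => mkTwo (X g * T (d g)) (T (d g)) (C g * T (d g))) fun g h => by
      rw [mkTwo_mul, hCmul, map_mul, map_mul, map_mul]
      have hcorner : (C g + X g * C h) * ((T (d g) * T (d h) : (TruncatedWittVector p 2 k)ˣ) :
          TruncatedWittVector p 2 k) =
          (X g * T (d g) : (TruncatedWittVector p 2 k)ˣ) * (C h * T (d h)) +
            C g * T (d g) * T (d h) := by
        rw [Units.val_mul, Units.val_mul]
        ring
      rw [hcorner, mul_mul_mul_comm]
  have hρ'c : IsLocallyConstant ρ' :=
    ((hX.prodMk hC).prodMk hρc).comp fun x => mkTwo (x.1.1 * T (diagTwo k 1 x.2))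
      (T (diagTwo k 1 x.2)) (x.1.2 * T (diagTwo k 1 x.2))
  refine ⟨ρ', hρ'c, MonoidHom.ext fun g => ?_⟩
  refine Eq.trans ?_ (mkTwo_diagTwo (ρ g))
  change BorelSubgroup.map _ (mkTwo _ _ _) = _
  have hXu : Units.map (wittReduce p k : _ →* k) (X g) = χ g := Units.ext (hXχ g)
  have hTg : wittReduce p k (T (d g)) = d g := congrArg Units.val (hT (d g))
  have hχd : χ g * d g = a g := inv_mul_cancel_right (a g) (d g)
  have hcd : c g * d g = b g := Units.inv_mul_cancel_right (b g) (d g)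
  rw [map_mkTwo, map_mul, map_mul, hCc, hT, hXu, hTg, hχd, hcd]
  rfl

/-- For every field `F` and every field `k` of characteristic `p > 0`,
every continuous homomorphism `Γ_F → B₂(k)` lifts to `B₂(W₂(k))`. -/
theorem b_two_lifts (p : ℕ) [Fact p.Prime] (F : Type) [Field F] (k : Type) [Field k] [CharP k p]
    (ρ : Field.absoluteGaloisGroup F →* BorelSubgroup 2 k) (hρ : Continuous[_, ⊥] ⇑ρ) :
    ∃ ρ' : Field.absoluteGaloisGroup F →* BorelSubgroup 2 (TruncatedWittVector p 2 k),
      Continuous[_, ⊥] ⇑ρ' ∧ (BorelSubgroup.map (wittReduce p k)).comp ρ' = ρ := by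
  have hρc : IsLocallyConstant ρ := by
    let _ : TopologicalSpace (BorelSubgroup 2 k) := ⊥
    have : DiscreteTopology (BorelSubgroup 2 k) := ⟨rfl⟩
    exact (IsLocallyConstant.iff_continuous _).2 hρ
  obtain ⟨ρ', hρ', h⟩ := exists_borelTwo_lift (Ω := AlgebraicClosure F) p ρ hρc
  refine ⟨ρ', ?_, h⟩
  let _ : TopologicalSpace (BorelSubgroup 2 (TruncatedWittVector p 2 k)) := ⊥
  exact hρ'.continuous
end

section
/- For every field F and every positive integer n ≤ 4, every continuous homomorphism ρ : Γ_F → GL_n(𝔽₂) lifts to ℤ/4ℤ: there exists a continuous homomorphism ρ̃ : Γ_F → GL_n(ℤ/4ℤ) whose composite with the entrywise reduction map GL_n(ℤ/4ℤ) → GL_n(𝔽₂) equals ρ. -/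
open Matrix Topology

/-- Reduction modulo two. -/
abbrev redTwo : ZMod 4 →+* ZMod 2 :=
  ZMod.castHom (show (2 : ℕ) ∣ 4 by norm_num) (ZMod 2)

/-- Every continuous additive character modulo two of an open subgroup lifts to a continuous
cocycle modulo four, with coefficients twisted by `χ`. Characters and cocycles are represented by
functions on the whole group. -/
def LiftsCharacters (G : Type*) [Group G] [TopologicalSpace G] (χ : G →* (ZMod 4)ˣ) : Prop :=
  ∀ S : Subgroup G, IsOpen (S : Set G) → ∀ φ : G → ZMod 2,
    (∀ s ∈ S, ∀ t ∈ S, φ (s * t) = φ s + φ t) → (∀ᶠ s in 𝓝 1, φ s = 0) →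
    ∃ ψ : G → ZMod 4, (∀ s ∈ S, ∀ t ∈ S, ψ (s * t) = ψ s + χ s * ψ t) ∧
      (∀ s ∈ S, redTwo (ψ s) = φ s) ∧ ∀ᶠ s in 𝓝 1, ψ s = 0

theorem ZMod.two_eq_one_of_ne_zero {a : ZMod 2} (ha : a ≠ 0) : a = 1 := by
  revert a; decide

section Galois

variable {K L : Type*} [Field K] [Field L] [Algebra K L]

theorem eventually_galois_apply_eq [Algebra.IsIntegral K L] (x : L) :
    ∀ᶠ s : Gal(L/K) in 𝓝 1, s x = x :=
  (stabilizer_isOpen_of_isIntegral (K := K) x).mem_nhds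
    (one_mem (MulAction.stabilizer Gal(L/K) x))

theorem exists_fixed_by_kernel_not_fixed [Normal K L] (S : Subgroup Gal(L/K))
    (hS : IsOpen (S : Set Gal(L/K))) (φ : Gal(L/K) → ZMod 2)
    (hφ : ∀ s ∈ S, ∀ t ∈ S, φ (s * t) = φ s + φ t) (hφ' : ∀ᶠ s in 𝓝 1, φ s = 0)
    {s₀ : Gal(L/K)} (hφs₀ : φ s₀ ≠ 0) :
    ∃ z : L, (∀ s ∈ S, φ s = 0 → s z = z) ∧ s₀ z ≠ z := by
  have hφ1 : φ 1 = 0 := by simpa using hφ 1 S.one_mem 1 S.one_mem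
  let N : Subgroup Gal(L/K) :=
    { carrier := {s | s ∈ S ∧ φ s = 0}
      one_mem' := ⟨S.one_mem, hφ1⟩
      mul_mem' := fun {a b} ha hb =>
        ⟨S.mul_mem ha.1 hb.1, by rw [hφ a ha.1 b hb.1, ha.2, hb.2, add_zero]⟩
      inv_mem' := fun {a} ha => ⟨S.inv_mem ha.1, by
        have := hφ a ha.1 a⁻¹ (S.inv_mem ha.1)
        rwa [mul_inv_cancel, hφ1, ha.2, zero_add, eq_comm] at this⟩ }
  obtain ⟨E, hE, hEn, hES⟩ := (krullTopology_mem_nhds_one_iff_of_normal K L _).1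
    (hφ'.and (hS.mem_nhds S.one_mem))
  let r : Gal(L/K) →* Gal(E/K) := AlgEquiv.restrictNormalHom E
  have hr (s : Gal(L/K)) (z : E) : ((r s z : E) : L) = s z :=
    AlgEquiv.restrictNormal_commutes s E z
  have hs₀N : r s₀ ∉ (IntermediateField.fixedField (N.map r)).fixingSubgroup := by
    rw [IntermediateField.fixingSubgroup_fixedField]
    rintro ⟨t, ht, hts⟩
    have hfix : t⁻¹ * s₀ ∈ E.fixingSubgroup := by
      rw [IntermediateField.mem_fixingSubgroup_iff]
      intro x hx
      have h1 : r (t⁻¹ * s₀) = 1 := by rw [map_mul, map_inv, hts, inv_mul_cancel]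
      simpa [h1] using (hr (t⁻¹ * s₀) ⟨x, hx⟩).symm
    obtain ⟨h0, hmem⟩ := hES hfix
    have := hφ t ht.1 (t⁻¹ * s₀) hmem
    rw [mul_inv_cancel_left, ht.2, h0, add_zero] at this
    exact hφs₀ this
  rw [IntermediateField.mem_fixingSubgroup_iff] at hs₀N
  push Not at hs₀N
  obtain ⟨z, hz, hne⟩ := hs₀N
  refine ⟨z, fun s hs h0 => ?_, fun h => hne (Subtype.ext (by rw [hr, h]))⟩
  rw [← hr]
  exact congrArg _ (hz ⟨r s, Subgroup.mem_map_of_mem r (show s ∈ N from ⟨hs, h0⟩)⟩)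

/-- Quadratic Kummer theory, in the form of Hilbert 90. -/
theorem exists_kummer_generator [Normal K L] (S : Subgroup Gal(L/K))
    (hS : IsOpen (S : Set Gal(L/K))) (φ : Gal(L/K) → ZMod 2)
    (hφ : ∀ s ∈ S, ∀ t ∈ S, φ (s * t) = φ s + φ t) (hφ' : ∀ᶠ s in 𝓝 1, φ s = 0) :
    ∃ u : L, u ≠ 0 ∧ ∀ s ∈ S, s u = (-1) ^ (φ s).val * u := by
  by_cases htriv : ∀ s ∈ S, φ s = 0
  · exact ⟨1, one_ne_zero, fun s hs => by simp [htriv s hs]⟩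
  push Not at htriv
  obtain ⟨s₀, hs₀, hne⟩ := htriv
  obtain ⟨z, hz, hz₀⟩ := exists_fixed_by_kernel_not_fixed S hS φ hφ hφ' hne
  have h1 := ZMod.two_eq_one_of_ne_zero hne
  have hs₀2 : s₀ (s₀ z) = z :=
    hz (s₀ * s₀) (S.mul_mem hs₀ hs₀) (by rw [hφ s₀ hs₀ s₀ hs₀, h1]; rfl)
  have hker (s) (hs : s ∈ S) (h0 : φ s = 0) : s (s₀ z) = s₀ z := by
    have h := hφ s hs s₀ hs₀
    have h' := hφ s₀⁻¹ (S.inv_mem hs₀) (s * s₀) (S.mul_mem hs hs₀)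
    have h'' := hφ s₀⁻¹ (S.inv_mem hs₀) s₀ hs₀
    have hφ1 : φ 1 = 0 := by simpa using hφ 1 S.one_mem 1 S.one_mem
    rw [inv_mul_cancel, hφ1] at h''
    have := hz (s₀⁻¹ * (s * s₀)) (S.mul_mem (S.inv_mem hs₀) (S.mul_mem hs hs₀))
      (by rw [h', h, h0, zero_add, ← h''])
    have h3 := congrArg s₀ this
    simpa [AlgEquiv.mul_apply, ← AlgEquiv.mul_apply s₀ s₀⁻¹] using h3
  refine ⟨z - s₀ z, sub_ne_zero.2 hz₀.symm, fun s hs => ?_⟩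
  by_cases h0 : φ s = 0
  · simp [h0, hz s hs h0, hker s hs h0]
  · have h2 := ZMod.two_eq_one_of_ne_zero h0
    have hinv : φ (s * s₀) = 0 := by rw [hφ s hs s₀ hs₀, h1, h2]; rfl
    have e1 : s (s₀ z) = z := hz (s * s₀) (S.mul_mem hs hs₀) hinv
    have e2 : s z = s₀ z := by
      have := hker (s * s₀) (S.mul_mem hs hs₀) hinv
      rwa [AlgEquiv.mul_apply, hs₀2] at this
    rw [h2, map_sub, e1, e2, ZMod.val_one]
    ring

/-- Quadratic Artin–Schreier theory, in the form of additive Hilbert 90. -/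
theorem exists_artinSchreier_generator [Normal K L] [CharP L 2] (S : Subgroup Gal(L/K))
    (hS : IsOpen (S : Set Gal(L/K))) (φ : Gal(L/K) → ZMod 2)
    (hφ : ∀ s ∈ S, ∀ t ∈ S, φ (s * t) = φ s + φ t) (hφ' : ∀ᶠ s in 𝓝 1, φ s = 0) :
    ∃ x : L, ∀ s ∈ S, s x = x + (φ s).val := by
  by_cases htriv : ∀ s ∈ S, φ s = 0
  · exact ⟨1, fun s hs => by simp [htriv s hs]⟩
  push Not at htriv
  obtain ⟨s₀, hs₀, hne⟩ := htriv
  obtain ⟨u, hu, hus⟩ : ∃ z : L, s₀ z ≠ z ∧ ∀ s ∈ S, s z = if φ s = 0 then z else s₀ z := by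
    obtain ⟨z, hz, hz₀⟩ := exists_fixed_by_kernel_not_fixed S hS φ hφ hφ' hne
    refine ⟨z, hz₀, fun s hs => ?_⟩
    split_ifs with h0
    · exact hz s hs h0
    · have h := hφ s₀ hs₀ (s₀⁻¹ * s) (S.mul_mem (S.inv_mem hs₀) hs)
      rw [mul_inv_cancel_left, ZMod.two_eq_one_of_ne_zero h0,
        ZMod.two_eq_one_of_ne_zero hne] at h
      have := congrArg s₀ (hz _ (S.mul_mem (S.inv_mem hs₀) hs) (by simpa using h))
      rwa [← AlgEquiv.mul_apply, mul_inv_cancel_left] at this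
  have h1 := ZMod.two_eq_one_of_ne_zero hne
  have hs₀2 : s₀ (s₀ u) = u := by
    have := hus (s₀ * s₀) (S.mul_mem hs₀ hs₀)
    rwa [if_pos (by rw [hφ s₀ hs₀ s₀ hs₀, h1]; rfl)] at this
  have ht : u + s₀ u ≠ 0 := by
    intro h
    rw [CharTwo.add_eq_zero] at h
    exact hu h.symm
  refine ⟨u / (u + s₀ u), fun s hs => ?_⟩
  have e1 := hus s hs
  have e2 : s (s₀ u) = if φ s = 0 then s₀ u else u := by
    have h := hus (s * s₀) (S.mul_mem hs hs₀)
    rw [hφ s hs s₀ hs₀, h1] at h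
    by_cases h0 : φ s = 0
    · rw [if_pos h0]
      rwa [h0, if_neg (by decide)] at h
    · rw [if_neg h0]
      rwa [ZMod.two_eq_one_of_ne_zero h0, if_pos (by decide)] at h
  rw [map_div₀, map_add, e1, e2]
  by_cases h0 : φ s = 0
  · simp [h0]
  · rw [if_neg h0, if_neg h0, ZMod.two_eq_one_of_ne_zero h0, ZMod.val_one, Nat.cast_one,
      add_comm (s₀ u) u, div_add_one ht]
    congr 1
    linear_combination -CharTwo.add_self_eq_zero u

/-- The addition law of Witt vectors of length two over `𝔽₂`. -/
theorem witt_add_law (a b c d : ZMod 2) :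
    ((((a + c).val + 2 * (b + d + a * c).val : ℕ)) : ZMod 4) =
      ((a.val + 2 * b.val : ℕ) : ZMod 4) + ((c.val + 2 * d.val : ℕ) : ZMod 4) := by
  revert a b c d; decide

theorem redTwo_witt (a b : ZMod 2) : redTwo ((a.val + 2 * b.val : ℕ) : ZMod 4) = a := by
  revert a b; decide

theorem liftsCharacters_of_charTwo [IsAlgClosed L] [Normal K L] [CharP L 2] :
    LiftsCharacters Gal(L/K) 1 := by
  intro S hS φ hφ hφ'
  obtain ⟨x, hx⟩ := exists_artinSchreier_generator S hS φ hφ hφ'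
  obtain ⟨y, hy⟩ : ∃ y : L, y ^ 2 = y + x * (x ^ 2 - x) := by
    let p : Polynomial L := Polynomial.X ^ 2 - Polynomial.X - Polynomial.C (x * (x ^ 2 - x))
    have hp : p.degree ≠ 0 := by
      have : p.degree = 2 := by unfold p; compute_degree!
      rw [this]; decide
    obtain ⟨y, hy⟩ := IsAlgClosed.exists_root p hp
    refine ⟨y, ?_⟩
    simp [p] at hy
    linear_combination hy
  have h2 : (2 : L) = 0 := CharTwo.two_eq_zero
  have hval (a : ZMod 2) : ((a.val : ℕ) : L) = ZMod.castHom (dvd_refl 2) L a := by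
    simp
  simp only [hval] at hx
  have key (s : Gal(L/K)) : ∃ c : ZMod 2, s ∈ S →
      s y = y + ZMod.castHom (dvd_refl 2) L (φ s) * x + ZMod.castHom (dvd_refl 2) L c := by
    by_cases hs : s ∈ S
    swap
    · exact ⟨0, fun h => absurd h hs⟩
    have hsy := congrArg s hy
    simp only [map_add, map_mul, map_sub, map_pow, hx s hs] at hsy
    set a := ZMod.castHom (dvd_refl 2) L (φ s) with ha
    have haa : a ^ 2 = a := by
      rw [ha, ← map_pow]; congr 1; generalize φ s = t; revert t; decide
    have : (s y - y - a * x) * (s y - y - a * x - 1) = 0 := by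
      have hsy' : s y ^ 2 = s y + (x + a) * (x ^ 2 - x) := by
        linear_combination hsy + (x + a) * haa + (x + a) * a * x * h2
      linear_combination hsy' + hy + x ^ 2 * haa +
        (y - s y * y - a * s y * x + a * y * x + x ^ 3 - x ^ 2 + a * x ^ 2) * h2
    rcases mul_eq_zero.1 this with h | h
    · exact ⟨0, fun _ => by rw [map_zero]; linear_combination h⟩
    · exact ⟨1, fun _ => by rw [map_one]; linear_combination h⟩
  choose c hc using key
  have hinj := (ZMod.castHom (dvd_refl 2) L).injective
  refine ⟨fun s => (((φ s).val + 2 * (c s).val : ℕ) : ZMod 4), fun s hs t ht => ?_,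
    fun s _ => redTwo_witt _ _, ?_⟩
  · have : c (s * t) = c s + c t + φ s * φ t := by
      apply hinj
      have h1 := hc (s * t) (S.mul_mem hs ht)
      have hcast (σ : Gal(L/K)) (a : ZMod 2) :
          σ (ZMod.castHom (dvd_refl 2) L a) = ZMod.castHom (dvd_refl 2) L a := by
        rw [← hval, map_natCast]
      rw [AlgEquiv.mul_apply, hc t ht] at h1
      simp only [map_add, map_mul, hcast, hc s hs, hx s hs, hφ s hs t ht] at h1 ⊢
      linear_combination -h1
    simp only [this, hφ s hs t ht, witt_add_law, MonoidHom.one_apply, Units.val_one, one_mul]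
  · filter_upwards [hφ', eventually_galois_apply_eq (K := K) y, hS.mem_nhds S.one_mem]
      with s h0 hsy hs
    have h := hc s hs
    rw [hsy, h0, map_zero, zero_mul, add_zero, left_eq_add, map_eq_zero] at h
    simp [h0, h]

theorem isPrimitiveRoot_four_of_sq_eq_neg_one (h2 : (2 : L) ≠ 0) {i : L} (hi : i ^ 2 = -1) :
    IsPrimitiveRoot i 4 := by
  have : orderOf i = 2 ^ (1 + 1) := by
    refine orderOf_eq_prime_pow ?_ ?_
    · rw [pow_one, hi]
      intro h
      apply h2
      linear_combination -h
    · rw [show 2 ^ (1 + 1) = 2 * 2 from rfl, pow_mul, hi]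
      ring
  rw [show 4 = orderOf i from this.symm]
  exact IsPrimitiveRoot.orderOf i

theorem redTwo_eq_of_two_mul_val_eq (a : ZMod 4) (b : ZMod 2)
    (h : ((2 * a.val : ℕ) : ZMod 4) = ((2 * b.val : ℕ) : ZMod 4)) : redTwo a = b := by
  revert a b; decide

theorem liftsCharacters_of_two_ne_zero [IsAlgClosed L] [Normal K L] (h2 : (2 : L) ≠ 0) :
    ∃ χ : Gal(L/K) →* (ZMod 4)ˣ, (∀ᶠ s in 𝓝 1, χ s = 1) ∧ LiftsCharacters Gal(L/K) χ := by
  obtain ⟨i, hi⟩ := IsAlgClosed.exists_pow_nat_eq (-1 : L) two_pos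
  have hi4 := isPrimitiveRoot_four_of_sq_eq_neg_one h2 hi
  have hpow (a b : ℕ) (h : i ^ a = i ^ b) : (a : ZMod 4) = b := by
    rw [pow_eq_pow_mod a hi4.pow_eq_one, pow_eq_pow_mod b hi4.pow_eq_one] at h
    exact (ZMod.natCast_eq_natCast_iff _ _ _).2
      (hi4.pow_inj (Nat.mod_lt _ (by norm_num)) (Nat.mod_lt _ (by norm_num)) h)
  have hi0 : i ≠ 0 := hi4.ne_zero (by norm_num)
  have hχ := hi4.autToPow_spec K
  set χ := hi4.autToPow K
  have hχ1 : ∀ᶠ s in 𝓝 1, χ s = 1 := by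
    filter_upwards [eventually_galois_apply_eq (K := K) i] with s hs
    have := hpow (χ s : ZMod 4).val 1 (by rw [hχ, hs, pow_one])
    rw [ZMod.natCast_zmod_val, Nat.cast_one] at this
    exact Units.ext this
  refine ⟨χ, hχ1, fun S hS φ hφ hφ' => ?_⟩
  obtain ⟨u, hu, hus⟩ := exists_kummer_generator S hS φ hφ hφ'
  obtain ⟨w, hw⟩ := IsAlgClosed.exists_pow_nat_eq u two_pos
  have hw0 : w ≠ 0 := by rintro rfl; exact hu (by rw [← hw]; simp)
  have key (s : Gal(L/K)) : ∃ c : ZMod 4, s ∈ S → s w = i ^ c.val * w := by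
    by_cases hs : s ∈ S
    swap
    · exact ⟨0, fun h => absurd h hs⟩
    obtain ⟨k, hk, hkw⟩ := hi4.eq_pow_of_pow_eq_one (ξ := s w / w) (by
      have : (s w / w) ^ 2 = (-1) ^ (φ s).val := by
        rw [div_pow, ← map_pow, hw, hus s hs, mul_div_assoc, div_self hu, mul_one]
      rw [show 4 = 2 * 2 from rfl, pow_mul, this, ← pow_mul, mul_comm, pow_mul]
      simp)
    exact ⟨k, fun _ => by rw [ZMod.val_natCast_of_lt hk, hkw, div_mul_cancel₀ _ hw0]⟩
  choose ψ hψ using key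
  refine ⟨ψ, fun s hs t ht => ?_, fun s hs => ?_, ?_⟩
  · have h := hψ (s * t) (S.mul_mem hs ht)
    rw [AlgEquiv.mul_apply, hψ t ht, map_mul, map_pow, ← hχ, hψ s hs, ← mul_assoc, ← pow_mul,
      ← pow_add] at h
    have := hpow _ _ (mul_right_cancel₀ hw0 h)
    push_cast [ZMod.natCast_zmod_val] at this
    rw [← this, add_comm]
  · apply redTwo_eq_of_two_mul_val_eq
    apply hpow
    apply mul_right_cancel₀ hu
    rw [mul_comm 2, pow_mul, pow_mul i 2, hi, ← hus s hs, ← hw, map_pow, hψ s hs, mul_pow]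
  · filter_upwards [eventually_galois_apply_eq (K := K) w, hS.mem_nhds S.one_mem] with s hsw hs
    have h := hψ s hs
    rw [hsw] at h
    have := hpow (ψ s).val 0 (by
      rw [pow_zero]; exact mul_right_cancel₀ hw0 (by rw [← h, one_mul]))
    simpa using this

theorem exists_liftsCharacters (K L : Type*) [Field K] [Field L] [Algebra K L] [IsAlgClosed L]
    [Normal K L] :
    ∃ χ : Gal(L/K) →* (ZMod 4)ˣ, (∀ᶠ s in 𝓝 1, χ s = 1) ∧ LiftsCharacters Gal(L/K) χ := by
  by_cases h2 : (2 : L) = 0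
  · have := CharTwo.of_one_ne_zero_of_two_eq_zero (one_ne_zero (α := L)) h2
    exact ⟨1, by simp, liftsCharacters_of_charTwo⟩
  · exact liftsCharacters_of_two_ne_zero h2

end Galois

section Cocycles

variable {G : Type*} [Group G] [TopologicalSpace G]

theorem Subgroup.nhds_one_eq_map_val {H : Subgroup G} (hH : IsOpen (H : Set G)) :
    𝓝 (1 : G) = Filter.map ((↑) : H → G) (𝓝 1) :=
  (hH.isOpenEmbedding_subtypeVal.map_nhds_eq 1).symm

theorem LiftsCharacters.restrict {χ : G →* (ZMod 4)ˣ} (h : LiftsCharacters G χ) {H : Subgroup G}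
    (hH : IsOpen (H : Set G)) : LiftsCharacters H (χ.comp H.subtype) := by
  classical
  intro S hS φ hφ hφ'
  have hnhds := Subgroup.nhds_one_eq_map_val hH
  obtain ⟨ψ, hψ, hψφ, hψ'⟩ := h (S.map H.subtype)
    (hH.isOpenEmbedding_subtypeVal.isOpenMap _ hS)
    (fun g => if hg : g ∈ H then φ ⟨g, hg⟩ else 0)
    (by
      rintro _ ⟨s, hs, rfl⟩ _ ⟨t, ht, rfl⟩
      rw [dif_pos (show H.subtype s * H.subtype t ∈ H from H.mul_mem s.2 t.2),
        dif_pos (show H.subtype s ∈ H from s.2), dif_pos (show H.subtype t ∈ H from t.2)]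
      exact hφ s hs t ht)
    (by
      rw [hnhds, Filter.eventually_map]
      filter_upwards [hφ'] with s hs
      simpa using hs)
  refine ⟨fun s => ψ s, fun s hs t ht => hψ _ ⟨s, hs, rfl⟩ _ ⟨t, ht, rfl⟩, fun s hs => ?_, ?_⟩
  · simpa using hψφ _ ⟨s, hs, rfl⟩
  · rwa [hnhds, Filter.eventually_map] at hψ'

variable [IsTopologicalGroup G]

theorem eventually_conj {p : G → Prop} (h : ∀ᶠ s in 𝓝 1, p s) (t : G) :
    ∀ᶠ s in 𝓝 1, p (t⁻¹ * s * t) := by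
  have : Filter.Tendsto (fun s : G => t⁻¹ * s * t) (𝓝 1) (𝓝 1) :=
    Continuous.tendsto' (by fun_prop) _ _ (by simp)
  exact this.eventually h

/-- Shapiro's lemma combined with the lifting of characters: cocycles with values in a permutation
module over `𝔽₂` lift to the twisted permutation module over `ℤ/4ℤ`. -/
theorem LiftsCharacters.exists_lift_cocycle {χ : G →* (ZMod 4)ˣ} (h : LiftsCharacters G χ)
    (hχ : ∀ᶠ s in 𝓝 1, χ s = 1) {X : Type*} [Finite X] [MulAction G X]
    (hX : ∀ᶠ g : G in 𝓝 1, ∀ x : X, g • x = x) (b : G → X → ZMod 2)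
    (hb : ∀ g g' x, b (g * g') x = b g x + b g' (g⁻¹ • x)) (hb' : ∀ᶠ g in 𝓝 1, ∀ x, b g x = 0) :
    ∃ c : G → X → ZMod 4, (∀ g g' x, c (g * g') x = c g x + χ g * c g' (g⁻¹ • x)) ∧
      (∀ g x, redTwo (c g x) = b g x) ∧ ∀ᶠ g in 𝓝 1, ∀ x, c g x = 0 := by
  have hstab (x : X) : IsOpen (MulAction.stabilizer G x : Set G) :=
    Subgroup.isOpen_of_mem_nhds _ (Filter.mem_of_superset hX fun g hg => hg x)
  have hinv {s : G} {x : X} (hs : s ∈ MulAction.stabilizer G x) : s⁻¹ • x = x :=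
    (MulAction.stabilizer G x).inv_mem hs
  choose ψ hψ hψb hψ' using fun x : X => h (MulAction.stabilizer G x) (hstab x) (fun g => b g x)
    (fun s hs t _ => by rw [hb, hinv hs]) (hb'.mono fun g hg => hg x)
  let rep : X → X := fun x => (Quotient.mk (MulAction.orbitRel G X) x).out
  have hrep (g : G) (x : X) : rep (g • x) = rep x :=
    congrArg Quotient.out (Quotient.sound (s := MulAction.orbitRel G X) ⟨g, rfl⟩)
  have ht (x : X) : ∃ t : G, t • rep x = x :=
    MulAction.orbitRel_apply.1
      ((MulAction.orbitRel G X).symm (Quotient.mk_out (s := MulAction.orbitRel G X) x))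
  choose t ht using ht
  let u : G → X → G := fun g x => (t x)⁻¹ * g * t (g⁻¹ • x)
  have hu (g : G) (x : X) : u g x ∈ MulAction.stabilizer G (rep x) := by
    have h1 := ht (g⁻¹ • x)
    rw [hrep] at h1
    rw [MulAction.mem_stabilizer_iff, mul_smul, mul_smul, h1, smul_inv_smul, inv_smul_eq_iff, ht]
  have hu_mul (g g' : G) (x : X) : u (g * g') x = u g x * u g' (g⁻¹ • x) := by
    simp only [u, _root_.mul_inv_rev, mul_smul, mul_assoc, mul_inv_cancel_left]
  choose k hk using fun x : X => ZMod.castHom_surjective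
    (show (2 : ℕ) ∣ 4 by norm_num) (b (t x) x)
  refine ⟨fun g x => k x + χ (t x) * ψ (rep x) (u g x) - χ g * k (g⁻¹ • x),
    fun g g' x => ?_, fun g x => ?_, ?_⟩
  · have h1 : (χ (t x) : ZMod 4) * χ (u g x) = χ g * χ (t (g⁻¹ • x)) := by
      rw [← Units.val_mul, ← Units.val_mul, ← map_mul, ← map_mul]
      simp only [u]
      congr 2
      group
    have h2 := hu g' (g⁻¹ • x)
    rw [hrep] at h2
    simp only [hu_mul, hψ _ _ (hu g x) _ h2, hrep, _root_.mul_inv_rev, mul_smul, map_mul, Units.val_mul]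
    linear_combination ψ (rep x) (u g' (g⁻¹ • x)) * h1
  · have hunit (a : (ZMod 4)ˣ) : redTwo a = 1 := by
      revert a; decide
    rw [map_sub, map_add, map_mul, map_mul, hunit, hunit, one_mul, one_mul, hψb _ _ (hu g x), hk,
      hk]
    have h1 := hb (t x) (u g x) x
    have h2 := hb g (t (g⁻¹ • x)) x
    have h3 : t x * u g x = g * t (g⁻¹ • x) := by simp only [u]; group
    have h4 : (t x)⁻¹ • x = rep x := by rw [inv_smul_eq_iff, ht]
    rw [h3, h2, h4] at h1
    linear_combination -h1
  · have hconj : ∀ᶠ g in 𝓝 1, ∀ x, ψ (rep x) ((t x)⁻¹ * g * t x) = 0 :=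
      Filter.eventually_all.2 fun x => eventually_conj (hψ' (rep x)) (t x)
    filter_upwards [hX, hχ, hconj] with g hg hχg hcg x
    have : g⁻¹ • x = x := by rw [inv_smul_eq_iff, hg]
    simp [u, this, hcg x, hχg]

end Cocycles

section Averaging

theorem isUnit_of_isUnit_redTwo {a : ZMod 4} (h : IsUnit (redTwo a)) : IsUnit a := by
  have h1 : redTwo a ≠ 0 := h.ne_zero
  have : a * a = 1 := by
    revert h1
    clear h
    revert a
    decide
  exact IsUnit.of_mul_eq_one _ this

variable {ι : Type*} [Fintype ι] [DecidableEq ι]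

/-- Reduction of invertible matrices modulo two. -/
abbrev GLRedTwo (ι : Type*) [Fintype ι] [DecidableEq ι] : GL ι (ZMod 4) →* GL ι (ZMod 2) :=
  Matrix.GeneralLinearGroup.map redTwo

theorem GLRedTwo_surjective : Function.Surjective (GLRedTwo ι) := by
  intro g
  choose f hf using ZMod.castHom_surjective (show (2 : ℕ) ∣ 4 by norm_num)
  let A : Matrix ι ι (ZMod 4) := (g : Matrix ι ι (ZMod 2)).map f
  have hA : redTwo.mapMatrix A = g := by
    ext i j
    exact hf _
  have hu : IsUnit A := by
    rw [Matrix.isUnit_iff_isUnit_det]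
    apply isUnit_of_isUnit_redTwo
    rw [RingHom.map_det, hA]
    exact (Matrix.isUnit_iff_isUnit_det _).1 g.isUnit
  exact ⟨hu.unit, Units.ext hA⟩

theorem ZMod.four_mul_eq_zero_of_redTwo {a b : ZMod 4} (ha : redTwo a = 0) (hb : redTwo b = 0) :
    a * b = 0 := by
  revert a b; decide

theorem mul_eq_zero_of_mapMatrix_redTwo {A B : Matrix ι ι (ZMod 4)}
    (hA : redTwo.mapMatrix A = 0) (hB : redTwo.mapMatrix B = 0) : A * B = 0 := by
  ext i j
  exact Finset.sum_eq_zero fun k _ => ZMod.four_mul_eq_zero_of_redTwo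
    (congrFun (congrFun hA i) k) (congrFun (congrFun hB k) j)

variable {G : Type*} [Group G] [TopologicalSpace G] [IsTopologicalGroup G]

/-- Averaging over the cosets of a subgroup of odd index: a lift over the subgroup yields a lift
over the whole group. -/
theorem exists_lift_of_odd_index (ρ : G →* GL ι (ZMod 2)) (H : Subgroup G)
    (hH : IsOpen (H : Set G)) (hodd : Odd H.index) (σ : H →* GL ι (ZMod 4))
    (hσ : ∀ᶠ h in 𝓝 1, σ h = 1) (hσρ : ∀ h : H, GLRedTwo ι (σ h) = ρ h) :
    ∃ ρ' : G →* GL ι (ZMod 4), (∀ᶠ g in 𝓝 1, ρ' g = 1) ∧ (GLRedTwo ι).comp ρ' = ρ := by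
  have : H.FiniteIndex := ⟨fun h0 => by rw [h0] at hodd; exact absurd hodd (by decide)⟩
  have : Fintype (G ⧸ H) := Fintype.ofFinite _
  choose l hl using fun x : G ⧸ H => GLRedTwo_surjective (ρ x.out)
  have hmem (g : G) : (g : G ⧸ H).out⁻¹ * g ∈ H :=
    QuotientGroup.eq.1 (Quotient.out_eq _)
  let s : G → GL ι (ZMod 4) := fun g => l g * σ ⟨_, hmem g⟩
  have hsρ (g : G) : GLRedTwo ι (s g) = ρ g := by
    rw [map_mul, hl, hσρ, ← map_mul, mul_inv_cancel_left]
  have hs (g : G) (h : H) : s (g * h) = s g * σ h := by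
    have h1 : ((g * h : G) : G ⧸ H) = g := QuotientGroup.mk_mul_of_mem g h.2
    simp only [s, mul_assoc, ← map_mul, h1]
    congr 2
    ext
    simp [mul_assoc]
  let u : G ⧸ H → G → GL ι (ZMod 4) := fun x g => s (g * x.out) * (s x.out)⁻¹
  have hu_mk (g t : G) : u t g = s (g * t) * (s t)⁻¹ := by
    obtain ⟨h, hh⟩ := QuotientGroup.mk_out_eq_mul H t
    simp only [u, hh, ← mul_assoc, hs]
    group
  have hu_mul (x : G ⧸ H) (g g' : G) : u x (g * g') = u (g' • x) g * u x g' := by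
    have : g' • x = ((g' * x.out : G) : G ⧸ H) := by
      conv_lhs => rw [← Quotient.out_eq x]
      rfl
    rw [this, hu_mk]
    simp only [u, mul_assoc]
    group
  have huρ (x : G ⧸ H) (g : G) : GLRedTwo ι (u x g) = ρ g := by
    simp only [u, map_mul, map_inv, hsρ, mul_inv_cancel_right]
  have hu_near : ∀ᶠ g in 𝓝 1, ∀ x, u x g = 1 := by
    refine Filter.eventually_all.2 fun x => ?_
    have h1 : ∀ᶠ g in 𝓝 (1 : G), ∃ h : H, (h : G) = g ∧ σ h = 1 := by
      rw [Subgroup.nhds_one_eq_map_val hH, Filter.eventually_map]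
      filter_upwards [hσ] with h hh using ⟨h, rfl, hh⟩
    filter_upwards [eventually_conj h1 x.out] with g ⟨h, hh, hσh⟩
    have : g * x.out = x.out * h := by rw [hh]; group
    simp only [u, this, hs, hσh, mul_one, mul_inv_cancel]
  let m : ZMod 4 := H.index
  have hm : m * (Fintype.card (G ⧸ H) : ZMod 4) = 1 := by
    rw [← Nat.card_eq_fintype_card, ← Subgroup.index]
    have : redTwo m ≠ 0 := by
      rw [map_natCast, Ne, ZMod.natCast_eq_zero_iff_even, Nat.not_even_iff_odd]
      exact hodd
    change m * m = 1
    revert this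
    generalize m = a
    revert a
    decide
  let A : G → Matrix ι ι (ZMod 4) := fun g => m • ∑ x, (u x g : Matrix ι ι (ZMod 4))
  have hconst (B : Matrix ι ι (ZMod 4)) : m • ∑ _x : G ⧸ H, B = B := by
    rw [Finset.sum_const, Finset.card_univ, ← Nat.cast_smul_eq_nsmul (ZMod 4), smul_smul, hm,
      one_smul]
  have hA_one (g : G) (hg : ∀ x, u x g = 1) : A g = 1 := by
    simp only [A, hg, Units.val_one]
    exact hconst 1
  have huρ' (x : G ⧸ H) (g : G) : redTwo.mapMatrix (u x g : Matrix ι ι (ZMod 4)) = ρ g :=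
    congrArg Units.val (huρ x g)
  have hAρ (g : G) : redTwo.mapMatrix (A g) = ρ g := by
    have hsmul (M : Matrix ι ι (ZMod 4)) :
        redTwo.mapMatrix (m • M) = redTwo m • redTwo.mapMatrix M := by
      ext i j
      exact map_mul redTwo _ _
    rw [← huρ' (1 : G) g, ← hconst (u (1 : G) g : Matrix ι ι (ZMod 4)), hsmul, hsmul, map_sum,
      map_sum]
    simp only [huρ']
  have hA (g : G) : A g = m • ∑ x, (u x g : Matrix ι ι (ZMod 4)) := rfl
  clear_value A
  have hA_mul (g g' : G) : A (g * g') = A g * A g' := by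
    have hexp (x : G ⧸ H) : (u x (g * g') : Matrix ι ι (ZMod 4)) =
        u (g' • x) g * A g' + A g * u x g' - A g * A g' := by
      have := mul_eq_zero_of_mapMatrix_redTwo
        (A := (u (g' • x) g : Matrix ι ι (ZMod 4)) - A g) (B := u x g' - A g')
        (by rw [map_sub, huρ', hAρ, sub_self]) (by rw [map_sub, huρ', hAρ, sub_self])
      rw [hu_mul, Units.val_mul, ← sub_eq_zero, ← this]
      noncomm_ring
    have hsum : ∑ x, (u (g' • x) g : Matrix ι ι (ZMod 4)) = ∑ x, ↑(u x g) :=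
      Equiv.sum_comp (MulAction.toPerm g') fun x => (u x g : Matrix ι ι (ZMod 4))
    calc A (g * g') = m • ∑ x, (u (g' • x) g * A g' + A g * u x g' - A g * A g') := by
          rw [hA, Finset.sum_congr rfl fun x _ => hexp x]
      _ = (m • ∑ x, (u (g' • x) g : Matrix ι ι (ZMod 4))) * A g' +
          A g * (m • ∑ x, (u x g' : Matrix ι ι (ZMod 4))) - m • ∑ _x : G ⧸ H, A g * A g' := by
          rw [Finset.sum_sub_distrib, Finset.sum_add_distrib, smul_sub, smul_add,
            ← Finset.sum_mul, ← Finset.mul_sum, smul_mul_assoc, mul_smul_comm]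
      _ = A g * A g' := by
          rw [hsum, hconst, ← hA, ← hA]
          exact add_sub_cancel_right _ _
  have hu_one (x : G ⧸ H) : u x 1 = 1 := by simp [u]
  let ρ' : G →* GL ι (ZMod 4) := MonoidHom.toHomUnits
    { toFun := A
      map_one' := hA_one 1 hu_one
      map_mul' := hA_mul }
  exact ⟨ρ', hu_near.mono fun g hg => Units.ext (hA_one g hg),
    MonoidHom.ext fun g => Units.ext (hAρ g)⟩

end Averaging

section Blocks

variable {α β : Type*} [DecidableEq α] [DecidableEq β] {R : Type*} [CommRing R]

theorem permMatrix_injective [Nontrivial R] :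
    Function.Injective fun σ : Equiv.Perm α => σ.permMatrix R := by
  intro σ σ' h
  ext i
  have h1 := congrFun (congrFun h i) (σ i)
  by_contra hne
  simp [PEquiv.toMatrix_apply, eq_comm] at h1
  exact hne h1

/-- The block upper triangular matrix whose diagonal blocks are the permutation matrix of `σ`,
scaled by `c`, and the permutation matrix of `τ`. -/
def permBlocks (c : R) (σ : Equiv.Perm α) (τ : Equiv.Perm β) (B : Matrix α β R) :
    Matrix (α ⊕ β) (α ⊕ β) R :=
  Matrix.fromBlocks (c • (σ⁻¹).permMatrix R) (B.submatrix id τ) 0 ((τ⁻¹).permMatrix R)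

theorem permBlocks_one : permBlocks (1 : R) (1 : Equiv.Perm α) (1 : Equiv.Perm β) 0 = 1 := by
  simp [permBlocks]

theorem permBlocks_inj [Nontrivial R] {σ σ' : Equiv.Perm α} {τ τ' : Equiv.Perm β}
    {B B' : Matrix α β R} :
    permBlocks 1 σ τ B = permBlocks 1 σ' τ' B' ↔ σ = σ' ∧ τ = τ' ∧ B = B' := by
  refine ⟨fun h => ?_, by rintro ⟨rfl, rfl, rfl⟩; rfl⟩
  rw [permBlocks, permBlocks, Matrix.fromBlocks_inj, one_smul, one_smul] at h
  obtain ⟨h1, h2, -, h3⟩ := h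
  obtain rfl := inv_injective (permMatrix_injective h1)
  obtain rfl := inv_injective (permMatrix_injective h3)
  refine ⟨rfl, rfl, ?_⟩
  ext i j
  simpa using congrFun (congrFun h2 i) (τ⁻¹ j)

variable [Fintype α] [Fintype β]

theorem permMatrix_inv_mul_apply {γ : Type*} (σ : Equiv.Perm α) (M : Matrix α γ R) :
    (σ⁻¹).permMatrix R * M = M.submatrix ⇑σ⁻¹ id :=
  PEquiv.toMatrix_toPEquiv_mul _ _

theorem mul_permMatrix_inv_apply {γ : Type*} (σ : Equiv.Perm α) (M : Matrix γ α R) :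
    M * (σ⁻¹).permMatrix R = M.submatrix id σ :=
  PEquiv.mul_toMatrix_toPEquiv _ _

theorem permBlocks_mul (c c' : R) (σ σ' : Equiv.Perm α) (τ τ' : Equiv.Perm β)
    (B B' : Matrix α β R) :
    permBlocks c σ τ B * permBlocks c' σ' τ' B' =
      permBlocks (c * c') (σ * σ') (τ * τ') (B + c • B'.submatrix ⇑σ⁻¹ ⇑τ⁻¹) := by
  rw [permBlocks, permBlocks, permBlocks, Matrix.fromBlocks_multiply]
  congr 1
  · rw [Matrix.mul_zero, add_zero, smul_mul_smul_comm, permMatrix_inv_mul_apply]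
    rfl
  · rw [Matrix.smul_mul, permMatrix_inv_mul_apply, mul_permMatrix_inv_apply]
    ext i j
    simp [add_comm]
  · simp
  · rw [Matrix.zero_mul, zero_add, permMatrix_inv_mul_apply]
    rfl

theorem permBlocks_mul_inv (σ : Equiv.Perm α) (τ : Equiv.Perm β) (B : Matrix α β R) :
    permBlocks 1 σ τ B * permBlocks 1 σ⁻¹ τ⁻¹ (-B.submatrix σ τ) = 1 := by
  rw [permBlocks_mul, mul_inv_cancel, mul_inv_cancel, one_mul, ← permBlocks_one]
  congr 1
  ext i j
  simp

theorem mapMatrix_permBlocks {S : Type*} [CommRing S] (f : R →+* S) (c : R) (σ : Equiv.Perm α)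
    (τ : Equiv.Perm β) (B : Matrix α β R) :
    f.mapMatrix (permBlocks c σ τ B) = permBlocks (f c) σ τ (B.map f) := by
  ext (i | i) (j | j) <;> simp [permBlocks, PEquiv.toMatrix_apply, apply_ite f]

variable (α β) in
/-- The group of invertible block upper triangular matrices over `𝔽₂` with permutation matrices as
diagonal blocks. -/
def permBlockSubgroup : Subgroup (GL (α ⊕ β) (ZMod 2)) where
  carrier := {g | ∃ σ τ B, (g : Matrix (α ⊕ β) (α ⊕ β) (ZMod 2)) = permBlocks 1 σ τ B}
  one_mem' := ⟨1, 1, 0, permBlocks_one.symm⟩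
  mul_mem' := by
    rintro g g' ⟨σ, τ, B, h⟩ ⟨σ', τ', B', h'⟩
    exact ⟨_, _, _, by rw [Units.val_mul, h, h', permBlocks_mul, one_mul]⟩
  inv_mem' := by
    rintro g ⟨σ, τ, B, h⟩
    exact ⟨_, _, _, Units.inv_eq_of_mul_eq_one_right (by rw [h, permBlocks_mul_inv])⟩

theorem card_permBlockSubgroup :
    Nat.card (permBlockSubgroup α β) = (Fintype.card α).factorial * (Fintype.card β).factorial *
      2 ^ (Fintype.card α * Fintype.card β) := by
  let f : Equiv.Perm α × Equiv.Perm β × Matrix α β (ZMod 2) → permBlockSubgroup α β := fun x =>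
    ⟨⟨permBlocks 1 x.1 x.2.1 x.2.2, permBlocks 1 x.1⁻¹ x.2.1⁻¹ (-x.2.2.submatrix x.1 x.2.1),
      permBlocks_mul_inv _ _ _, mul_eq_one_comm.1 (permBlocks_mul_inv _ _ _)⟩, _, _, _, rfl⟩
  have hf : Function.Bijective f := by
    refine ⟨fun x y h => ?_, ?_⟩
    · obtain ⟨h1, h2, h3⟩ := permBlocks_inj.1 (congrArg
        (fun g : permBlockSubgroup α β => (g : GL (α ⊕ β) (ZMod 2)).val) h)
      exact Prod.ext h1 (Prod.ext h2 h3)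
    · rintro ⟨g, σ, τ, B, h⟩
      exact ⟨(σ, τ, B), Subtype.ext (Units.ext h.symm)⟩
  rw [← Nat.card_eq_of_bijective f hf, Nat.card_prod, Nat.card_prod, Nat.card_perm, Nat.card_perm,
    Nat.card_eq_fintype_card (α := Matrix α β (ZMod 2)), Nat.card_eq_fintype_card,
    Nat.card_eq_fintype_card, mul_assoc]
  congr 2
  change Fintype.card (α → β → ZMod 2) = _
  rw [Fintype.card_fun, Fintype.card_fun, ZMod.card, ← pow_mul, mul_comm]

variable {G : Type*} [Group G] [TopologicalSpace G] [IsTopologicalGroup G]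

theorem exists_lift_of_mem_permBlockSubgroup {χ : G →* (ZMod 4)ˣ} (hL : LiftsCharacters G χ)
    (hχ : ∀ᶠ s in 𝓝 1, χ s = 1) (ρ : G →* GL (α ⊕ β) (ZMod 2)) (hρ : ∀ᶠ g in 𝓝 1, ρ g = 1)
    (hP : ∀ g, ρ g ∈ permBlockSubgroup α β) :
    ∃ ρ' : G →* GL (α ⊕ β) (ZMod 4), (∀ᶠ g in 𝓝 1, ρ' g = 1) ∧
      ∀ g, GLRedTwo (α ⊕ β) (ρ' g) = ρ g := by
  choose σ τ B h using hP
  have hmul (g g' : G) : σ (g * g') = σ g * σ g' ∧ τ (g * g') = τ g * τ g' ∧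
      B (g * g') = B g + (B g').submatrix ⇑(σ g)⁻¹ ⇑(τ g)⁻¹ := by
    rw [← permBlocks_inj, ← h, map_mul, Units.val_mul, h, h, permBlocks_mul, one_smul, one_mul]
  have hone (g : G) (hg : ρ g = 1) : σ g = 1 ∧ τ g = 1 ∧ B g = 0 := by
    rw [← permBlocks_inj, ← h, hg, permBlocks_one, Units.val_one]
  obtain ⟨hσ1, hτ1, -⟩ := hone 1 (map_one ρ)
  let : MulAction G (α × β) :=
    { smul := fun g x => (σ g x.1, τ g x.2)
      one_smul := fun x => Prod.ext (DFunLike.congr_fun (hσ1) x.1)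
        (DFunLike.congr_fun (hτ1) x.2)
      mul_smul := fun g g' x => Prod.ext (DFunLike.congr_fun ((hmul g g').1) x.1)
        (DFunLike.congr_fun ((hmul g g').2.1) x.2) }
  have hσinv (g : G) : σ g⁻¹ = (σ g)⁻¹ :=
    eq_inv_of_mul_eq_one_left (by rw [← (hmul _ _).1, inv_mul_cancel, hσ1])
  have hτinv (g : G) : τ g⁻¹ = (τ g)⁻¹ :=
    eq_inv_of_mul_eq_one_left (by rw [← (hmul _ _).2.1, inv_mul_cancel, hτ1])
  have hsmul (g : G) (x : α × β) : g⁻¹ • x = ((σ g)⁻¹ x.1, (τ g)⁻¹ x.2) := by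
    rw [← hσinv, ← hτinv]
    rfl
  obtain ⟨c, hc, hcB, hc1⟩ := hL.exists_lift_cocycle hχ (X := α × β)
    (hρ.mono fun g hg x => Prod.ext (DFunLike.congr_fun ((hone g hg).1) x.1)
        (DFunLike.congr_fun ((hone g hg).2.1) x.2))
    (fun g x => B g x.1 x.2)
    (fun g g' x => by rw [(hmul g g').2.2, hsmul]; rfl)
    (hρ.mono fun g hg x => by rw [(hone g hg).2.2]; rfl)
  let A : G → Matrix (α ⊕ β) (α ⊕ β) (ZMod 4) := fun g =>
    permBlocks (χ g : ZMod 4) (σ g) (τ g) (Matrix.of fun i j => c g (i, j))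
  have hA1 (g : G) (hg : ρ g = 1) (hχg : χ g = 1) (hcg : ∀ x, c g x = 0) : A g = 1 := by
    simp only [A, (hone g hg).1, (hone g hg).2.1, hχg, hcg]
    exact permBlocks_one
  have hA_mul (g g' : G) : A (g * g') = A g * A g' := by
    simp only [A]
    rw [permBlocks_mul, map_mul, Units.val_mul, (hmul g g').1, (hmul g g').2.1]
    congr 1
    ext i j
    simp [hc, hsmul]
  have hc_one (x : α × β) : c 1 x = 0 := by
    have := hc 1 1 x
    simpa using this
  refine ⟨MonoidHom.toHomUnits
    { toFun := A
      map_one' := hA1 1 (map_one ρ) (map_one χ) hc_one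
      map_mul' := hA_mul }, ?_, fun g => Units.ext ?_⟩
  · filter_upwards [hρ, hχ, hc1] with g h1 h2 h3 using Units.ext (hA1 g h1 h2 h3)
  · have hunit (a : (ZMod 4)ˣ) : redTwo a = 1 := by
      revert a; decide
    change redTwo.mapMatrix (A g) = ρ g
    rw [h, mapMatrix_permBlocks, hunit]
    congr 1
    ext i j
    exact hcB g (i, j)

theorem exists_subgroup_conj_le {Γ : Type*} [Group Γ] [Finite Γ] (P : Subgroup Γ)
    (hP : Odd P.index) (ρ : G →* Γ) (hρ : ∀ᶠ g in 𝓝 1, ρ g = 1) :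
    ∃ (H : Subgroup G) (γ : Γ), IsOpen (H : Set G) ∧ Odd H.index ∧
      ∀ g ∈ H, γ⁻¹ * ρ g * γ ∈ P := by
  obtain ⟨Q⟩ : Nonempty (Sylow 2 ρ.range) := inferInstance
  obtain ⟨x, hx⟩ := Q.2.nonempty_fixed_point_of_prime_not_dvd_card (Γ ⧸ P)
    (by rw [← Subgroup.index, ← even_iff_two_dvd, Nat.not_even_iff_odd]; exact hP)
  obtain ⟨γ, rfl⟩ := QuotientGroup.mk_surjective x
  refine ⟨(Q : Subgroup ρ.range).comap ρ.rangeRestrict, γ, ?_, ?_, fun g hg => ?_⟩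
  · refine Subgroup.isOpen_of_mem_nhds (g := 1) _ ?_
    filter_upwards [hρ] with g hg
    change ρ.rangeRestrict g ∈ (Q : Subgroup ρ.range)
    rw [show ρ.rangeRestrict g = 1 from Subtype.ext hg]
    exact one_mem _
  · rw [Subgroup.index_comap_of_surjective _ ρ.rangeRestrict_surjective,
      ← Nat.not_even_iff_odd, even_iff_two_dvd]
    exact Q.not_dvd_index
  · have h1 : ((ρ g * γ : Γ) : Γ ⧸ P) = γ := hx ⟨ρ.rangeRestrict g, hg⟩
    rw [mul_assoc]
    exact QuotientGroup.eq.1 h1.symm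

/-- Lifting for representations of dimension `|α| + |β|`, provided `permBlockSubgroup α β` contains
a Sylow 2-subgroup. -/
theorem exists_lift_of_odd_index_permBlockSubgroup {χ : G →* (ZMod 4)ˣ}
    (hL : LiftsCharacters G χ) (hχ : ∀ᶠ s in 𝓝 1, χ s = 1)
    (hP : Odd (permBlockSubgroup α β).index) (ρ : G →* GL (α ⊕ β) (ZMod 2))
    (hρ : ∀ᶠ g in 𝓝 1, ρ g = 1) :
    ∃ ρ' : G →* GL (α ⊕ β) (ZMod 4), (∀ᶠ g in 𝓝 1, ρ' g = 1) ∧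
      (GLRedTwo (α ⊕ β)).comp ρ' = ρ := by
  obtain ⟨H, γ, hH, hodd, hHP⟩ := exists_subgroup_conj_le _ hP ρ hρ
  obtain ⟨δ, rfl⟩ := GLRedTwo_surjective γ
  have hsub {p : G → Prop} (hp : ∀ᶠ g in 𝓝 1, p g) : ∀ᶠ h : H in 𝓝 1, p h := by
    rwa [Subgroup.nhds_one_eq_map_val hH, Filter.eventually_map] at hp
  obtain ⟨σ, hσ, hσρ⟩ := exists_lift_of_mem_permBlockSubgroup (hL.restrict hH) (hsub hχ)
    ((MulAut.conj (GLRedTwo (α ⊕ β) δ)⁻¹).toMonoidHom.comp (ρ.comp H.subtype))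
    ((hsub hρ).mono fun h hh => by simp [hh])
    (fun h => by simpa using hHP h h.2)
  refine exists_lift_of_odd_index ρ H hH hodd ((MulAut.conj δ).toMonoidHom.comp σ)
    (hσ.mono fun h hh => by simp [hh]) fun h => ?_
  have : GLRedTwo (α ⊕ β) (σ h) = (GLRedTwo _ δ)⁻¹ * ρ h * GLRedTwo _ δ :=
    (hσρ h).trans (by simp)
  change GLRedTwo (α ⊕ β) (δ * σ h * δ⁻¹) = ρ h
  rw [map_mul, map_mul, map_inv, this]
  group

theorem odd_index_permBlockSubgroup {n : ℕ} (e : Fin n ≃ α ⊕ β) {m : ℕ} (hm : Odd m)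
    (h : ∏ i : Fin n, (2 ^ n - 2 ^ (i : ℕ)) = (Fintype.card α).factorial *
      (Fintype.card β).factorial * 2 ^ (Fintype.card α * Fintype.card β) * m) :
    Odd (permBlockSubgroup α β).index := by
  have h1 := (permBlockSubgroup α β).card_mul_index
  have h2 := Matrix.card_GL_field (𝔽 := ZMod 2) n
  rw [ZMod.card, h, ← card_permBlockSubgroup, Nat.card_congr (Units.mapEquiv
    (Matrix.reindexRingEquiv (ZMod 2) e).toMulEquiv).toEquiv, ← h1] at h2
  rwa [Nat.eq_of_mul_eq_mul_left Nat.card_pos h2]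

end Blocks

theorem continuous_bot_iff_eventually_eq_one {G M : Type*} [Group G] [TopologicalSpace G]
    [IsTopologicalGroup G] [Group M] (f : G →* M) :
    Continuous[_, ⊥] ⇑f ↔ ∀ᶠ g in 𝓝 1, f g = 1 := by
  let : TopologicalSpace M := ⊥
  have : DiscreteTopology M := ⟨rfl⟩
  rw [← map_one f, ← Filter.tendsto_pure, ← nhds_discrete]
  exact ⟨fun h => h.tendsto 1, continuous_of_continuousAt_one f⟩

theorem exists_lift_of_equiv_sum {α β : Type*} [Fintype α] [DecidableEq α] [Fintype β]
    [DecidableEq β] {n : ℕ} (e : Fin n ≃ α ⊕ β) {m : ℕ} (hm : Odd m)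
    (h : ∏ i : Fin n, (2 ^ n - 2 ^ (i : ℕ)) = (Fintype.card α).factorial *
      (Fintype.card β).factorial * 2 ^ (Fintype.card α * Fintype.card β) * m)
    {G : Type*} [Group G] [TopologicalSpace G] [IsTopologicalGroup G] {χ : G →* (ZMod 4)ˣ}
    (hL : LiftsCharacters G χ) (hχ : ∀ᶠ s in 𝓝 1, χ s = 1)
    (ρ : G →* GL (Fin n) (ZMod 2)) (hρ : ∀ᶠ g in 𝓝 1, ρ g = 1) :
    ∃ ρ' : G →* GL (Fin n) (ZMod 4), (∀ᶠ g in 𝓝 1, ρ' g = 1) ∧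
      (GLRedTwo (Fin n)).comp ρ' = ρ := by
  let E (R : Type) [CommRing R] : GL (Fin n) R ≃* GL (α ⊕ β) R :=
    Units.mapEquiv (Matrix.reindexRingEquiv R e).toMulEquiv
  obtain ⟨ρ', h1, h2⟩ := exists_lift_of_odd_index_permBlockSubgroup hL hχ
    (odd_index_permBlockSubgroup e hm h) ((E (ZMod 2)).toMonoidHom.comp ρ)
    (hρ.mono fun g hg => by simp [hg])
  refine ⟨(E (ZMod 4)).symm.toMonoidHom.comp ρ', h1.mono fun g hg => by simp [hg], ?_⟩
  ext g : 1
  apply (E (ZMod 2)).injective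
  refine Eq.trans ?_ (DFunLike.congr_fun h2 g)
  ext i j
  simp [E, Units.mapEquiv]

/-- De Clercq–Florence. For every field `F` and every positive `n ≤ 4`,
every continuous homomorphism `Γ_F → GL_n(F2)` lifts to `GL_n(ℤ/4ℤ)`. -/
theorem gl_n_f2_lifts (F : Type) [Field F] (n : ℕ) (hn : 0 < n) (hn4 : n ≤ 4)
    (ρ : Field.absoluteGaloisGroup F →* GL (Fin n) (ZMod 2)) (hρ : Continuous[_, ⊥] ⇑ρ) :
    ∃ ρ' : Field.absoluteGaloisGroup F →* GL (Fin n) (ZMod 4),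
      Continuous[_, ⊥] ⇑ρ' ∧
        (Matrix.GeneralLinearGroup.map
          (ZMod.castHom (show (2 : ℕ) ∣ 4 by norm_num) (ZMod 2))).comp ρ' = ρ := by
  obtain ⟨χ, hχ, hL⟩ : ∃ χ : Field.absoluteGaloisGroup F →* (ZMod 4)ˣ,
      (∀ᶠ s in 𝓝 1, χ s = 1) ∧ LiftsCharacters (Field.absoluteGaloisGroup F) χ :=
    exists_liftsCharacters F (AlgebraicClosure F)
  rw [continuous_bot_iff_eventually_eq_one] at hρ
  simp only [continuous_bot_iff_eventually_eq_one]
  interval_cases n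
  · exact exists_lift_of_equiv_sum (finSumFinEquiv (m := 1) (n := 0)).symm (m := 1)
      (by decide) (by decide) hL hχ ρ hρ
  · exact exists_lift_of_equiv_sum (finSumFinEquiv (m := 2) (n := 0)).symm (m := 3)
      (by decide) (by decide) hL hχ ρ hρ
  · exact exists_lift_of_equiv_sum (finSumFinEquiv (m := 2) (n := 1)).symm (m := 21)
      (by decide) (by decide) hL hχ ρ hρ
  · exact exists_lift_of_equiv_sum (finSumFinEquiv (m := 2) (n := 2)).symm (m := 315)
      (by decide) (by simp [Fin.prod_univ_succ]) hL hχ ρ hρ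
end

section
/- For every field F and every positive integer n ≤ 4, every continuous homomorphism ρ : Γ_F → B_n(𝔽₂) lifts to ℤ/4ℤ: there exists a continuous homomorphism ρ̃ : Γ_F → B_n(ℤ/4ℤ) whose composite with the entrywise reduction map B_n(ℤ/4ℤ) → B_n(𝔽₂) equals ρ. -/
open Matrix Topology

theorem zmod_two_eq_zero_or_one : ∀ x : ZMod 2, x = 0 ∨ x = 1 := by decide

theorem exists_fixed_not_fixed {F : Type*} [Field F] {L : Type*} [Field L] [Algebra F L]
    [Normal F L] {U : Subgroup Gal(L/F)} (hU : (U : Set Gal(L/F)) ∈ nhds 1)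
    {g : Gal(L/F)} (hg : g ∉ U) : ∃ y : L, (∀ h ∈ U, h y = y) ∧ g y ≠ y := by
  obtain ⟨E, hE, hnormal, hEU⟩ := (krullTopology_mem_nhds_one_iff_of_normal F L _).1 hU
  by_contra! hcon
  let V := U.map (AlgEquiv.restrictNormalHom E)
  have hmem : AlgEquiv.restrictNormalHom E g ∈ V := by
    rw [← IntermediateField.fixingSubgroup_fixedField V, IntermediateField.mem_fixingSubgroup_iff]
    intro x hx
    refine Subtype.ext ?_
    rw [AlgEquiv.restrictNormalHom_apply]
    refine hcon x fun h hh ↦ ?_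
    rw [← AlgEquiv.restrictNormalHom_apply]
    exact congrArg Subtype.val (hx ⟨_, Subgroup.mem_map_of_mem _ hh⟩)
  obtain ⟨h, hh, hhg⟩ := hmem
  have hker : h⁻¹ * g ∈ U := by
    apply hEU
    rw [SetLike.mem_coe, ← IntermediateField.restrictNormalHom_ker, MonoidHom.mem_ker, map_mul, map_inv, hhg,
      inv_mul_cancel]
  exact hg (by simpa using U.mul_mem hh hker)

/-- The cocycle identity for functions from a group to the functions on a set on which it acts. -/
def IsSetCocycle {Γ S A : Type*} [Group Γ] [MulAction Γ S] [AddCommGroup A] (φ : Γ → S → A) : Prop :=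
  ∀ g h s, φ (g * h) s = φ h s + φ g (h • s)

theorem exists_swapped_pair {F : Type*} [Field F] {L : Type*} [Field L] [Algebra F L]
    [Normal F L] {S : Type*} [MulAction Gal(L/F) S] {φ : Gal(L/F) → S → ZMod 2}
    (hφ : IsSetCocycle φ) {U : Set Gal(L/F)} (hU : U ∈ nhds 1)
    (hUS : ∀ g ∈ U, ∀ s : S, g • s = s ∧ φ g s = 0) (s : S) :
    ∃ y : ZMod 2 → L, y 0 ≠ y 1 ∧ ∀ g : Gal(L/F), g • s = s → ∀ i, g • y i = y (i + φ g s) := by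
  have hone (s) : φ 1 s = 0 := by simpa using hφ 1 1 s
  have hmul {g h : Gal(L/F)} (hh : h • s = s) : φ (g * h) s = φ h s + φ g s := by rw [hφ, hh]
  let V : Subgroup Gal(L/F) :=
    { carrier := {g | g • s = s ∧ φ g s = 0}
      one_mem' := ⟨one_smul _ _, hone s⟩
      mul_mem' := fun {g h} hg hh ↦
        ⟨by rw [mul_smul, hh.1, hg.1], by rw [hmul hh.1, hh.2, hg.2, add_zero]⟩
      inv_mem' := fun {g} hg ↦ by
        refine ⟨by rw [inv_smul_eq_iff, hg.1], ?_⟩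
        have := hmul (g := g⁻¹) hg.1
        rwa [inv_mul_cancel, hone, hg.2, zero_add, eq_comm] at this }
  by_cases htriv : ∀ g : Gal(L/F), g • s = s → φ g s = 0
  · refine ⟨fun i ↦ if i = 0 then 0 else 1, by simp, fun g hg i ↦ ?_⟩
    rw [htriv g hg, add_zero]
    beta_reduce
    split_ifs <;> simp
  push Not at htriv
  obtain ⟨g₀, hg₀, hφ₀⟩ := htriv
  have hφ₀' : φ g₀ s = 1 := (zmod_two_eq_zero_or_one _).resolve_left hφ₀
  have hV : (V : Set Gal(L/F)) ∈ nhds 1 := Filter.mem_of_superset hU fun g hg ↦ hUS g hg s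
  obtain ⟨y, hy, hne⟩ := exists_fixed_not_fixed (g := g₀) hV fun h ↦ hφ₀ h.2
  have hinv : g₀⁻¹ • s = s := by rw [inv_smul_eq_iff, hg₀]
  have hφinv : φ g₀⁻¹ s = 1 := by
    have := hmul (g := g₀⁻¹) hg₀
    rw [inv_mul_cancel, hone, hφ₀'] at this
    generalize φ g₀⁻¹ s = x at *
    revert x; decide
  have key (g : Gal(L/F)) (hg : g • s = s) (hgφ : φ g s = 1) : g y = g₀ y := by
    have : (g₀⁻¹ * g) y = y := hy _ ⟨by rw [mul_smul, hg, hinv], by rw [hmul hg, hgφ, hφinv]; rfl⟩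
    conv_rhs => rw [← this, ← AlgEquiv.mul_apply, mul_inv_cancel_left]
  refine ⟨fun i ↦ if i = 0 then y else g₀ y, by simpa using hne.symm, fun g hg i ↦ ?_⟩
  have h2 : (1 : ZMod 2) + 1 = 0 := rfl
  have hgg : (g * g₀) • s = s := by rw [mul_smul, hg₀, hg]
  rcases zmod_two_eq_zero_or_one i with rfl | rfl <;> rcases zmod_two_eq_zero_or_one (φ g s) with h | h
  · simpa [h] using hy g ⟨hg, h⟩
  · simpa [h] using key g hg h
  · simpa [h] using key (g * g₀) hgg (by rw [hmul hg₀, h, hφ₀', add_zero])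
  · simpa [h, h2] using hy (g * g₀) ⟨hgg, by rw [hmul hg₀, h, hφ₀', h2]⟩

theorem IsSetCocycle.exists_equivariant {Γ S L : Type*} [Group Γ] [MulAction Γ S] [MulAction Γ L]
    {φ : Γ → S → ZMod 2} (hφ : IsSetCocycle φ)
    (hy : ∀ s, ∃ y : ZMod 2 → L, y 0 ≠ y 1 ∧ ∀ g : Γ, g • s = s → ∀ i, g • y i = y (i + φ g s)) :
    ∃ Y : S → ZMod 2 → L, (∀ s, Y s 0 ≠ Y s 1) ∧ ∀ g s i, g • Y s i = Y (g • s) (i + φ g s) := by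
  choose y hne hy using hy
  let r (s : S) : S := (Quotient.mk (MulAction.orbitRel Γ S) s).out
  have hr (g : Γ) (s : S) : r (g • s) = r s := by
    refine congrArg Quotient.out (Quotient.sound ?_)
    exact ⟨g, rfl⟩
  have hk (s : S) : ∃ k : Γ, k • r s = s :=
    (MulAction.orbitRel Γ S).symm (Quotient.mk_out (s := MulAction.orbitRel Γ S) s)
  choose k hk using hk
  refine ⟨fun s i ↦ k s • y (r s) (i + φ (k s) (r s)), fun s h ↦ ?_, fun g s i ↦ ?_⟩
  · have hinj := (MulAction.injective (k s)) h
    generalize φ (k s) (r s) = x at hinj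
    rcases zmod_two_eq_zero_or_one x with rfl | rfl
    · exact hne _ (by simpa using hinj)
    · exact hne _ (by simpa [show (1 : ZMod 2) + 1 = 0 from rfl] using hinj.symm)
  · beta_reduce
    obtain ⟨h, hh⟩ : ∃ h, g * k s = k (g • s) * h := ⟨(k (g • s))⁻¹ * (g * k s), by simp⟩
    have hstab : h • r s = r s := by
      apply MulAction.injective (k (g • s))
      beta_reduce
      rw [← mul_smul, ← hh, mul_smul, hk]
      conv_rhs => rw [← hr g s, hk]
    rw [← mul_smul, hh, mul_smul, hy _ h hstab, hr]
    congr 2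
    have e := hφ g (k s) (r s)
    rw [hh, hφ, hstab, hk] at e
    have h2 : (2 : ZMod 2) = 0 := rfl
    linear_combination e + (φ (k s) (r s) - φ (k (g • s)) (r s)) * h2

section

/-- Reduction mod 2. -/
abbrev redMod : ZMod 4 →+* ZMod 2 := ZMod.castHom (show (2 : ℕ) ∣ 4 by norm_num) (ZMod 2)

/-- A lift of the cocycle `φ` to a cocycle with values in `ZMod 4` twisted by a character `χ`; both
are trivial on the elements of `Γ` which act trivially on `S` and on a finite subset of `L`. -/
structure TwistedLift {Γ S : Type*} (L : Type*) [Group Γ] [MulAction Γ S] [SMul Γ L]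
    (φ : Γ → S → ZMod 2) where
  χ : Γ →* ZMod 4
  ψ : Γ → S → ZMod 4
  cocycle : ∀ g h s, ψ (g * h) s = χ g * ψ h s + ψ g (h • s)
  reduction : ∀ g s, redMod (ψ g s) = φ g s
  support : Set L
  finite : support.Finite
  trivial : ∀ g : Γ, (∀ x ∈ support, g • x = x) → (∀ s : S, g • s = s) → χ g = 1 ∧ ∀ s, ψ g s = 0

variable {Γ S L : Type*} [Group Γ] [MulAction Γ S] [Finite S] [Field L] [IsAlgClosed L]
    [MulSemiringAction Γ L] {φ : Γ → S → ZMod 2}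

theorem nonempty_twistedLift_of_charP_two [CharP L 2] (hφ : IsSetCocycle φ)
    {Y : S → ZMod 2 → L} (hne : ∀ s, Y s 0 ≠ Y s 1)
    (hY : ∀ (g : Γ) s i, g • Y s i = Y (g • s) (i + φ g s)) : Nonempty (TwistedLift L φ) := by
  have h2 : (2 : L) = 0 := CharTwo.two_eq_zero
  let ι : ZMod 2 →+* L := ZMod.castHom dvd_rfl L
  have hι : Function.Injective ι := ι.injective
  have hfix (g : Γ) (x : ZMod 2) : g • ι x = ι x := by
    rcases zmod_two_eq_zero_or_one x with rfl | rfl <;> simp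
  have hidem (x : ZMod 2) : ι x ^ 2 = ι x := by
    rcases zmod_two_eq_zero_or_one x with rfl | rfl <;> simp
  have hY0 (s) : Y s 0 + Y s 1 ≠ 0 := by
    rw [Ne, CharTwo.add_eq_zero]
    exact hne s
  let u (s : S) : L := Y s 0 / (Y s 0 + Y s 1)
  have hu (g : Γ) (s) : g • u s = u (g • s) + ι (φ g s) := by
    have h0 := hY0 (g • s)
    simp only [u, smul_div₀', smul_add, hY]
    rcases zmod_two_eq_zero_or_one (φ g s) with h | h
    · simp [h]
    · rw [h, zero_add, show (1 : ZMod 2) + 1 = 0 from rfl, add_comm (Y _ 1), map_one, div_add_one h0,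
        div_left_inj' h0]
      linear_combination (-Y (g • s) 0) * h2
  choose t ht using fun s ↦ IsAlgClosed.exists_root
    (Polynomial.X ^ 2 + Polynomial.X - Polynomial.C (u s ^ 3 + u s ^ 2)) (by
      rw [show (Polynomial.X ^ 2 + Polynomial.X - Polynomial.C (u s ^ 3 + u s ^ 2) : Polynomial L).degree = 2 by
        compute_degree!]
      norm_num)
  replace ht (s) : t s ^ 2 + t s = u s ^ 3 + u s ^ 2 := by
    simpa [Polynomial.IsRoot, sub_eq_zero] using ht s
  have hε (g : Γ) (s) : ∃ ε : ZMod 2, ι ε = g • t s + t (g • s) + ι (φ g s) * u (g • s) := by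
    have h1 := congrArg (g • ·) (ht s)
    simp only [smul_add, smul_pow', hu] at h1
    have h3 := hidem (φ g s)
    have := ht (g • s)
    set f := ι (φ g s)
    set a := g • t s
    set b := t (g • s)
    set v := u (g • s)
    have : (a + b + f * v) * (a + b + f * v - 1) = 0 := by
      linear_combination h1 + this + (v ^ 2 + 3 * v + f + 2) * h3 + (a * b + a * f * v + b * f * v - a - b
        + 2 * f * v ^ 2 + 2 * v * f + f + v ^ 3 + v ^ 2) * h2
    rcases mul_eq_zero.1 this with h | h
    · exact ⟨0, by rw [h, map_zero]⟩
    · exact ⟨1, by rw [map_one, sub_eq_zero.1 h]⟩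
  choose ε hε using hε
  have hεmul (g h : Γ) (s) : ε (g * h) s = ε h s + ε g (h • s) + φ h s * φ g (h • s) := by
    apply hι
    have e := congrArg (g • ·) (hε h s)
    simp only [hfix, smul_add, smul_mul', hu, ← mul_smul] at e
    simp only [map_add, map_mul, hε (g * h), hε g, e, hφ g h s]
    simp only [mul_smul]
    linear_combination (-(g • t (h • s)) - ι (φ h s) * ι (φ g (h • s))) * h2
  refine ⟨⟨1, fun g s ↦ (φ g s).val + 2 * (ε g s).val, fun g h s ↦ ?_, fun g s ↦ ?_,
    Set.range u ∪ Set.range t, (Set.finite_range u).union (Set.finite_range t), fun g hg hS ↦ ⟨rfl, fun s ↦ ?_⟩⟩⟩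
  · rw [hεmul, hφ, MonoidHom.one_apply, one_mul]
    generalize φ h s = a
    generalize φ g (h • s) = b
    generalize ε h s = c
    generalize ε g (h • s) = d
    revert a b c d
    decide
  · generalize φ g s = a
    generalize ε g s = b
    revert a b
    decide
  · have hφ0 : φ g s = 0 := hι <| by
      have := hu g s
      rw [hS, hg _ (Or.inl ⟨s, rfl⟩)] at this
      simpa using this
    have hε0 : ε g s = 0 := hι <| by
      rw [hε, hS, hg _ (Or.inr ⟨s, rfl⟩), hφ0, CharTwo.add_self_eq_zero]
      simp
    rw [hφ0, hε0]
    rfl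

theorem nonempty_twistedLift_of_two_ne_zero (h2 : (2 : L) ≠ 0) {Y : S → ZMod 2 → L} (hne : ∀ s, Y s 0 ≠ Y s 1)
    (hY : ∀ (g : Γ) s i, g • Y s i = Y (g • s) (i + φ g s)) : Nonempty (TwistedLift L φ) := by
  classical
  have hneg : (-1 : L) ≠ 1 := fun h ↦ h2 (by linear_combination -h)
  obtain ⟨ζ, hζ⟩ := IsAlgClosed.exists_pow_nat_eq (-1 : L) (n := 2) (by norm_num)
  have hζ0 : ζ ≠ 0 := by rintro rfl; simp at hζ
  have hζ4 : ζ ^ 4 = 1 := by linear_combination (ζ ^ 2 - 1) * hζ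
  have hζ' : ζ ≠ -ζ := fun h ↦ mul_ne_zero h2 hζ0 (by linear_combination h)
  let E : AddChar (ZMod 4) L := AddChar.zmodChar 4 hζ4
  have hE (x : ZMod 4) : E x = ζ ^ x.val := rfl
  have hE0 (x) : E x ≠ 0 := pow_ne_zero _ hζ0
  have hζprim : IsPrimitiveRoot ζ 4 :=
    IsPrimitiveRoot.iff_orderOf.2 (orderOf_eq_prime_pow (p := 2) (n := 1) (by simpa [hζ] using hneg) hζ4)
  have hEinj : Function.Injective E := fun x y hxy ↦
    ZMod.val_injective _ (hζprim.pow_inj x.val_lt y.val_lt hxy)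
  have hE2 (x : ZMod 4) : E x ^ 2 = (-1) ^ (redMod x).val := by
    have h : ∀ x : ZMod 4, (redMod x).val = x.val % 2 := by decide
    rw [h, ← neg_one_pow_eq_pow_mod_two, ← hζ, hE, pow_right_comm]
  have hneginj {x y : ZMod 2} (h : (-1 : L) ^ x.val = (-1) ^ y.val) : x = y := by
    have hval : (1 : ZMod 2).val = 1 := rfl
    rcases zmod_two_eq_zero_or_one x with rfl | rfl <;> rcases zmod_two_eq_zero_or_one y with rfl | rfl
    · rfl
    · exact absurd h (by simpa [hval] using hneg.symm)
    · exact absurd h (by simpa [hval] using hneg)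
    · rfl
  have hEsurj {z : L} {x : ZMod 2} (hz : z ^ 2 = (-1) ^ x.val) : ∃ y, E y = z := by
    have hz4 : z ^ 4 = 1 := by
      rw [show 4 = 2 * 2 from rfl, pow_mul, hz, pow_right_comm, neg_one_sq, one_pow]
    obtain ⟨i, hi, rfl⟩ := hζprim.eq_pow_of_pow_eq_one hz4
    exact ⟨i, by rw [hE, ZMod.val_cast_of_lt hi]⟩
  have hζg (g : Γ) : g • ζ = ζ ∨ g • ζ = -ζ := by
    apply sq_eq_sq_iff_eq_or_eq_neg.1
    rw [← smul_pow', hζ, smul_neg, smul_one]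
  let χ : Γ →* ZMod 4 :=
    { toFun := fun g ↦ if g • ζ = ζ then 1 else -1
      map_one' := by simp
      map_mul' := fun g h ↦ by
        rcases hζg g with hg | hg <;> rcases hζg h with hh | hh <;>
          simp [mul_smul, hg, hh, hζ'.symm] }
  have hχ (g : Γ) (x : ZMod 4) : g • E x = E (χ g * x) := by
    have h : g • ζ = E (χ g) := by
      rcases hζg g with hg | hg
      · rw [show χ g = 1 from if_pos hg, hg]
        exact (pow_one ζ).symm
      · rw [show χ g = -1 from if_neg (by rw [hg]; exact hζ'.symm), hg, hE,
          show (-1 : ZMod 4).val = 3 from rfl]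
        linear_combination -ζ * hζ
    rw [hE x, smul_pow', h, ← AddChar.map_nsmul_eq_pow]
    congr 1
    simp [mul_comm]
  let u (s : S) : L := Y s 0 - Y s 1
  have hu0 (s) : u s ≠ 0 := sub_ne_zero.2 (hne s)
  have hu (g : Γ) (s) : g • u s = (-1) ^ (φ g s).val * u (g • s) := by
    simp only [u, smul_sub, hY]
    rcases zmod_two_eq_zero_or_one (φ g s) with h | h <;>
      simp [h, show (1 : ZMod 2) + 1 = 0 from rfl, show (1 : ZMod 2).val = 1 from rfl]
  choose w hw using fun s ↦ IsAlgClosed.exists_pow_nat_eq (u s) (n := 2) (by norm_num)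
  have hw0 (s) : w s ≠ 0 := by
    intro h
    apply hu0 s
    rw [← hw, h]
    simp
  have hψ (g : Γ) (s) : ∃ y, E y = g • w s / w (g • s) := by
    refine hEsurj (x := φ g s) ?_
    rw [div_pow, ← smul_pow', hw, hw, hu, mul_div_cancel_right₀ _ (hu0 _)]
  choose ψ hψ using hψ
  refine ⟨⟨χ, ψ, fun g h s ↦ ?_, fun g s ↦ ?_,
    insert ζ (Set.range w), (Set.finite_range w).insert ζ, fun g hg hS ↦ ⟨?_, fun s ↦ ?_⟩⟩⟩
  · apply hEinj
    rw [AddChar.map_add_eq_mul, ← hχ, hψ, hψ, hψ, smul_div₀', mul_smul, mul_smul]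
    have := hw0 (g • h • s)
    have : g • w (h • s) ≠ 0 := by simpa [smul_eq_zero_iff_eq] using hw0 (h • s)
    field_simp
  · apply hneginj
    rw [← hE2, hψ, div_pow, ← smul_pow', hw, hw, hu, mul_div_cancel_right₀ _ (hu0 _)]
  · exact if_pos (hg _ (Set.mem_insert _ _))
  · apply hEinj
    rw [hψ, hS, hg _ (Or.inr ⟨s, rfl⟩), div_self (hw0 s), AddChar.map_zero_eq_one]

end

/-- The upper triangular matrix with diagonal blocks `χ * P a` and `P c`, where `P` is the regular
representation of `ZMod 2` in a basis whose first vector is invariant, and whose remaining block is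
`P a * m`, with `m` expressed in terms of the permuted bases. -/
def blockLift {R : Type*} [CommRing R] (χ : R) (a c : ZMod 2) (m : ZMod 2 × ZMod 2 → R) :
    Matrix (Fin 4) (Fin 4) R :=
  let α : R := (a.val : R)
  let γ : R := (c.val : R)
  let p := m (1, 0) + m (1, 1) - m (0, 0) - m (0, 1)
  let q := m (1, 1) - m (0, 1)
  !![χ, χ * α, m (0, 0) + m (0, 1) + α * p, m (0, 1) + α * q;
     0, χ * (1 - 2 * α), (1 - 2 * α) * p, (1 - 2 * α) * q;
     0, 0, 1, γ;
     0, 0, 0, 1 - 2 * γ]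

theorem blockLift_mul {R : Type*} [CommRing R] (χ χ' : R) (a c a' c' : ZMod 2)
    (m m' : ZMod 2 × ZMod 2 → R) :
    blockLift χ a c m * blockLift χ' a' c' m' =
      blockLift (χ * χ') (a + a') (c + c') fun s ↦ χ * m' s + m (s + (a', c')) := by
  have h2 : (1 : ZMod 2) + 1 = 0 := rfl
  have v1 : (1 : ZMod 2).val = 1 := rfl
  have vs (x : ZMod 2) : ((x + 1).val : R) = 1 - x.val := by
    rcases zmod_two_eq_zero_or_one x with rfl | rfl <;> simp [h2, v1]
  ext i j
  rcases zmod_two_eq_zero_or_one a' with rfl | rfl <;> rcases zmod_two_eq_zero_or_one c' with rfl | rfl <;>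
    fin_cases i <;> fin_cases j <;>
    simp [blockLift, Matrix.mul_apply, Fin.sum_univ_four, h2, v1, vs] <;> ring

theorem blockLift_one {R : Type*} [CommRing R] : blockLift (1 : R) 0 0 0 = 1 := by
  ext i j
  fin_cases i <;> fin_cases j <;> simp [blockLift]

/-- The function `m` such that an upper triangular matrix over `𝔽₂` is `blockLift 1 a c m`. -/
def blockCoord (X : Matrix (Fin 4) (Fin 4) (ZMod 2)) (s : ZMod 2 × ZMod 2) : ZMod 2 :=
  let x := X 0 2 + X 0 1 * X 1 2
  let y := X 0 3 + X 0 1 * X 1 3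
  if s.1 = 0 then if s.2 = 0 then x + y else y
  else if s.2 = 0 then X 1 2 + X 1 3 + x + y else X 1 3 + y

theorem blockLift_blockCoord {X : Matrix (Fin 4) (Fin 4) (ZMod 2)} (hX : X.BlockTriangular id)
    (hdiag : ∀ i, X i i = 1) : blockLift 1 (X 0 1) (X 2 3) (blockCoord X) = X := by
  have h2 : (2 : ZMod 2) = 0 := rfl
  have hlow {i j : Fin 4} (h : j < i) : X i j = 0 := hX h
  ext i j
  fin_cases i <;> fin_cases j <;> simp [blockLift, blockCoord, hlow, hdiag, h2]
  all_goals ring_nf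
  all_goals reduce_mod_char

theorem blockCoord_blockLift (a c : ZMod 2) (m : ZMod 2 × ZMod 2 → ZMod 2) :
    blockCoord (blockLift 1 a c m) = m := by
  have h2 : (2 : ZMod 2) = 0 := rfl
  ext ⟨i, j⟩
  rcases zmod_two_eq_zero_or_one i with rfl | rfl <;> rcases zmod_two_eq_zero_or_one j with rfl | rfl <;>
    simp [blockLift, blockCoord, h2]
  all_goals ring_nf
  all_goals reduce_mod_char

theorem blockLift_blockTriangular {R : Type*} [CommRing R] (χ : R) (a c : ZMod 2)
    (m : ZMod 2 × ZMod 2 → R) : (blockLift χ a c m).BlockTriangular id := by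
  intro i j hij
  fin_cases i <;> fin_cases j <;> first | rfl | exact absurd hij (by decide)

theorem blockLift_map (χ : ZMod 4) (a c : ZMod 2) (m : ZMod 2 × ZMod 2 → ZMod 4) :
    (blockLift χ a c m).map redMod = blockLift (redMod χ) a c (redMod ∘ m) := by
  have hval (x : ZMod 2) : redMod (x.val : ZMod 4) = (x.val : ZMod 2) := map_natCast _ _
  ext i j
  fin_cases i <;> fin_cases j <;>
    simp only [blockLift, Matrix.map_apply, Matrix.of_apply, Matrix.cons_val, map_add, map_sub,
      map_mul, map_one, map_zero, map_ofNat, hval, Function.comp_apply, Fin.mk_one, Fin.zero_eta,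
      Fin.reduceFinMk]

theorem exists_lift_upperTriangular_four {F L : Type*} [Field F] [Field L] [Algebra F L] [Normal F L]
    [IsAlgClosed L] (σ : Gal(L/F) →* Matrix (Fin 4) (Fin 4) (ZMod 2))
    (hσ : ∀ g, (σ g).BlockTriangular id) (hσ1 : ∀ᶠ g in nhds 1, σ g = 1) :
    ∃ σ' : Gal(L/F) →* Matrix (Fin 4) (Fin 4) (ZMod 4), (∀ g, (σ' g).BlockTriangular id) ∧
      (∀ g, (σ' g).map redMod = σ g) ∧ ∀ᶠ g in nhds 1, σ' g = 1 := by
  have hdiag (g i) : σ g i i = 1 := by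
    have hdet : IsUnit (σ g).det := ((Group.isUnit g).map σ).map Matrix.detMonoidHom
    rw [Matrix.det_of_isUpperTriangular (hσ g), IsUnit.prod_univ_iff] at hdet
    exact (zmod_two_eq_zero_or_one _).resolve_left (hdet i).ne_zero
  have hform (g) := blockLift_blockCoord (hσ g) (hdiag g)
  have hmul (g h) : σ (g * h) = blockLift 1 (σ g 0 1 + σ h 0 1) (σ g 2 3 + σ h 2 3)
      fun s ↦ blockCoord (σ h) s + blockCoord (σ g) (s + (σ h 0 1, σ h 2 3)) := by
    rw [map_mul, ← hform g, ← hform h, blockLift_mul]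
    simp only [one_mul, hform]
  have ha (g h) : σ (g * h) 0 1 = σ g 0 1 + σ h 0 1 := by
    rw [hmul]; simp [blockLift]
  have hc (g h) : σ (g * h) 2 3 = σ g 2 3 + σ h 2 3 := by
    rw [hmul]; simp [blockLift]
  let : MulAction Gal(L/F) (ZMod 2 × ZMod 2) :=
    { smul := fun g s ↦ s + (σ g 0 1, σ g 2 3)
      one_smul := fun s ↦ by
        change s + (σ 1 0 1, σ 1 2 3) = s
        simp
      mul_smul := fun g h s ↦ by
        change s + (σ (g * h) 0 1, σ (g * h) 2 3) = s + (σ h 0 1, σ h 2 3) + (σ g 0 1, σ g 2 3)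
        rw [ha, hc, add_assoc, ← Prod.mk_add_mk, add_comm (σ h 0 1, _)] }
  have hsmul (g : Gal(L/F)) (s : ZMod 2 × ZMod 2) : g • s = s + (σ g 0 1, σ g 2 3) := rfl
  let φ (g : Gal(L/F)) := blockCoord (σ g)
  have hφ : IsSetCocycle φ := fun g h s ↦ by
    simp only [φ, hmul, blockCoord_blockLift, hsmul]
  have htriv {g} (hg : σ g = 1) (s : ZMod 2 × ZMod 2) : g • s = s ∧ φ g s = 0 := by
    refine ⟨by simp [hsmul, hg], ?_⟩
    simp only [φ, hg]
    rw [← blockLift_one, blockCoord_blockLift]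
    rfl
  obtain ⟨Y, hne, hY⟩ := hφ.exists_equivariant
    fun s ↦ exists_swapped_pair (L := L) hφ hσ1 (fun g hg ↦ htriv hg) s
  obtain ⟨T⟩ : Nonempty (TwistedLift L φ) := by
    by_cases h2 : (2 : L) = 0
    · have : CharP L 2 := CharTwo.of_one_ne_zero_of_two_eq_zero one_ne_zero h2
      exact nonempty_twistedLift_of_charP_two hφ hne hY
    · exact nonempty_twistedLift_of_two_ne_zero h2 hne hY
  have hT : ∀ᶠ g : Gal(L/F) in nhds 1, ∀ x ∈ T.support, g • x = x :=
    (Filter.eventually_all_finite T.finite).2 fun x _ ↦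
      (stabilizer_isOpen_of_isIntegral (K := F) x).mem_nhds (one_mem _)
  have hev : ∀ᶠ g : Gal(L/F) in nhds 1,
      blockLift (T.χ g) (σ g 0 1) (σ g 2 3) (T.ψ g) = 1 := by
    filter_upwards [hT, hσ1] with g hg hg1
    obtain ⟨hχ, hψ⟩ := T.trivial g hg fun s ↦ (htriv hg1 s).1
    rw [hχ, show T.ψ g = 0 from funext hψ, hg1]
    exact blockLift_one
  refine ⟨⟨⟨fun g ↦ blockLift (T.χ g) (σ g 0 1) (σ g 2 3) (T.ψ g), hev.self_of_nhds⟩, fun g h ↦ ?_⟩,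
    fun g ↦ blockLift_blockTriangular _ _ _ _, fun g ↦ ?_, hev⟩
  · simp only [blockLift_mul, map_mul T.χ, ha, hc, ← hsmul, ← T.cocycle]
  · have hχ : redMod (T.χ g) = 1 :=
      (zmod_two_eq_zero_or_one _).resolve_left (((Group.isUnit g).map T.χ).map redMod).ne_zero
    rw [← hform g]
    simp only [MonoidHom.coe_mk, OneHom.coe_mk, blockLift_map, hχ]
    congr 1
    exact funext (T.reduction g)

section Corner

variable {R : Type*} [CommRing R] {n k l : ℕ}

/-- Extension of a matrix by the identity matrix. -/
def extendByOne (e : Fin n ⊕ Fin k ≃ Fin l) :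
    Matrix (Fin n) (Fin n) R →* Matrix (Fin l) (Fin l) R where
  toFun A := (Matrix.fromBlocks A 0 0 1).submatrix e.symm e.symm
  map_one' := by simp
  map_mul' A B := by simp [Matrix.submatrix_mul_equiv, Matrix.fromBlocks_multiply]

/-- The upper left corner of a matrix. -/
def corner (e : Fin n ⊕ Fin k ≃ Fin l) (A : Matrix (Fin l) (Fin l) R) : Matrix (Fin n) (Fin n) R :=
  (A.submatrix e e).toBlocks₁₁

theorem corner_extendByOne (e : Fin n ⊕ Fin k ≃ Fin l) (A : Matrix (Fin n) (Fin n) R) :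
    corner e (extendByOne e A) = A := by
  simp [corner, extendByOne]

theorem corner_one (e : Fin n ⊕ Fin k ≃ Fin l) :
    corner e (1 : Matrix (Fin l) (Fin l) R) = 1 := by
  rw [corner, Matrix.submatrix_one_equiv, ← Matrix.fromBlocks_one, Matrix.toBlocks_fromBlocks₁₁]

theorem corner_mul {e : Fin n ⊕ Fin k ≃ Fin l} (he : ∀ i j, e (.inl i) < e (.inr j))
    (A : Matrix (Fin l) (Fin l) R) {B : Matrix (Fin l) (Fin l) R} (hB : B.BlockTriangular id) :
    corner e (A * B) = corner e A * corner e B := by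
  ext i j
  simp only [corner, Matrix.toBlocks₁₁, Matrix.of_apply, Matrix.submatrix_apply, Matrix.mul_apply]
  rw [← e.sum_comp, Fintype.sum_sum_type, add_eq_left]
  exact Finset.sum_eq_zero fun x _ ↦ by rw [hB (he _ _), mul_zero]

theorem blockTriangular_corner {e : Fin n ⊕ Fin k ≃ Fin l}
    (he : StrictMono fun i ↦ e (.inl i)) {A : Matrix (Fin l) (Fin l) R}
    (hA : A.BlockTriangular id) : (corner e A).BlockTriangular id :=
  fun _ _ hij ↦ hA (he hij)

theorem blockTriangular_extendByOne {e : Fin n ⊕ Fin k ≃ Fin l} (he₁ : StrictMono fun i ↦ e (.inl i))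
    {A : Matrix (Fin n) (Fin n) R} (hA : A.BlockTriangular id) :
    (extendByOne e A).BlockTriangular id := by
  intro i j hij
  obtain ⟨i, rfl⟩ := e.surjective i
  obtain ⟨j, rfl⟩ := e.surjective j
  rcases i with i | i <;> rcases j with j | j
  · simpa [extendByOne] using hA (he₁.lt_iff_lt.1 hij)
  · simp [extendByOne]
  · simp [extendByOne]
  · simp only [extendByOne, MonoidHom.coe_mk, OneHom.coe_mk, Matrix.submatrix_apply,
      Equiv.symm_apply_apply, Matrix.fromBlocks_apply₂₂]
    exact Matrix.one_apply_ne fun h ↦ hij.ne (by rw [h])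

end Corner

theorem exists_lift_upperTriangular {F L : Type*} [Field F] [Field L] [Algebra F L] [Normal F L]
    [IsAlgClosed L] {n : ℕ} (hn : n ≤ 4) (σ : Gal(L/F) →* Matrix (Fin n) (Fin n) (ZMod 2))
    (hσ : ∀ g, (σ g).BlockTriangular id) (hσ1 : ∀ᶠ g in nhds 1, σ g = 1) :
    ∃ σ' : Gal(L/F) →* Matrix (Fin n) (Fin n) (ZMod 4), (∀ g, (σ' g).BlockTriangular id) ∧
      (∀ g, (σ' g).map redMod = σ g) ∧ ∀ᶠ g in nhds 1, σ' g = 1 := by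
  let e : Fin n ⊕ Fin (4 - n) ≃ Fin 4 := finSumFinEquiv.trans (finCongr (by omega))
  have he : StrictMono fun i ↦ e (.inl i) := fun i j hij ↦ hij
  have he' (i j) : e (.inl i) < e (.inr j) := by
    change i.val < n + j.val
    omega
  obtain ⟨τ, hτ, hred, hτ1⟩ := exists_lift_upperTriangular_four ((extendByOne e).comp σ)
    (fun g ↦ blockTriangular_extendByOne he (hσ g))
    (hσ1.mono fun g hg ↦ by rw [MonoidHom.comp_apply, hg, map_one])
  refine ⟨⟨⟨fun g ↦ corner e (τ g), ?_⟩, fun g h ↦ ?_⟩, fun g ↦ blockTriangular_corner he (hτ g),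
    fun g ↦ ?_, hτ1.mono fun g hg ↦ ?_⟩
  · rw [map_one, corner_one]
  · simp only [map_mul, corner_mul he' _ (hτ h)]
  · calc (corner e (τ g)).map redMod = corner e ((τ g).map redMod) := rfl
      _ = σ g := by rw [hred, MonoidHom.comp_apply, corner_extendByOne]
  · simp only [MonoidHom.coe_mk, OneHom.coe_mk, hg, corner_one]

/-- For every field `F` and every positive `n ≤ 4`, every continuous
homomorphism `Γ_F → B_n(F2)` lifts to `B_n(ℤ/4ℤ)`. -/
theorem b_n_f2_lifts (F : Type) [Field F] (n : ℕ) (hn : 0 < n) (hn4 : n ≤ 4)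
    (ρ : Field.absoluteGaloisGroup F →* BorelSubgroup n (ZMod 2)) (hρ : Continuous[_, ⊥] ⇑ρ) :
    ∃ ρ' : Field.absoluteGaloisGroup F →* BorelSubgroup n (ZMod 4),
      Continuous[_, ⊥] ⇑ρ' ∧
        (BorelSubgroup.map
          (ZMod.castHom (show (2 : ℕ) ∣ 4 by norm_num) (ZMod 2))).comp ρ' = ρ := by
  let σ : Field.absoluteGaloisGroup F →* Matrix (Fin n) (Fin n) (ZMod 2) :=
    (Units.coeHom _).comp ((BorelSubgroup n (ZMod 2)).subtype.comp ρ)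
  have hρ1 : ∀ᶠ g in nhds 1, ρ g = 1 := by
    let : TopologicalSpace (BorelSubgroup n (ZMod 2)) := ⊥
    have : DiscreteTopology (BorelSubgroup n (ZMod 2)) := ⟨rfl⟩
    exact hρ.continuousAt.eventually_mem ((isOpen_discrete {1}).mem_nhds (map_one ρ))
  obtain ⟨τ, hτ, hred, hτ1⟩ := exists_lift_upperTriangular (L := AlgebraicClosure F) hn4 σ
    (fun g ↦ (ρ g).2) (hρ1.mono fun g hg ↦ congrArg (fun x ↦ (x.1 : Matrix (Fin n) (Fin n) (ZMod 2))) hg)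
  let ρ' : Field.absoluteGaloisGroup F →* BorelSubgroup n (ZMod 4) :=
    τ.toHomUnits.codRestrict (BorelSubgroup n (ZMod 4)) hτ
  refine ⟨ρ', ?_, MonoidHom.ext fun g ↦ Subtype.ext (Units.ext (hred g))⟩
  let : TopologicalSpace (BorelSubgroup n (ZMod 4)) := ⊥
  have : DiscreteTopology (BorelSubgroup n (ZMod 4)) := ⟨rfl⟩
  refine continuous_of_continuousAt_one ρ' ?_
  have hev : ρ' =ᶠ[nhds 1] fun _ ↦ 1 := hτ1.mono fun g hg ↦ Subtype.ext (Units.ext hg)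
  exact continuousAt_const.congr hev.symm
end
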